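/- Let U₁ and U₂ be bounded open convex subsets of ℝ² of Lebesgue area 1, and let ψ be a potential of the optimal transport between U₁ and U₂. Then for every ε > 0 there is a constant C(ε) > 0, depending only on ε and the diameters of U₁ and U₂, such that ψ is twice differentiable at every point x ∈ U₁ and the operator norm of its Hessian satisfies ‖D²ψ(x)‖ ≤ C(ε) · dist(x, ∂U₁)^{−ε} for all x ∈ U₁. -/

import Mathlib

noncomputable section

open MeasureTheory Metric Set
open scoped RealInnerProductSpace

abbrev R2 : Type := EuclideanSpace ℝ (Fin 2)

/-- `p` is a subgradient of `f` at `x`. -/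
def SubgradAt (f : R2 → ℝ) (x p : R2) : Prop :=
  ∀ y : R2, f x + ⟪p, y - x⟫ ≤ f y

/-- `ψ` is a (canonically extended) potential of the optimal transport between `U₁` and `U₂`:
it is convex on `ℝ²`, all its subgradients lie in `closure U₂`, and its gradient map pushes
the Lebesgue measure restricted to `U₁` forward to the Lebesgue measure restricted to `U₂`. -/
def IsOTPotential (U₁ U₂ : Set R2) (ψ : R2 → ℝ) : Prop :=
  ConvexOn ℝ Set.univ ψ ∧
  (∀ x p : R2, SubgradAt ψ x p → p ∈ closure U₂) ∧
  MeasureTheory.Measure.map (fun x => gradient ψ x) (MeasureTheory.volume.restrict U₁) =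
    MeasureTheory.volume.restrict U₂

/-- `S` is a centred section of `w` at `x₀` of height `h`:
`S = {w < w x₀ + p · (· - x₀) + h}` for a slope `p` chosen so that
the centre of mass of `S` is `x₀`. -/
def IsCentredSection (w : R2 → ℝ) (x₀ : R2) (h : ℝ) (S : Set R2) : Prop :=
  ∃ p : R2, S = {x : R2 | w x < w x₀ + ⟪p, x - x₀⟫ + h} ∧
    (∫ x in S, (x - x₀) ∂(MeasureTheory.volume)) = 0

/-- Dilation of `S` about `x₀` by factor `t`. -/
def dilate (x₀ : R2) (t : ℝ) (S : Set R2) : Set R2 :=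
  (fun x => x₀ + t • (x - x₀)) '' S

/-- The (closed) ellipse centred at `0` with half-axis `A` in unit direction `e` and
half-axis `B` in the orthogonal unit direction `f`. -/
def ellipse (e f : R2) (A B : ℝ) : Set R2 :=
  {x : R2 | (⟪x, e⟫ / A) ^ 2 + (⟪x, f⟫ / B) ^ 2 ≤ 1}

/-- `w` is an Alexandrov solution of `det D² w = χ_Ω` in `ℝ²`: the Lebesgue measure of the
subdifferential image of any Borel set `E` equals the Lebesgue measure of `E ∩ Ω`. -/
def AlexandrovSol (w : R2 → ℝ) (Ω : Set R2) : Prop :=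
  ∀ E : Set R2, MeasurableSet E →
    MeasureTheory.volume (⋃ x ∈ E, {p : R2 | SubgradAt w x p}) =
      MeasureTheory.volume (E ∩ Ω)

/-- Membership of the pair `(u, v)` in the normalized family `S(δ̄)`, together with the
associated data: the domains `Ω₁, Ω₂`, and, for each height `h ∈ (0,1]`, the ellipse
`E_h = ellipse (e h) (f h) (L h) (l h)` centred at `0` (long half-axis `L h` in unit
direction `e h`, short half-axis `l h` in the orthogonal unit direction `f h`, area `hπ`,
so `L h * l h = h`), whose perpendicular ellipse is
`E_h^⊥ = ellipse (f h) (e h) (L h) (l h)`.  The eccentricity is `η_u(h) = L h / l h`. -/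
def InSFamily (δb : ℝ) (u v : R2 → ℝ) (Ω₁ Ω₂ : Set R2)
    (L l : ℝ → ℝ) (e f : ℝ → R2) : Prop :=
  ConvexOn ℝ Set.univ u ∧ ConvexOn ℝ Set.univ v ∧
  Convex ℝ Ω₁ ∧ Convex ℝ Ω₂ ∧
  (interior Ω₁).Nonempty ∧ (interior Ω₂).Nonempty ∧
  (0 : R2) ∈ frontier Ω₁ ∧ (0 : R2) ∈ frontier Ω₂ ∧
  (fun x => gradient u x) '' Ω₁ = Ω₂ ∧ (fun y => gradient v y) '' Ω₂ = Ω₁ ∧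
  AlexandrovSol u Ω₁ ∧ u 0 = 0 ∧ SubgradAt u 0 0 ∧
  AlexandrovSol v Ω₂ ∧ v 0 = 0 ∧ SubgradAt v 0 0 ∧
  (∀ y ∈ Ω₂, v y = ⨆ x : R2, (⟪x, y⟫ - u x)) ∧
  L 1 = 1 ∧ l 1 = 1 ∧
  (∀ h : ℝ, h ∈ Set.Ioc (0 : ℝ) 1 →
    ‖e h‖ = 1 ∧ ‖f h‖ = 1 ∧ ⟪e h, f h⟫ = 0 ∧
    0 < l h ∧ l h ≤ L h ∧ L h * l h = h ∧
    (∃ S : Set R2, IsCentredSection u 0 h S ∧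
      (∃ xh : R2, (fun z => xh + δb • z) '' ellipse (e h) (f h) (L h) (l h) ⊆ Ω₁ ∩ S) ∧
      S ⊆ (fun z => δb⁻¹ • z) '' ellipse (e h) (f h) (L h) (l h)) ∧
    (∃ S : Set R2, IsCentredSection v 0 h S ∧
      (∃ yh : R2, (fun z => yh + δb • z) '' ellipse (f h) (e h) (L h) (l h) ⊆ Ω₂ ∩ S) ∧
      S ⊆ (fun z => δb⁻¹ • z) '' ellipse (f h) (e h) (L h) (l h)))

/-- `z ↦ t • x` cone over `Ω` with vertex `0` (closed): the tangent cone of `Ω` at `0`. -/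
def tangentConeZero (Ω : Set R2) : Set R2 :=
  closure {y : R2 | ∃ t : ℝ, 0 ≤ t ∧ ∃ x ∈ Ω, y = t • x}

/-- The planar cross product (determinant) of two vectors. -/
def det2 (a b : R2) : ℝ := a 0 * b 1 - a 1 * b 0

/-- `r` is the unit direction of the right tangent ray of `∂Ω` at `0`:
it lies in the tangent cone of `Ω` at `0` and the whole tangent cone lies
(weakly) counterclockwise from it. -/
def IsRightTangent (Ω : Set R2) (r : R2) : Prop :=
  ‖r‖ = 1 ∧ r ∈ tangentConeZero Ω ∧ ∀ x ∈ tangentConeZero Ω, 0 ≤ det2 r x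

/-- `l` is the unit direction of the left tangent ray of `∂Ω` at `0`:
it lies in the tangent cone of `Ω` at `0` and the whole tangent cone lies
(weakly) clockwise from it. -/
def IsLeftTangent (Ω : Set R2) (l : R2) : Prop :=
  ‖l‖ = 1 ∧ l ∈ tangentConeZero Ω ∧ ∀ x ∈ tangentConeZero Ω, det2 l x ≤ 0

/-- The open cone of direction `e` and opening angle `θ`. -/
def cone2 (e : R2) (θ : ℝ) : Set R2 :=
  {y : R2 | ∃ lam : ℝ, 0 < lam ∧ ∃ w : R2, ‖w‖ = 1 ∧
    InnerProductGeometry.angle w e < θ ∧ y = lam • w}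

namespace PlanarOT

/-- The half sum `(z + G z) / 2`. -/
def wMap (G : ℂ → ℂ) (z : ℂ) : ℂ := (z + G z) / 2

/-- The half difference `(z - G z) / 2`. -/
def kMap (G : ℂ → ℂ) (z : ℂ) : ℂ := (z - G z) / 2

/-- The source point `(z + conj (G z)) / 2`, mixing the coordinates of `wMap` and `kMap`. -/
def xMap (G : ℂ → ℂ) (z : ℂ) : ℂ := ⟨(wMap G z).re, (kMap G z).im⟩

/-- The target point `(z - conj (G z)) / 2`, mixing the coordinates of `kMap` and `wMap`. -/
def pMap (G : ℂ → ℂ) (z : ℂ) : ℂ := ⟨(kMap G z).re, (wMap G z).im⟩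

section basic
variable {G : ℂ → ℂ}

@[simp] lemma xMap_re (z : ℂ) : (xMap G z).re = (wMap G z).re := rfl
@[simp] lemma xMap_im (z : ℂ) : (xMap G z).im = (kMap G z).im := rfl
@[simp] lemma pMap_re (z : ℂ) : (pMap G z).re = (kMap G z).re := rfl
@[simp] lemma pMap_im (z : ℂ) : (pMap G z).im = (wMap G z).im := rfl

lemma wMap_add_kMap (z : ℂ) : wMap G z + kMap G z = z := by
  simp only [wMap, kMap]; ring

lemma wMap_sub_kMap (z : ℂ) : wMap G z - kMap G z = G z := by
  simp only [wMap, kMap]; ring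

lemma xMap_add_pMap (z : ℂ) : xMap G z + pMap G z = z := by
  apply Complex.ext
  · simp [wMap, kMap]; ring
  · simp [wMap, kMap]; ring

lemma continuous_wMap (hG : LipschitzWith 1 G) : Continuous (wMap G) := by
  have := hG.continuous
  unfold wMap; fun_prop

lemma continuous_kMap (hG : LipschitzWith 1 G) : Continuous (kMap G) := by
  have := hG.continuous
  unfold kMap; fun_prop

lemma continuous_xMap (hG : LipschitzWith 1 G) : Continuous (xMap G) := by
  have h1 := continuous_wMap hG
  have h2 := continuous_kMap hG
  exact Complex.equivRealProdCLM.symm.continuous.comp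
    ((Complex.continuous_re.comp h1).prodMk (Complex.continuous_im.comp h2))

lemma continuous_pMap (hG : LipschitzWith 1 G) : Continuous (pMap G) := by
  have h1 := continuous_wMap hG
  have h2 := continuous_kMap hG
  exact Complex.equivRealProdCLM.symm.continuous.comp
    ((Complex.continuous_re.comp h2).prodMk (Complex.continuous_im.comp h1))

/-- The polarised identity behind the monotonicity of `xMap` and `pMap`. -/
lemma normSq_sub_normSq (z z' : ℂ) :
    ‖z - z'‖ ^ 2 - ‖G z - G z'‖ ^ 2 =
      4 * (((wMap G z).re - (wMap G z').re) * ((kMap G z).re - (kMap G z').re)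
        + ((wMap G z).im - (wMap G z').im) * ((kMap G z).im - (kMap G z').im)) := by
  rw [← Complex.normSq_eq_norm_sq, ← Complex.normSq_eq_norm_sq, Complex.normSq_apply,
    Complex.normSq_apply]
  simp [wMap, kMap]; ring

lemma monotone_of_lipschitz (hG : LipschitzWith 1 G) (z z' : ℂ) :
    0 ≤ ((wMap G z).re - (wMap G z').re) * ((kMap G z).re - (kMap G z').re)
        + ((wMap G z).im - (wMap G z').im) * ((kMap G z).im - (kMap G z').im) := by
  have h := hG.norm_sub_le z z'
  have h2 := normSq_sub_normSq (G := G) z z'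
  simp at h
  have := pow_le_pow_left₀ (norm_nonneg _) h 2
  linarith

lemma monotone_strict {z z' : ℂ} (h : ‖G z - G z'‖ < ‖z - z'‖) :
    0 < ((wMap G z).re - (wMap G z').re) * ((kMap G z).re - (kMap G z').re)
        + ((wMap G z).im - (wMap G z').im) * ((kMap G z).im - (kMap G z').im) := by
  have h2 := normSq_sub_normSq (G := G) z z'
  have := pow_lt_pow_left₀ h (norm_nonneg _) two_ne_zero
  linarith

end basic

/-- Maximum principle on an unbounded open set, with boundary control through a continuous
majorant. -/
lemma norm_le_of_majorant {Ω : Set ℂ} (hΩ : IsOpen Ω) {h : ℂ → ℂ} {b : ℂ → ℝ} {C : ℝ}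
    (hh : DifferentiableOn ℂ h Ω) (hb : ContinuousOn b (closure Ω))
    (hle : ∀ z ∈ Ω, ‖h z‖ ≤ b z) (hfr : ∀ z ∈ frontier Ω, b z ≤ C)
    (hinf : ∃ R : ℝ, ∀ z ∈ Ω, R ≤ ‖z‖ → ‖h z‖ ≤ C) {z : ℂ} (hz : z ∈ Ω) : ‖h z‖ ≤ C := by
  refine le_of_forall_pos_le_add fun δ hδ => ?_
  by_contra hcon
  push Not at hcon
  obtain ⟨R, hR⟩ := hinf
  set R' := max R ‖z‖ + 1
  set U : Set ℂ := {x | x ∈ Ω ∧ C + δ < b x} ∩ ball 0 R'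
  have hsub : closure U ⊆ Ω ∧ closure U ⊆ {x | C + δ ≤ b x} := by
    have h1 : closure U ⊆ closure Ω := closure_mono (fun x hx => hx.1.1)
    have h2 : closure U ⊆ {x | C + δ ≤ b x} := by
      intro x hx
      have hxΩ := h1 hx
      have : ContinuousWithinAt b U x := (hb x hxΩ).mono (fun y hy => subset_closure hy.1.1)
      have := mem_closure_iff_nhdsWithin_neBot.1 hx
      exact ge_of_tendsto ‹ContinuousWithinAt b U x›.tendsto
        (by filter_upwards [self_mem_nhdsWithin] with y hy using hy.1.2.le)
    refine ⟨fun x hx => ?_, h2⟩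
    by_contra hxn
    have : x ∈ frontier Ω := ⟨h1 hx, by rwa [hΩ.interior_eq]⟩
    have h3 := hfr x this
    have h4 : C + δ ≤ b x := h2 hx
    linarith
  have hUopen : IsOpen {x | x ∈ Ω ∧ C + δ < b x} := by
    have := (hb.mono subset_closure).isOpen_inter_preimage hΩ (isOpen_Ioi (a := C + δ))
    exact this
  have hUo : IsOpen U := hUopen.inter isOpen_ball
  have hUb : Bornology.IsBounded U := isBounded_ball.subset inter_subset_right
  have hd : DiffContOnCl ℂ h U :=
    ⟨hh.mono (fun x hx => hx.1.1), hh.continuousOn.mono hsub.1⟩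
  have hzU : z ∈ U := by
    refine ⟨⟨hz, lt_of_lt_of_le hcon (hle z hz)⟩, ?_⟩
    simp [R']
    exact lt_of_le_of_lt (le_max_right R _) (lt_add_one _)
  have := Complex.norm_le_of_forall_mem_frontier_norm_le hUb hd (C := C + δ) (by
    intro x hx
    have hxcl : x ∈ closure U := hx.1
    have hxΩ := hsub.1 hxcl
    have hxU : x ∉ U := by
      have := hx.2; rwa [hUo.interior_eq] at this
    by_cases hxR : R ≤ ‖x‖
    · linarith [hR x hxΩ hxR]
    · have : x ∈ ball (0:ℂ) R' := by
        simp [R']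
        exact lt_of_lt_of_le (not_le.1 hxR) ((le_max_left R ‖z‖).trans (by linarith))
      have hbx : b x ≤ C + δ := by
        by_contra hne
        exact hxU ⟨⟨hxΩ, not_le.1 hne⟩, this⟩
      exact (hle x hxΩ).trans hbx) (subset_closure hzU)
  linarith

/-- Phragmén–Lindelöf principle with a comparison function. -/
lemma re_nonpos_of_comparison {V : Set ℂ} (hV : IsOpen V) {Ψ Θ : ℂ → ℂ}
    (hΨ : DifferentiableOn ℂ Ψ V) (hΨc : ContinuousOn Ψ (closure V))
    (hΘ : DifferentiableOn ℂ Θ V) (hΘc : ContinuousOn Θ (closure V))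
    (hfr : ∀ z ∈ frontier V, (Ψ z).re ≤ 0) (hpos : ∀ z ∈ closure V, 0 ≤ (Θ z).re)
    (hinf : ∀ κ : ℝ, 0 < κ → ∃ R : ℝ, ∀ z ∈ V, R ≤ ‖z‖ → (Ψ z).re ≤ κ * (Θ z).re)
    {z : ℂ} (hz : z ∈ V) : (Ψ z).re ≤ 0 := by
  have key : ∀ κ : ℝ, 0 < κ → (Ψ z).re ≤ κ * (Θ z).re := by
    intro κ hκ
    have hn : ∀ y, ‖Complex.exp (Ψ y - κ * Θ y)‖ = Real.exp ((Ψ y).re - κ * (Θ y).re) := by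
      intro y; rw [Complex.norm_exp]; simp
    have := norm_le_of_majorant hV (h := fun y => Complex.exp (Ψ y - κ * Θ y))
      (b := fun y => ‖Complex.exp (Ψ y - κ * Θ y)‖) (C := 1)
      ((hΨ.sub (hΘ.const_mul _)).cexp)
      ((hΨc.sub (hΘc.const_smul (κ:ℂ))).cexp.norm) (fun _ _ => le_rfl)
      (by
        intro y hy
        rw [hn, Real.exp_le_one_iff]
        have := hpos y hy.1
        have := hfr y hy
        nlinarith)
      (by
        obtain ⟨R, hR⟩ := hinf κ hκ
        refine ⟨R, fun y hy hy2 => ?_⟩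
        rw [hn, Real.exp_le_one_iff]
        linarith [hR y hy hy2]) hz
    rw [hn, Real.exp_le_one_iff] at this
    linarith
  by_contra hcon
  push Not at hcon
  have h0 := hpos z (subset_closure hz)
  have := key ((Ψ z).re / (2 * ((Θ z).re + 1))) (by positivity)
  have h3 : (Ψ z).re / (2 * ((Θ z).re + 1)) * (Θ z).re ≤ (Ψ z).re / 2 := by
    rw [div_mul_eq_mul_div, div_le_div_iff₀ (by positivity) (by positivity)]
    nlinarith
  linarith

end PlanarOT

namespace PlanarOT

/-- `y` has an argument of absolute value at most `α`. -/
def InSector (α : ℝ) (y : ℂ) : Prop :=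
  ∃ θ : ℝ, |θ| ≤ α ∧ y = ‖y‖ * Complex.exp (θ * Complex.I)

lemma inSector_one : InSector 0 1 := ⟨0, by simp, by simp⟩

lemma InSector.mono {α β : ℝ} (h : α ≤ β) {y : ℂ} (hy : InSector α y) : InSector β y := by
  obtain ⟨θ, h1, h2⟩ := hy
  exact ⟨θ, h1.trans h, h2⟩

lemma InSector.mul {α β : ℝ} {x y : ℂ} (hx : InSector α x) (hy : InSector β y) :
    InSector (α + β) (x * y) := by
  obtain ⟨θ, h1, h2⟩ := hx
  obtain ⟨θ', h1', h2'⟩ := hy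
  refine ⟨θ + θ', (abs_add_le _ _).trans (add_le_add h1 h1'), ?_⟩
  rw [norm_mul]
  conv_lhs => rw [h2, h2']
  push_cast
  rw [add_mul, Complex.exp_add]; ring

lemma cpow_eq_polar (x : ℂ) (b : ℝ) :
    x ^ (b : ℂ) = (‖x‖ ^ b : ℝ) * Complex.exp ((b * x.arg : ℝ) * Complex.I) := by
  apply Complex.ext
  · rw [Complex.cpow_ofReal_re, Complex.re_ofReal_mul, Complex.exp_ofReal_mul_I_re, mul_comm b]
  · rw [Complex.cpow_ofReal_im, Complex.im_ofReal_mul, Complex.exp_ofReal_mul_I_im, mul_comm b]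

lemma norm_cpow_ofReal (x : ℂ) (b : ℝ) : ‖x ^ (b : ℂ)‖ = ‖x‖ ^ b := by
  rw [cpow_eq_polar x b, norm_mul, Complex.norm_exp_ofReal_mul_I, mul_one,
    Complex.norm_real, Real.norm_of_nonneg (by positivity)]

lemma inSector_cpow {x : ℂ} {b α : ℝ} (hb : 0 < b) (hx : |x.arg| ≤ α) :
    InSector (b * α) (x ^ (b : ℂ)) := by
  refine ⟨b * x.arg, ?_, ?_⟩
  · rw [abs_mul, abs_of_pos hb]; gcongr
  · rw [norm_cpow_ofReal x b]; exact cpow_eq_polar x b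

lemma InSector.re_cpow_mul {α : ℝ} {y : ℂ} (hy : InSector α y) (x : ℂ) (a : ℝ) :
    ∃ θ : ℝ, |θ| ≤ α ∧ (x ^ (a : ℂ) * y).re = ‖x‖ ^ a * ‖y‖ * Real.cos (a * x.arg + θ) := by
  obtain ⟨θ, h1, h2⟩ := hy
  refine ⟨θ, h1, ?_⟩
  have : x ^ (a : ℂ) * y =
      ((‖x‖ ^ a * ‖y‖ : ℝ) : ℂ) * Complex.exp ((a * x.arg + θ : ℝ) * Complex.I) := by
    rw [cpow_eq_polar x a]
    conv_lhs => rw [h2]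
    push_cast
    rw [add_mul, Complex.exp_add]; ring
  rw [this, Complex.re_ofReal_mul, Complex.exp_ofReal_mul_I_re]

lemma abs_arg_le_arccos {x : ℂ} {q : ℝ} (hx : x ≠ 0) (h : q * ‖x‖ ≤ x.re) :
    |x.arg| ≤ Real.arccos q := by
  have h1 : q ≤ Real.cos |x.arg| := by
    rw [Real.cos_abs, Complex.cos_arg hx, le_div_iff₀ (norm_pos_iff.2 hx)]; exact h
  have h2 := Real.arccos_le_arccos h1
  rwa [Real.arccos_cos (abs_nonneg _) (Complex.abs_arg_le_pi _)] at h2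

lemma re_cpow_ge {x : ℂ} {q m : ℝ} (hm : 0 < m) (hq : m * Real.arccos q ≤ Real.pi)
    (h : q * ‖x‖ ≤ x.re) :
    Real.cos (m * Real.arccos q) * ‖x‖ ^ m ≤ (x ^ (m : ℂ)).re := by
  rcases eq_or_ne x 0 with rfl | hx
  · simp [Real.zero_rpow hm.ne', Complex.zero_cpow (Complex.ofReal_ne_zero.2 hm.ne')]
  rw [Complex.cpow_ofReal_re, mul_comm]
  refine mul_le_mul_of_nonneg_left ?_ (by positivity)
  rw [← Real.cos_abs (x.arg * m), abs_mul, abs_of_pos hm, mul_comm |x.arg|]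
  apply Real.cos_le_cos_of_nonneg_of_le_pi (by positivity) hq
  gcongr
  exact abs_arg_le_arccos hx h

lemma continuousOn_cpow_of_re_nonneg {f : ℂ → ℂ} {s : Set ℂ} {b : ℝ} (hb : 0 < b)
    (hf : ContinuousOn f s) (h : ∀ z ∈ s, 0 ≤ (f z).re ∨ (f z).im ≠ 0) :
    ContinuousOn (fun z => f z ^ (b : ℂ)) s := fun z hz =>
  (Complex.continuousAt_cpow_const_of_re_pos (h z hz) (by simpa using hb)).comp_continuousWithinAt
    (hf z hz)

lemma differentiableOn_cpow {f : ℂ → ℂ} {s : Set ℂ} {b : ℝ}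
    (hf : DifferentiableOn ℂ f s) (h : ∀ z ∈ s, f z ∈ Complex.slitPlane) :
    DifferentiableOn ℂ (fun z => f z ^ (b : ℂ)) s := fun z hz =>
  (hf z hz).cpow_const (h z hz)

/-- Sublinearity of `y ↦ y ^ (1 - ε)`. -/
lemma rpow_le_mul_add {ε δ : ℝ} (hε : 0 < ε) (hε1 : ε < 1) (hδ : 0 < δ) :
    ∃ C : ℝ, 0 ≤ C ∧ ∀ y : ℝ, 0 ≤ y → y ^ (1 - ε) ≤ δ * y + C := by
  set Y := δ ^ (-1 / ε)
  have hY : 0 < Y := by positivity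
  refine ⟨Y ^ (1 - ε), by positivity, fun y hy => ?_⟩
  rcases le_total y Y with h | h
  · have : y ^ (1 - ε) ≤ Y ^ (1 - ε) := Real.rpow_le_rpow hy h (by linarith)
    have := mul_nonneg hδ.le hy
    linarith
  · have hy0 : 0 < y := hY.trans_le h
    have h1 : y ^ (1 - ε) = y ^ (-ε) * y := by
      rw [sub_eq_add_neg, add_comm, Real.rpow_add_one hy0.ne']
    have h2 : y ^ (-ε) ≤ Y ^ (-ε) := Real.rpow_le_rpow_of_nonpos hY h (by linarith)
    have h3 : Y ^ (-ε) = δ := by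
      rw [← Real.rpow_mul hδ.le]
      have : -1 / ε * -ε = 1 := by field_simp
      rw [this, Real.rpow_one]
    have : y ^ (1 - ε) ≤ δ * y := by
      rw [h1, ← h3]; gcongr
    have : 0 ≤ Y ^ (1 - ε) := by positivity
    linarith

/-- A power of lower order is eventually dominated. -/
lemma exists_rpow_le {a m C c κ : ℝ} (ha : 0 < a) (ham : a < m) (hc : 0 < c) (hκ : 0 < κ) :
    ∃ R : ℝ, ∀ r, R ≤ r → C * (r + 1) ^ a ≤ κ * (c * r ^ m) := by
  have h1 : (fun r : ℝ => (r + 1) ^ a) =O[Filter.atTop] fun r : ℝ => r ^ a := by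
    refine Asymptotics.IsBigO.of_bound ((2:ℝ) ^ a) ?_
    filter_upwards [Filter.eventually_ge_atTop 1] with r hr
    rw [Real.norm_of_nonneg (by positivity), Real.norm_of_nonneg (by positivity),
      ← Real.mul_rpow (by norm_num) (by linarith)]
    exact Real.rpow_le_rpow (by linarith) (by linarith) ha.le
  have h2 : (fun r : ℝ => r ^ a) =o[Filter.atTop] fun r : ℝ => r ^ m := by
    refine (Asymptotics.isLittleO_iff_tendsto' ?_).2 ?_
    · filter_upwards [Filter.eventually_gt_atTop 0] with r hr h
      exact absurd h (Real.rpow_pos_of_pos hr _).ne'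
    · refine (tendsto_rpow_neg_atTop (sub_pos.2 ham)).congr' ?_
      filter_upwards [Filter.eventually_gt_atTop 0] with r hr
      rw [← Real.rpow_sub hr]; congr 1; ring
  have h3 := (h1.const_mul_left C).trans_isLittleO h2
  have h4 := h3.def (c := κ * c) (by positivity)
  obtain ⟨R, hR⟩ := Filter.eventually_atTop.1 h4
  refine ⟨max R 1, fun r hr => ?_⟩
  have h5 := hR r ((le_max_left _ _).trans hr)
  have : (0:ℝ) ≤ r := by linarith [le_max_right R 1]
  rw [Real.norm_of_nonneg (by positivity : 0 ≤ r ^ m)] at h5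
  linarith [le_abs_self (C * (r + 1) ^ a), Real.norm_eq_abs (C * (r + 1) ^ a)]

end PlanarOT

namespace PlanarOT

/-- A limit configuration of the transport problem: `G` is holomorphic on `Ω`, the maps `xMap G`
and `pMap G` send `Ω` into the interiors of the convex sets `A` and `B` and the frontier of `Ω`
into their boundaries, and `kMap G` grows at most like the power `1 - ε` of `wMap G`. -/
structure LimitBase (ε : ℝ) (G : ℂ → ℂ) (A B Ω : Set ℂ) : Prop where
  ε_pos : 0 < ε
  ε_lt : ε < 1
  lip : LipschitzWith 1 G
  closedA : IsClosed A
  closedB : IsClosed B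
  convexA : Convex ℝ A
  convexB : Convex ℝ B
  isOpen : IsOpen Ω
  conn : IsPreconnected Ω
  nonempty : Ω.Nonempty
  diff : DifferentiableOn ℂ G Ω
  strict : ∀ z ∈ Ω, ∀ z', z' ≠ z → ‖G z - G z'‖ < ‖z - z'‖
  xMap_mem : ∀ z ∈ Ω, xMap G z ∈ interior A
  pMap_mem : ∀ z ∈ Ω, pMap G z ∈ interior B
  xMap_frontier : ∀ z ∈ frontier Ω, xMap G z ∈ A ∧ xMap G z ∉ interior A
  pMap_frontier : ∀ z ∈ frontier Ω, pMap G z ∈ B ∧ pMap G z ∉ interior B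
  growth : ∀ z ∈ closure Ω, ∀ z' ∈ closure Ω,
    ‖kMap G z - kMap G z'‖ ≤ (‖wMap G z - wMap G z'‖ + 1) ^ (1 - ε)

/-- `A` is stable under translations by nonnegative multiples of `c`. -/
def Recedes (A : Set ℂ) (c : ℂ) : Prop := ∀ a ∈ A, ∀ T : ℝ, 0 ≤ T → a + T * c ∈ A

/-- A limit configuration in which `A` recedes to the left and `B` recedes downwards. -/
structure LimitConfig (ε : ℝ) (G : ℂ → ℂ) (A B Ω : Set ℂ) : Prop
    extends LimitBase ε G A B Ω where
  leftA : Recedes A (-1)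
  downB : Recedes B (-Complex.I)

/-- The interior of a receding set recedes. -/
lemma Recedes.recedes_interior {A : Set ℂ} {c : ℂ} (h : Recedes A c) : Recedes (interior A) c := by
  intro a ha T hT
  have h1 : (fun x => x + T * c) '' interior A ⊆ interior A := by
    apply interior_maximal
    · rintro _ ⟨x, hx, rfl⟩; exact h x (interior_subset hx) T hT
    · exact (Homeomorph.addRight (T * c)).isOpenMap _ isOpen_interior
  exact h1 ⟨a, ha, rfl⟩

lemma forall_lt_or_forall_gt {Ω : Set ℂ} (hΩ : IsPreconnected Ω) {f : ℂ → ℝ}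
    (hf : Continuous f) {c : ℝ} (h : ∀ z ∈ Ω, f z ≠ c) :
    (∀ z ∈ Ω, f z < c) ∨ (∀ z ∈ Ω, c < f z) := by
  by_contra hcon
  push Not at hcon
  obtain ⟨⟨a, ha, ha'⟩, b, hb, hb'⟩ := hcon
  obtain ⟨y, hy, hy'⟩ := hΩ.intermediate_value hb ha hf.continuousOn ⟨hb', ha'⟩
  exact h y hy hy'

lemma eq_csSup_of_mem_closure {Ω : Set ℂ} {f : ℂ → ℝ} (hf : Continuous f) {P : ℂ}
    (hP : P ∈ closure Ω) (h : ∀ z ∈ Ω, f z ≤ f P) : f P = sSup (f '' Ω) := by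
  have hne : Ω.Nonempty := closure_nonempty_iff.1 ⟨P, hP⟩
  refine (IsLUB.csSup_eq ⟨?_, ?_⟩ (hne.image f)).symm
  · rintro _ ⟨z, hz, rfl⟩; exact h z hz
  · intro b hb
    exact closure_minimal (t := {z | f z ≤ b}) (fun z hz => hb ⟨z, hz, rfl⟩)
      (isClosed_le hf continuous_const) hP

lemma eq_csInf_of_mem_closure {Ω : Set ℂ} {f : ℂ → ℝ} (hf : Continuous f) {P : ℂ}
    (hP : P ∈ closure Ω) (h : ∀ z ∈ Ω, f P ≤ f z) : f P = sInf (f '' Ω) := by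
  have hne : Ω.Nonempty := closure_nonempty_iff.1 ⟨P, hP⟩
  refine (IsGLB.csInf_eq ⟨?_, ?_⟩ (hne.image f)).symm
  · rintro _ ⟨z, hz, rfl⟩; exact h z hz
  · intro b hb
    exact closure_minimal (t := {z | b ≤ f z}) (fun z hz => hb ⟨z, hz, rfl⟩)
      (isClosed_le continuous_const hf) hP

namespace LimitConfig
variable {ε : ℝ} {G : ℂ → ℂ} {A B Ω : Set ℂ} (H : LimitConfig ε G A B Ω)
include H

lemma contW : Continuous (wMap G) := continuous_wMap H.lip
lemma contK : Continuous (kMap G) := continuous_kMap H.lip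
lemma contKre : Continuous (fun z => (kMap G z).re) := Complex.continuous_re.comp H.contK
lemma contKim : Continuous (fun z => (kMap G z).im) := Complex.continuous_im.comp H.contK

lemma diffW : DifferentiableOn ℂ (wMap G) Ω := by
  unfold wMap; exact (differentiableOn_id.add H.diff).div_const _
lemma diffK : DifferentiableOn ℂ (kMap G) Ω := by
  unfold kMap; exact (differentiableOn_id.sub H.diff).div_const _

lemma notMem_of_frontier {z : ℂ} (hz : z ∈ frontier Ω) : z ∉ Ω := by
  have := hz.2; rwa [H.isOpen.interior_eq] at this

lemma mono_strict {z z' : ℂ} (hz : z ∈ Ω) (h : z' ≠ z) :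
    0 < ((wMap G z).re - (wMap G z').re) * ((kMap G z).re - (kMap G z').re)
        + ((wMap G z).im - (wMap G z').im) * ((kMap G z).im - (kMap G z').im) :=
  monotone_strict (H.strict z hz z' h)

lemma mono_strict_frontier {z z' : ℂ} (hz : z ∈ Ω) (h : z' ∈ frontier Ω) :
    0 < ((wMap G z).re - (wMap G z').re) * ((kMap G z).re - (kMap G z').re)
        + ((wMap G z).im - (wMap G z').im) * ((kMap G z).im - (kMap G z').im) :=
  H.mono_strict hz (fun e => H.notMem_of_frontier h (e ▸ hz))

lemma ray_horizontal {z P : ℂ} (hz : z ∈ Ω) (hP : P ∈ frontier Ω)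
    (h : (kMap G z).im = (kMap G P).im) :
    (wMap G z).re < (wMap G P).re ∧ (kMap G z).re < (kMap G P).re := by
  have h1 : (wMap G z).re < (wMap G P).re := by
    by_contra hcon
    push Not at hcon
    apply (H.xMap_frontier P hP).2
    have := H.leftA.recedes_interior _ (H.xMap_mem z hz) _ (sub_nonneg.2 hcon)
    convert this using 1
    apply Complex.ext <;> simp [h]
  have h2 := H.mono_strict_frontier hz hP
  rw [h] at h2
  exact ⟨h1, by nlinarith⟩

lemma ray_vertical {z P : ℂ} (hz : z ∈ Ω) (hP : P ∈ frontier Ω)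
    (h : (kMap G z).re = (kMap G P).re) :
    (wMap G z).im < (wMap G P).im ∧ (kMap G z).im < (kMap G P).im := by
  have h1 : (wMap G z).im < (wMap G P).im := by
    by_contra hcon
    push Not at hcon
    apply (H.pMap_frontier P hP).2
    have := H.downB.recedes_interior _ (H.pMap_mem z hz) _ (sub_nonneg.2 hcon)
    convert this using 1
    apply Complex.ext <;> simp [h]
  have h2 := H.mono_strict_frontier hz hP
  rw [h] at h2
  exact ⟨h1, by nlinarith⟩

lemma slit {P : ℂ} (hP : P ∈ frontier Ω) :
    ∃ σ : ℝ, |σ| = 1 ∧ ∀ z ∈ Ω, (σ : ℂ) * (wMap G P - wMap G z) ∈ Complex.slitPlane := by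
  obtain ⟨f, hf⟩ := geometric_hahn_banach_open_point H.convexB.interior isOpen_interior
    (H.pMap_frontier P hP).2
  have hlin : ∀ z : ℂ, f z = z.re * f 1 + z.im * f Complex.I := by
    intro z
    conv_lhs => rw [← Complex.re_add_im z]
    rw [map_add, ← Complex.real_smul, ← smul_eq_mul, ← mul_one (z.re : ℂ), ← smul_eq_mul (z.re : ℂ),
      Complex.coe_smul, map_smul, map_smul]
    simp
  have key : ∀ z ∈ Ω, (wMap G z).im = (wMap G P).im →
      ((kMap G z).re - (kMap G P).re) * f 1 < 0 ∧
      0 < ((wMap G z).re - (wMap G P).re) * ((kMap G z).re - (kMap G P).re) := by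
    intro z hz h
    have h1 := hf _ (H.pMap_mem z hz)
    rw [hlin, hlin (pMap G P)] at h1
    simp only [pMap_re, pMap_im, h] at h1
    have h2 := H.mono_strict_frontier hz hP
    rw [h] at h2
    exact ⟨by linarith, by linarith⟩
  rcases le_or_gt 0 (f 1) with h0 | h0
  · refine ⟨1, by simp, fun z hz => ?_⟩
    by_cases h : (wMap G z).im = (wMap G P).im
    · obtain ⟨h1, h2⟩ := key z hz h
      left
      simp
      by_contra hcon
      push Not at hcon
      nlinarith [neg_of_mul_neg_left h1 h0]
    · right
      simp [sub_ne_zero]; exact fun h' => h h'.symm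
  · refine ⟨-1, by simp, fun z hz => ?_⟩
    by_cases h : (wMap G z).im = (wMap G P).im
    · obtain ⟨h1, h2⟩ := key z hz h
      left
      simp
      by_contra hcon
      push Not at hcon
      nlinarith [pos_of_mul_neg_left h1 h0.le]
    · right
      simp [sub_ne_zero]; exact fun h' => h h'

/-- The variation of `kMap` is at most affine in that of `wMap`, with any small slope. -/
lemma growth_small {P : ℂ} (hP : P ∈ closure Ω) {δ : ℝ} (hδ : 0 < δ) :
    ∃ C : ℝ, 0 ≤ C ∧ ∀ z ∈ closure Ω, ‖kMap G z - kMap G P‖ ≤ δ * ‖wMap G z - wMap G P‖ + C := by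
  obtain ⟨C, hC, h⟩ := rpow_le_mul_add H.ε_pos H.ε_lt hδ
  refine ⟨δ + C, by positivity, fun z hz => (H.growth z hz P hP).trans ((h _ (by positivity)).trans ?_)⟩
  linarith

lemma norm_le_wMap {P : ℂ} (hP : P ∈ closure Ω) (R : ℝ) :
    ∃ R' : ℝ, ∀ z ∈ closure Ω, R' ≤ ‖z‖ → R ≤ ‖wMap G z - wMap G P‖ := by
  obtain ⟨C, hC, h⟩ := H.growth_small hP one_pos
  refine ⟨2 * R + C + ‖P‖, fun z hz hz' => ?_⟩
  have h1 := h z hz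
  have h2 : ‖z - P‖ ≤ ‖wMap G z - wMap G P‖ + ‖kMap G z - kMap G P‖ := by
    have : z - P = (wMap G z - wMap G P) + (kMap G z - kMap G P) := by
      conv_lhs => rw [← wMap_add_kMap (G := G) z, ← wMap_add_kMap (G := G) P]
      ring
    rw [this]; exact norm_add_le _ _
  have h3 := norm_sub_norm_le z P
  linarith

lemma false_of_kMap_const (h : ∀ z ∈ Ω, ∀ z' ∈ Ω, kMap G z = kMap G z') : False := by
  obtain ⟨z, hz⟩ := H.nonempty
  obtain ⟨z', hz', hne⟩ : ∃ z' ∈ Ω, z' ≠ z := by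
    obtain ⟨r, hr, hb⟩ := Metric.isOpen_iff.1 H.isOpen z hz
    refine ⟨z + (r / 2 : ℝ), hb ?_, ?_⟩
    · simp [abs_of_pos hr]; linarith
    · simp [hr.ne']
  have h1 := H.mono_strict hz hne
  rw [h z hz z' hz'] at h1
  simp at h1

lemma frontier_nonempty : (frontier Ω).Nonempty := by
  by_contra hcon
  rw [not_nonempty_iff_eq_empty] at hcon
  have hcl : IsClopen Ω := isClopen_iff_frontier_eq_empty.2 hcon
  have huniv : Ω = univ := hcl.eq_univ H.nonempty
  subst huniv
  have hK : Differentiable ℂ (kMap G) := differentiableOn_univ.1 H.diffK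
  apply H.false_of_kMap_const
  have hder : ∀ c, deriv (kMap G) c = 0 := by
    intro c
    rw [← norm_le_zero_iff]
    refine le_of_forall_pos_le_add fun δ hδ => ?_
    rw [zero_add]
    obtain ⟨C, hC, h⟩ := H.growth_small (P := c) (by simp) (δ := δ / 4) (by positivity)
    have hR : 0 < 2 * C / δ + 1 := by positivity
    have hbd := Complex.norm_deriv_le_of_forall_mem_sphere_norm_le (f := fun z => kMap G z - kMap G c)
      (c := c) (R := 2 * C / δ + 1) (C := δ / 4 * (2 * C / δ + 1) + C) hR
      (hK.sub_const _).diffContOnCl (by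
        intro z hz
        refine (h z (by simp)).trans ?_
        have hw : ‖wMap G z - wMap G c‖ ≤ ‖z - c‖ := by
          have h1 := H.lip.norm_sub_le z c
          simp at h1
          have : wMap G z - wMap G c = ((z - c) + (G z - G c)) / 2 := by simp [wMap]; ring
          rw [this, norm_div]
          have := norm_add_le (z - c) (G z - G c)
          simp; linarith
        rw [mem_sphere_iff_norm] at hz
        rw [hz] at hw
        gcongr)
    rw [deriv_sub_const] at hbd
    refine hbd.trans ?_
    rw [div_le_iff₀ hR]
    have : δ * (2 * C / δ + 1) = 2 * C + δ := by field_simp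
    nlinarith
  intro z _ z' _
  exact is_const_of_deriv_eq_zero hK hder z z'

/-- If `kMap` takes only finitely many values on the frontier, we reach a contradiction. -/
lemma false_of_finite (hfin : (kMap G '' frontier Ω).Finite) : False := by
  obtain ⟨P, hP⟩ := H.frontier_nonempty
  obtain ⟨σ, hσ, hslit⟩ := H.slit hP
  set S := hfin.toFinset
  set F : ℂ → ℂ := fun z => ∏ c ∈ S, (kMap G z - c)
  have hFfr : ∀ z ∈ frontier Ω, F z = 0 := fun z hz =>
    Finset.prod_eq_zero (i := kMap G z) (by simp [S]; exact ⟨z, hz, rfl⟩) (by simp)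
  have hFd : DifferentiableOn ℂ F Ω := by
    apply DifferentiableOn.fun_finsetProd
    intro c _; exact H.diffK.sub_const _
  have hFc : Continuous F := by
    apply continuous_finsetProd
    intro c _; exact H.contK.sub continuous_const
  have hF : ∀ z ∈ Ω, F z = 0 := by
    have hmain : ∀ κ : ℝ, 0 < κ → ∀ δ : ℝ, 0 < δ → ∀ z ∈ Ω,
        ‖F z * Complex.exp (-κ * ((σ : ℂ) * (wMap G P - wMap G z)) ^ ((1/4 : ℝ) : ℂ))‖ ≤ δ := by
      intro κ hκ δ hδ z hz
      have hre : ∀ z ∈ Ω, Real.cos (Real.pi / 4) * ‖wMap G z - wMap G P‖ ^ (1/4 : ℝ) ≤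
          (((σ : ℂ) * (wMap G P - wMap G z)) ^ ((1/4 : ℝ) : ℂ)).re := by
        intro z hz
        have := re_cpow_ge (x := (σ : ℂ) * (wMap G P - wMap G z)) (q := -1) (m := 1/4)
          (by norm_num) (by rw [Real.arccos_neg_one]; linarith [Real.pi_pos])
          (by
            have := Complex.abs_re_le_norm ((σ : ℂ) * (wMap G P - wMap G z))
            linarith [neg_abs_le ((σ : ℂ) * (wMap G P - wMap G z)).re])
        rw [Real.arccos_neg_one, norm_mul, Complex.norm_real, Real.norm_eq_abs, hσ, one_mul,
          norm_sub_rev] at this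
        convert this using 3; ring
      have hcos : 0 < Real.cos (Real.pi / 4) := by rw [Real.cos_pi_div_four]; positivity
      have hn : ∀ z ∈ Ω, ‖F z * Complex.exp (-κ * ((σ : ℂ) * (wMap G P - wMap G z)) ^ ((1/4 : ℝ) : ℂ))‖
          ≤ ‖F z‖ * Real.exp (-κ * (Real.cos (Real.pi / 4) * ‖wMap G z - wMap G P‖ ^ (1/4 : ℝ))) := by
        intro z hz
        rw [norm_mul, Complex.norm_exp]
        gcongr
        have : (-(κ:ℂ) * ((σ : ℂ) * (wMap G P - wMap G z)) ^ ((1/4 : ℝ) : ℂ)).re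
          = -κ * (((σ : ℂ) * (wMap G P - wMap G z)) ^ ((1/4 : ℝ) : ℂ)).re := by
          rw [← Complex.ofReal_neg, Complex.re_ofReal_mul]
        rw [this]
        have := mul_le_mul_of_nonneg_left (hre z hz) hκ.le
        linarith
      refine norm_le_of_majorant H.isOpen
        (h := fun z => F z * Complex.exp (-κ * ((σ : ℂ) * (wMap G P - wMap G z)) ^ ((1/4 : ℝ) : ℂ)))
        (b := fun z => ‖F z‖) (C := δ) ?_ hFc.norm.continuousOn ?_ ?_ ?_ hz
      · refine hFd.mul (DifferentiableOn.cexp (DifferentiableOn.const_mul ?_ _))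
        exact differentiableOn_cpow ((H.diffW.const_sub _).const_mul _) hslit
      · intro z hz
        refine (hn z hz).trans (mul_le_of_le_one_right (norm_nonneg _) ?_)
        rw [Real.exp_le_one_iff]
        have : 0 ≤ κ * (Real.cos (Real.pi / 4) * ‖wMap G z - wMap G P‖ ^ (1/4 : ℝ)) := by positivity
        linarith
      · intro z hz
        simp only [hFfr z hz, norm_zero]; exact hδ.le
      · -- decay at infinity
        obtain ⟨C, hC, hgr⟩ := H.growth_small (P := P) hP.1 one_pos
        set M : ℝ := ∑ c ∈ S, ‖kMap G P - c‖
        have hFb : ∀ z ∈ Ω, ‖F z‖ ≤ (‖wMap G z - wMap G P‖ + (C + M)) ^ S.card := by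
          intro z hz
          simp only [F, norm_prod]
          rw [← Finset.prod_const]
          refine Finset.prod_le_prod (fun _ _ => norm_nonneg _) fun c hc => ?_
          have h1 := hgr z (subset_closure hz)
          have h2 : ‖kMap G P - c‖ ≤ M :=
            Finset.single_le_sum (f := fun c => ‖kMap G P - c‖) (fun _ _ => norm_nonneg _) hc
          have h3 : ‖kMap G z - c‖ ≤ ‖kMap G z - kMap G P‖ + ‖kMap G P - c‖ := by
            have := norm_add_le (kMap G z - kMap G P) (kMap G P - c)
            simpa using this
          linarith
        have hlim : Filter.Tendsto (fun r : ℝ => (r + (C + M)) ^ S.card *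
            Real.exp (-κ * (Real.cos (Real.pi / 4) * r ^ (1/4 : ℝ)))) Filter.atTop (nhds 0) := by
          have hb : 0 < κ * Real.cos (Real.pi / 4) := by positivity
          have h1 : (fun r : ℝ => (r + (C + M)) ^ S.card) =O[Filter.atTop]
              fun r : ℝ => (r ^ (1/4 : ℝ)) ^ (4 * S.card : ℝ) := by
            refine Asymptotics.IsBigO.of_bound ((2:ℝ) ^ S.card) ?_
            filter_upwards [Filter.eventually_ge_atTop |C + M|, Filter.eventually_ge_atTop 1] with r hr hr1
            have hr0 : 0 ≤ r := by linarith
            have he : (r ^ (1/4 : ℝ)) ^ (4 * S.card : ℝ) = r ^ S.card := by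
              rw [← Real.rpow_mul hr0]
              have : (1/4 : ℝ) * (4 * S.card) = S.card := by ring
              rw [this, Real.rpow_natCast]
            rw [he, norm_pow, norm_pow, ← mul_pow]
            gcongr
            rw [Real.norm_eq_abs, Real.norm_eq_abs, abs_of_nonneg hr0]
            exact (abs_add_le _ _).trans (by rw [abs_of_nonneg hr0]; linarith)
          have h2 := (isLittleO_rpow_exp_pos_mul_atTop (4 * S.card : ℝ) hb).comp_tendsto
            (tendsto_rpow_atTop (by norm_num : (0:ℝ) < 1/4))
          have h3 := h1.trans_isLittleO h2
          have h4 := h3.tendsto_div_nhds_zero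
          refine h4.congr fun r => ?_
          simp only [Function.comp]
          rw [div_eq_mul_inv, ← Real.exp_neg]
          congr 2; ring
        obtain ⟨R, hR⟩ := Filter.eventually_atTop.1 (hlim.eventually_lt_const hδ)
        obtain ⟨R', hR'⟩ := H.norm_le_wMap (P := P) hP.1 R
        refine ⟨R', fun z hz hz' => (hn z hz).trans ?_⟩
        refine le_trans ?_ (hR _ (hR' z (subset_closure hz) hz')).le
        gcongr
        exact hFb z hz
    intro z hz
    have h1 := hmain 1 one_pos
    have h2 : ‖F z * Complex.exp (-((1:ℝ):ℂ) * ((σ : ℂ) * (wMap G P - wMap G z)) ^ ((1/4 : ℝ) : ℂ))‖ ≤ 0 :=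
      le_of_forall_pos_le_add fun δ hδ => by rw [zero_add]; exact h1 δ hδ z hz
    rw [norm_le_zero_iff] at h2
    exact (mul_eq_zero.1 h2).resolve_right (Complex.exp_ne_zero _)
  apply H.false_of_kMap_const
  have hsub : kMap G '' Ω ⊆ (S : Set ℂ) := by
    rintro _ ⟨z, hz, rfl⟩
    obtain ⟨c, hc, hc'⟩ := Finset.prod_eq_zero_iff.1 (hF z hz)
    rw [sub_eq_zero.1 hc']; exact hc
  have hss := (H.conn.image _ H.contK.continuousOn)
  have : (kMap G '' Ω).Subsingleton :=
    not_nontrivial_iff.1 fun hn => (hss.infinite_of_nontrivial hn) (S.finite_toSet.subset hsub)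
  intro z hz z' hz'
  exact this ⟨z, hz, rfl⟩ ⟨z', hz', rfl⟩

end LimitConfig

end PlanarOT

namespace PlanarOT

/-- The reflection `z ↦ c * conj z`. -/
def reflect (c : Circle) : ℂ ≃ₗᵢ[ℝ] ℂ := Complex.conjLIE.trans (rotation c)

lemma reflect_apply (c : Circle) (z : ℂ) : reflect c z = c * (starRingEnd ℂ) z := by
  simp [reflect]

@[simp] lemma reflect_reflect (c : Circle) (z : ℂ) : reflect c (reflect c z) = z := by
  have : (c : ℂ) * (starRingEnd ℂ) (c : ℂ) = 1 := by
    rw [Complex.mul_conj, Circle.normSq_coe, Complex.ofReal_one]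
  rw [reflect_apply, reflect_apply, map_mul, Complex.conj_conj, ← mul_assoc, this, one_mul]

/-- Conjugation of a map by a reflection. -/
def conjBy (c : Circle) (G : ℂ → ℂ) (z : ℂ) : ℂ := reflect c (G (reflect c z))

lemma wMap_conjBy (c : Circle) (G : ℂ → ℂ) (z : ℂ) :
    wMap (conjBy c G) z = reflect c (wMap G (reflect c z)) := by
  have : wMap G (reflect c z) = (1/2 : ℝ) • (reflect c z + G (reflect c z)) := by
    rw [wMap, Complex.real_smul]; push_cast; ring
  rw [this, map_smul, map_add, reflect_reflect, wMap, conjBy, Complex.real_smul]; push_cast; ring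

lemma kMap_conjBy (c : Circle) (G : ℂ → ℂ) (z : ℂ) :
    kMap (conjBy c G) z = reflect c (kMap G (reflect c z)) := by
  have : kMap G (reflect c z) = (1/2 : ℝ) • (reflect c z - G (reflect c z)) := by
    rw [kMap, Complex.real_smul]; push_cast; ring
  rw [this, map_smul, map_sub, reflect_reflect, kMap, conjBy, Complex.real_smul]; push_cast; ring

/-- The imaginary unit as an element of the circle. -/
def circleI : Circle := ⟨Complex.I, by simp [Submonoid.unitSphere]⟩

lemma reflect_one (z : ℂ) : reflect 1 z = ⟨z.re, -z.im⟩ := by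
  rw [reflect_apply]; apply Complex.ext <;> simp

lemma reflect_neg_one (z : ℂ) : reflect (-1) z = ⟨-z.re, z.im⟩ := by
  rw [reflect_apply]; apply Complex.ext <;> simp

lemma reflect_circleI (z : ℂ) : reflect circleI z = ⟨z.im, z.re⟩ := by
  rw [reflect_apply]; apply Complex.ext <;> simp [circleI]

lemma xMap_conjBy_one (G : ℂ → ℂ) (z : ℂ) :
    xMap (conjBy 1 G) z = reflect 1 (xMap G (reflect 1 z)) := by
  apply Complex.ext <;> simp [wMap_conjBy, kMap_conjBy] <;> simp [reflect_one]

lemma pMap_conjBy_one (G : ℂ → ℂ) (z : ℂ) :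
    pMap (conjBy 1 G) z = reflect 1 (pMap G (reflect 1 z)) := by
  apply Complex.ext <;> simp [wMap_conjBy, kMap_conjBy] <;> simp [reflect_one]

lemma xMap_conjBy_neg_one (G : ℂ → ℂ) (z : ℂ) :
    xMap (conjBy (-1) G) z = reflect (-1) (xMap G (reflect (-1) z)) := by
  apply Complex.ext <;> simp [wMap_conjBy, kMap_conjBy] <;> simp [reflect_neg_one]

lemma pMap_conjBy_neg_one (G : ℂ → ℂ) (z : ℂ) :
    pMap (conjBy (-1) G) z = reflect (-1) (pMap G (reflect (-1) z)) := by
  apply Complex.ext <;> simp [wMap_conjBy, kMap_conjBy] <;> simp [reflect_neg_one]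

lemma xMap_conjBy_circleI (G : ℂ → ℂ) (z : ℂ) :
    xMap (conjBy circleI G) z = reflect circleI (pMap G (reflect circleI z)) := by
  apply Complex.ext <;> simp [wMap_conjBy, kMap_conjBy] <;> simp [reflect_circleI]

lemma pMap_conjBy_circleI (G : ℂ → ℂ) (z : ℂ) :
    pMap (conjBy circleI G) z = reflect circleI (xMap G (reflect circleI z)) := by
  apply Complex.ext <;> simp [wMap_conjBy, kMap_conjBy] <;> simp [reflect_circleI]

lemma lipschitz_conjBy (c : Circle) {G : ℂ → ℂ} (h : LipschitzWith 1 G) :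
    LipschitzWith 1 (conjBy c G) := by
  refine LipschitzWith.of_dist_le_mul fun x y => ?_
  have := h.dist_le_mul (reflect c x) (reflect c y)
  rwa [(reflect c).dist_map, ← (reflect c).dist_map (G _)] at this

lemma differentiableAt_conjBy (c : Circle) {G : ℂ → ℂ} {z : ℂ}
    (h : DifferentiableAt ℂ G (reflect c z)) : DifferentiableAt ℂ (conjBy c G) z := by
  have h1 : DifferentiableAt ℂ (fun y => G (c * y)) ((starRingEnd ℂ) z) := by
    rw [reflect_apply] at h
    exact DifferentiableAt.comp ((starRingEnd ℂ) z) h (by fun_prop)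
  have h2 := h1.conj_conj
  rw [Complex.conj_conj] at h2
  have h3 := h2.const_mul (c : ℂ)
  have h4 : conjBy c G = fun y => (c : ℂ) * ((starRingEnd ℂ) ∘ (fun y => G (c * y)) ∘
      (starRingEnd ℂ)) y := by
    ext y
    simp [conjBy, reflect_apply]
  rw [h4]; exact h3

/-- Transport of a limit configuration by a reflection, given how `xMap` and `pMap` transform. -/
lemma LimitBase.conjBy_of {ε : ℝ} {G : ℂ → ℂ} {A B Ω A' B' : Set ℂ} (H : LimitBase ε G A B Ω)
    (c : Circle) (hA' : IsClosed A') (hB' : IsClosed B') (hcA : Convex ℝ A') (hcB : Convex ℝ B')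
    (hx : ∀ z ∈ Ω, xMap (conjBy c G) (reflect c z) ∈ interior (reflect c ⁻¹' A'))
    (hp : ∀ z ∈ Ω, pMap (conjBy c G) (reflect c z) ∈ interior (reflect c ⁻¹' B'))
    (hxf : ∀ z ∈ frontier Ω, xMap (conjBy c G) (reflect c z) ∈ reflect c ⁻¹' A' ∧
      xMap (conjBy c G) (reflect c z) ∉ interior (reflect c ⁻¹' A'))
    (hpf : ∀ z ∈ frontier Ω, pMap (conjBy c G) (reflect c z) ∈ reflect c ⁻¹' B' ∧
      pMap (conjBy c G) (reflect c z) ∉ interior (reflect c ⁻¹' B')) :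
    LimitBase ε (conjBy c G) (reflect c ⁻¹' A') (reflect c ⁻¹' B') (reflect c ⁻¹' Ω) where
  ε_pos := H.ε_pos
  ε_lt := H.ε_lt
  lip := lipschitz_conjBy c H.lip
  closedA := hA'.preimage (reflect c).continuous
  closedB := hB'.preimage (reflect c).continuous
  convexA := hcA.linear_preimage (reflect c).toLinearEquiv.toLinearMap
  convexB := hcB.linear_preimage (reflect c).toLinearEquiv.toLinearMap
  isOpen := H.isOpen.preimage (reflect c).continuous
  conn := (reflect c).toHomeomorph.isPreconnected_preimage.2 H.conn
  nonempty := by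
    obtain ⟨z, hz⟩ := H.nonempty
    exact ⟨reflect c z, by simpa using hz⟩
  diff := fun z hz => (differentiableAt_conjBy c
    (H.diff.differentiableAt (H.isOpen.mem_nhds hz))).differentiableWithinAt
  strict := by
    intro z hz z' hne
    have := H.strict (reflect c z) hz (reflect c z') (fun h => hne ((reflect c).injective h))
    simpa only [conjBy, ← map_sub, LinearIsometryEquiv.norm_map] using this
  xMap_mem := fun z hz => by simpa using hx _ hz
  pMap_mem := fun z hz => by simpa using hp _ hz
  xMap_frontier := fun z hz => by
    have h : reflect c z ∈ frontier Ω := by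
      have := (reflect c).toHomeomorph.preimage_frontier Ω
      exact this.symm.subset hz
    simpa using hxf _ h
  pMap_frontier := fun z hz => by
    have h : reflect c z ∈ frontier Ω := by
      have := (reflect c).toHomeomorph.preimage_frontier Ω
      exact this.symm.subset hz
    simpa using hpf _ h
  growth := fun z hz z' hz' => by
    have h : ∀ z, z ∈ closure (reflect c ⁻¹' Ω) → reflect c z ∈ closure Ω := fun z hz =>
      ((reflect c).toHomeomorph.preimage_closure Ω).symm.subset hz
    have := H.growth _ (h z hz) _ (h z' hz')
    rw [kMap_conjBy, kMap_conjBy, wMap_conjBy, wMap_conjBy, ← map_sub, ← map_sub,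
      LinearIsometryEquiv.norm_map, LinearIsometryEquiv.norm_map]
    exact this

lemma mem_interior_preimage_reflect (c : Circle) {A : Set ℂ} {z : ℂ} :
    reflect c z ∈ interior (reflect c ⁻¹' A) ↔ z ∈ interior A := by
  have := (reflect c).toHomeomorph.preimage_interior A
  have h : interior (reflect c ⁻¹' A) = reflect c ⁻¹' interior A := this.symm
  rw [h, mem_preimage, reflect_reflect]

lemma LimitBase.conjBy {ε : ℝ} {G : ℂ → ℂ} {A B Ω : Set ℂ} (H : LimitBase ε G A B Ω)
    (c : Circle) (hx : ∀ z, xMap (conjBy c G) z = reflect c (xMap G (reflect c z)))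
    (hp : ∀ z, pMap (PlanarOT.conjBy c G) z = reflect c (pMap G (reflect c z))) :
    LimitBase ε (conjBy c G) (reflect c ⁻¹' A) (reflect c ⁻¹' B) (reflect c ⁻¹' Ω) := by
  refine H.conjBy_of c H.closedA H.closedB H.convexA H.convexB ?_ ?_ ?_ ?_
  · intro z hz
    rw [hx, reflect_reflect, mem_interior_preimage_reflect]; exact H.xMap_mem z hz
  · intro z hz
    rw [hp, reflect_reflect, mem_interior_preimage_reflect]; exact H.pMap_mem z hz
  · intro z hz
    rw [hx, reflect_reflect, mem_interior_preimage_reflect, mem_preimage, reflect_reflect]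
    exact H.xMap_frontier z hz
  · intro z hz
    rw [hp, reflect_reflect, mem_interior_preimage_reflect, mem_preimage, reflect_reflect]
    exact H.pMap_frontier z hz

lemma LimitBase.swap {ε : ℝ} {G : ℂ → ℂ} {A B Ω : Set ℂ} (H : LimitBase ε G A B Ω) :
    LimitBase ε (PlanarOT.conjBy circleI G) (reflect circleI ⁻¹' B) (reflect circleI ⁻¹' A)
      (reflect circleI ⁻¹' Ω) := by
  refine H.conjBy_of circleI H.closedB H.closedA H.convexB H.convexA ?_ ?_ ?_ ?_
  · intro z hz
    rw [xMap_conjBy_circleI, reflect_reflect, mem_interior_preimage_reflect]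
    exact H.pMap_mem z hz
  · intro z hz
    rw [pMap_conjBy_circleI, reflect_reflect, mem_interior_preimage_reflect]
    exact H.xMap_mem z hz
  · intro z hz
    rw [xMap_conjBy_circleI, reflect_reflect, mem_interior_preimage_reflect, mem_preimage,
      reflect_reflect]
    exact H.pMap_frontier z hz
  · intro z hz
    rw [pMap_conjBy_circleI, reflect_reflect, mem_interior_preimage_reflect, mem_preimage,
      reflect_reflect]
    exact H.xMap_frontier z hz

lemma Recedes.reflect {A : Set ℂ} {d : ℂ} (h : Recedes A d) (c : Circle) :
    Recedes (reflect c ⁻¹' A) (reflect c d) := by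
  intro a ha T hT
  have := h _ ha T hT
  rw [mem_preimage, map_add, ← Complex.real_smul, map_smul, reflect_reflect, Complex.real_smul]
  exact this

lemma Recedes.of_reflect {A : Set ℂ} {d : ℂ} {c : Circle}
    (h : Recedes (PlanarOT.reflect c ⁻¹' A) d) : Recedes A (PlanarOT.reflect c d) := by
  have := h.reflect c
  rwa [← preimage_comp, show (PlanarOT.reflect c ∘ PlanarOT.reflect c : ℂ → ℂ) = id from
    funext fun z => reflect_reflect c z, preimage_id] at this

lemma reflect_circleI_neg_one : reflect circleI (-1) = -Complex.I := by
  rw [reflect_circleI]; apply Complex.ext <;> simp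

lemma reflect_circleI_neg_I : reflect circleI (-Complex.I) = -1 := by
  rw [reflect_circleI]; apply Complex.ext <;> simp

lemma LimitConfig.swap {ε : ℝ} {G : ℂ → ℂ} {A B Ω : Set ℂ} (H : LimitConfig ε G A B Ω) :
    LimitConfig ε (PlanarOT.conjBy circleI G) (PlanarOT.reflect circleI ⁻¹' B)
      (PlanarOT.reflect circleI ⁻¹' A) (PlanarOT.reflect circleI ⁻¹' Ω) where
  toLimitBase := H.toLimitBase.swap
  leftA := by
    have := H.downB.reflect circleI
    rwa [reflect_circleI_neg_I] at this
  downB := by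
    have := H.leftA.reflect circleI
    rwa [reflect_circleI_neg_one] at this

/-- A closed convex set not receding to the right lies in a cone around the left half line. -/
lemma exists_re_le_of_not_recedes {A : Set ℂ} (hc : IsClosed A) (hA : Convex ℝ A)
    (h : ¬ Recedes A 1) : ∃ C : ℝ, 0 ≤ C ∧ ∀ a ∈ A, a.re ≤ C * (1 + |a.im|) := by
  by_contra hcon
  push Not at hcon
  apply h
  intro a ha T hT
  choose x hxA hx using fun n : ℕ => hcon n (Nat.cast_nonneg n)
  have hre : Filter.Tendsto (fun n => (x n).re) Filter.atTop Filter.atTop := by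
    refine Filter.tendsto_atTop_mono (fun n => ?_) tendsto_natCast_atTop_atTop
    have := hx n
    have h2 : (0:ℝ) ≤ n * |(x n).im| := by positivity
    nlinarith
  have him : Filter.Tendsto (fun n => (x n).im / (x n).re) Filter.atTop (nhds 0) := by
    refine squeeze_zero_norm' (a := fun n : ℕ => 1 / (n : ℝ)) ?_ tendsto_one_div_atTop_nhds_zero_nat
    filter_upwards [Filter.eventually_gt_atTop 0] with n hn
    have hn' : (0:ℝ) < n := by exact_mod_cast hn
    have h1 := hx n
    have h0 : 0 < (x n).re := lt_of_le_of_lt (by positivity) h1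
    rw [norm_div, Real.norm_eq_abs, Real.norm_eq_abs, abs_of_pos h0,
      div_le_div_iff₀ h0 hn']
    nlinarith
  have hinv : Filter.Tendsto (fun n => T * (x n).re⁻¹) Filter.atTop (nhds 0) := by
    simpa using (tendsto_inv_atTop_zero.comp hre).const_mul T
  have hlim : Filter.Tendsto (fun n => a + ((T * (x n).re⁻¹ : ℝ) : ℂ) * (x n - a)) Filter.atTop
      (nhds (a + T * 1)) := by
    have e1 : ∀ᶠ n in Filter.atTop, a + ((T + T * ((x n).im / (x n).re : ℝ) * Complex.I
        - ((T * (x n).re⁻¹ : ℝ) : ℂ) * a)) = a + ((T * (x n).re⁻¹ : ℝ) : ℂ) * (x n - a) := by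
      filter_upwards [hre.eventually_gt_atTop 0] with n hn
      have hne : ((x n).re : ℂ) ≠ 0 := by exact_mod_cast hn.ne'
      conv_rhs => rw [← Complex.re_add_im (x n)]
      push_cast
      simp only [Complex.add_re, Complex.ofReal_re, Complex.mul_re, Complex.ofReal_im,
        Complex.I_re, Complex.I_im, mul_zero, mul_one, sub_self, add_zero]
      field_simp
    refine Filter.Tendsto.congr' e1 ?_
    have h1 := (Complex.continuous_ofReal.tendsto 0).comp him
    have h2 := (Complex.continuous_ofReal.tendsto 0).comp hinv
    have := (((h1.const_mul (T : ℂ)).mul_const Complex.I).const_add (T : ℂ)).sub (h2.mul_const a)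
    have := this.const_add a
    simpa [Function.comp_def] using this
  refine hc.mem_of_tendsto hlim ?_
  have hev : ∀ᶠ n in Filter.atTop, T * (x n).re⁻¹ ≤ 1 := hinv.eventually_le_const one_pos
  filter_upwards [hev, hre.eventually_gt_atTop 0] with n h1 h2
  have := hA.add_smul_sub_mem ha (hxA n) (t := T * (x n).re⁻¹) ⟨by positivity, h1⟩
  rwa [Complex.real_smul] at this

namespace LimitConfig
variable {ε : ℝ} {G : ℂ → ℂ} {A B Ω : Set ℂ} (H : LimitConfig ε G A B Ω)
include H

lemma xMap_mem_closure {z : ℂ} (hz : z ∈ closure Ω) : xMap G z ∈ A :=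
  closure_minimal (t := xMap G ⁻¹' A) (fun z hz => interior_subset (s := A) (H.xMap_mem z hz))
    (H.closedA.preimage (continuous_xMap H.lip)) hz

/-- If `A` does not recede to the right, then `wMap` is nearly in the left half plane. -/
lemma sector_re (h : ¬ Recedes A 1) {δ : ℝ} (hδ : 0 < δ) :
    ∃ C : ℝ, ∀ z ∈ closure Ω, (wMap G z).re ≤ δ * |(wMap G z).im| + C := by
  obtain ⟨C, hC, hA⟩ := exists_re_le_of_not_recedes H.closedA H.convexA h
  obtain ⟨P, hP⟩ := H.nonempty
  have hP' := subset_closure hP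
  set δ' := min δ 1 / 2 with hδ'
  have hδ'0 : 0 < δ' := by positivity
  have hδ'1 : δ' ≤ 1 / 2 := by rw [hδ']; linarith [min_le_right δ 1]
  have hδ'2 : 2 * δ' ≤ δ := by rw [hδ']; linarith [min_le_left δ 1]
  obtain ⟨D, hD, hgr⟩ := H.growth_small hP' (δ := δ' / (C + 1)) (by positivity)
  set E : ℝ := C * (1 + |(kMap G P).im| + D) + δ' * ‖wMap G P‖ with hE
  refine ⟨2 * |E|, fun z hz => ?_⟩
  have h1 : (wMap G z).re ≤ C * (1 + |(kMap G z).im|) := hA _ (H.xMap_mem_closure hz)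
  have h2 := hgr z hz
  have h3 : |(kMap G z).im| ≤ |(kMap G P).im| + ‖kMap G z - kMap G P‖ := by
    have := Complex.abs_im_le_norm (kMap G z - kMap G P)
    rw [Complex.sub_im] at this
    linarith [abs_sub_abs_le_abs_sub (kMap G z).im (kMap G P).im]
  have h4 : ‖wMap G z - wMap G P‖ ≤ |(wMap G z).re| + |(wMap G z).im| + ‖wMap G P‖ :=
    (norm_sub_le _ _).trans (by gcongr; exact Complex.norm_le_abs_re_add_abs_im _)
  have h5 : C * (δ' / (C + 1) * ‖wMap G z - wMap G P‖) ≤ δ' * ‖wMap G z - wMap G P‖ := by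
    have : C * (δ' / (C + 1)) ≤ δ' := by
      rw [mul_div_assoc', div_le_iff₀ (by positivity)]; nlinarith
    calc _ = C * (δ' / (C + 1)) * ‖wMap G z - wMap G P‖ := by ring
      _ ≤ _ := by gcongr
  have h6 : (wMap G z).re ≤ E + δ' * (|(wMap G z).re| + |(wMap G z).im|) := by
    have h7 : C * |(kMap G z).im| ≤ C * (|(kMap G P).im| + (δ' / (C + 1) * ‖wMap G z - wMap G P‖ + D)) := by
      gcongr; linarith
    have h8 := mul_le_mul_of_nonneg_left h4 hδ'0.le
    rw [hE]; nlinarith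
  have h9 := le_abs_self E
  have h10 := abs_nonneg (wMap G z).im
  have h11 : 2 * δ' * |(wMap G z).im| ≤ δ * |(wMap G z).im| := by gcongr
  rcases le_total (wMap G z).re 0 with hs | hs
  · have := abs_nonneg E
    have : 0 ≤ δ * |(wMap G z).im| := by positivity
    linarith
  · rw [abs_of_nonneg hs] at h6
    nlinarith

lemma sector_im (h : ¬ Recedes B Complex.I) {δ : ℝ} (hδ : 0 < δ) :
    ∃ C : ℝ, ∀ z ∈ closure Ω, (wMap G z).im ≤ δ * |(wMap G z).re| + C := by
  have h' : ¬ Recedes (PlanarOT.reflect circleI ⁻¹' B) 1 := by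
    intro h2
    have := h2.of_reflect
    rw [reflect_circleI] at this
    exact h this
  obtain ⟨C, hC⟩ := H.swap.sector_re h' hδ
  refine ⟨C, fun z hz => ?_⟩
  have hz' : PlanarOT.reflect circleI z ∈ closure (PlanarOT.reflect circleI ⁻¹' Ω) := by
    have := ((PlanarOT.reflect circleI).toHomeomorph.preimage_closure Ω).subset
    apply this
    simpa using hz
  have := hC _ hz'
  rw [wMap_conjBy, reflect_reflect, reflect_circleI] at this
  exact this

end LimitConfig

end PlanarOT

namespace PlanarOT

lemma abs_arg_eq_arccos {x : ℂ} (hx : x ≠ 0) : |x.arg| = Real.arccos (x.re / ‖x‖) := by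
  rw [← Complex.cos_arg hx, ← Real.cos_abs,
    Real.arccos_cos (abs_nonneg _) (Complex.abs_arg_le_pi _)]

lemma InSector.re_cpow_mul_nonpos {α a : ℝ} {x y : ℂ} (hy : InSector α y)
    (h1 : Real.pi / 2 + α ≤ a * |x.arg|) (h2 : a * |x.arg| + α ≤ 3 * Real.pi / 2) (ha : 0 < a) :
    (x ^ (a : ℂ) * y).re ≤ 0 := by
  obtain ⟨θ, hθ, h⟩ := hy.re_cpow_mul x a
  rw [h]
  refine mul_nonpos_of_nonneg_of_nonpos (by positivity) ?_
  rw [← Real.cos_abs]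
  have h3 : |a * x.arg| = a * |x.arg| := by rw [abs_mul, abs_of_pos ha]
  apply Real.cos_nonpos_of_pi_div_two_le_of_le
  · have := abs_sub_abs_le_abs_sub (a * x.arg) (-θ)
    rw [abs_neg, sub_neg_eq_add] at this
    linarith
  · have := abs_add_le (a * x.arg) θ
    linarith

lemma InSector.re_cpow_mul_pos {α a : ℝ} {x y : ℂ} (hy : InSector α y)
    (h1 : a * |x.arg| + α < Real.pi / 2) (ha : 0 < a) (hx : x ≠ 0) (hy0 : y ≠ 0) :
    0 < (x ^ (a : ℂ) * y).re := by
  obtain ⟨θ, hθ, h⟩ := hy.re_cpow_mul x a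
  rw [h]
  have h3 : |a * x.arg| = a * |x.arg| := by rw [abs_mul, abs_of_pos ha]
  have h4 := abs_add_le (a * x.arg) θ
  have h5 : |a * x.arg + θ| < Real.pi / 2 := by linarith
  have := Real.cos_pos_of_mem_Ioo (abs_lt.1 h5)
  have := norm_pos_iff.2 hx
  have := norm_pos_iff.2 hy0
  positivity

namespace LimitConfig
variable {ε : ℝ} {G : ℂ → ℂ} {A B Ω : Set ℂ} (H : LimitConfig ε G A B Ω)
include H

lemma false_of_extremal (h : ∀ P ∈ frontier Ω,
    ((∀ z ∈ Ω, (kMap G z).re ≤ (kMap G P).re) ∨ (∀ z ∈ Ω, (kMap G P).re ≤ (kMap G z).re)) ∧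
    ((∀ z ∈ Ω, (kMap G z).im ≤ (kMap G P).im) ∨ (∀ z ∈ Ω, (kMap G P).im ≤ (kMap G z).im))) :
    False := by
  set f : ℂ → ℝ := fun z => (kMap G z).re
  set g : ℂ → ℝ := fun z => (kMap G z).im
  apply H.false_of_finite
  refine Set.Finite.subset (s := (fun p : ℝ × ℝ => (⟨p.1, p.2⟩ : ℂ)) ''
    (({sSup (f '' Ω), sInf (f '' Ω)} : Set ℝ) ×ˢ ({sSup (g '' Ω), sInf (g '' Ω)} : Set ℝ)))
    (Set.Finite.image _ (Set.Finite.prod (by simp) (by simp))) ?_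
  rintro _ ⟨P, hP, rfl⟩
  refine ⟨(f P, g P), ⟨?_, ?_⟩, rfl⟩
  · rcases (h P hP).1 with h1 | h1
    · left; exact eq_csSup_of_mem_closure H.contKre hP.1 h1
    · right; exact eq_csInf_of_mem_closure H.contKre hP.1 h1
  · rcases (h P hP).2 with h1 | h1
    · left; exact eq_csSup_of_mem_closure H.contKim hP.1 h1
    · right; exact eq_csInf_of_mem_closure H.contKim hP.1 h1

lemma im_ne_of_recedes (hA : Recedes A 1) {z P : ℂ} (hz : z ∈ Ω) (hP : P ∈ frontier Ω) :
    (kMap G z).im ≠ (kMap G P).im := by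
  intro h
  have h1 := (H.ray_horizontal hz hP h).1
  apply (H.xMap_frontier P hP).2
  have := hA.recedes_interior _ (H.xMap_mem z hz) _ (sub_nonneg.2 h1.le)
  convert this using 1
  apply Complex.ext <;> simp [h]

lemma re_ne_of_recedes (hB : Recedes B Complex.I) {z P : ℂ} (hz : z ∈ Ω) (hP : P ∈ frontier Ω) :
    (kMap G z).re ≠ (kMap G P).re := by
  intro h
  have h1 := (H.ray_vertical hz hP h).1
  apply (H.pMap_frontier P hP).2
  have := hB.recedes_interior _ (H.pMap_mem z hz) _ (sub_nonneg.2 h1.le)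
  convert this using 1
  apply Complex.ext <;> simp [h]

lemma false_of_recedes_both (hA : Recedes A 1) (hB : Recedes B Complex.I) : False := by
  refine H.false_of_extremal fun P hP => ⟨?_, ?_⟩
  · exact (forall_lt_or_forall_gt H.conn H.contKre fun z hz => H.re_ne_of_recedes hB hz hP).imp
      (fun h z hz => (h z hz).le) (fun h z hz => (h z hz).le)
  · exact (forall_lt_or_forall_gt H.conn H.contKim fun z hz => H.im_ne_of_recedes hA hz hP).imp
      (fun h z hz => (h z hz).le) (fun h z hz => (h z hz).le)

lemma growth_pow (S k₀ : ℂ) : ∃ C : ℝ, 0 ≤ C ∧ ∀ z ∈ closure Ω,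
    ‖kMap G z - k₀‖ ≤ C * (‖S - wMap G z‖ + 1) ^ (1 - ε) := by
  obtain ⟨P, hP⟩ := H.nonempty
  have hε := H.ε_lt
  have hP' := subset_closure hP
  set D := ‖S - wMap G P‖
  refine ⟨(D + 1) ^ (1 - ε) + ‖kMap G P - k₀‖, by positivity, fun z hz => ?_⟩
  set r := ‖S - wMap G z‖
  have h1 := H.growth z hz P hP'
  have h2 : ‖wMap G z - wMap G P‖ + 1 ≤ (D + 1) * (r + 1) := by
    have : ‖wMap G z - wMap G P‖ ≤ D + r := by
      have := norm_sub_le (S - wMap G P) (S - wMap G z)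
      simpa using this
    have : 0 ≤ D * r := by positivity
    nlinarith
  have h3 : (‖wMap G z - wMap G P‖ + 1) ^ (1 - ε) ≤ (D + 1) ^ (1 - ε) * (r + 1) ^ (1 - ε) := by
    rw [← Real.mul_rpow (by positivity) (by positivity)]
    exact Real.rpow_le_rpow (by positivity) h2 (by linarith)
  have h4 : 1 ≤ (r + 1) ^ (1 - ε) :=
    Real.one_le_rpow (by linarith [norm_nonneg (S - wMap G z)]) (by linarith)
  have h5 : ‖kMap G z - k₀‖ ≤ ‖kMap G z - kMap G P‖ + ‖kMap G P - k₀‖ := by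
    have := norm_add_le (kMap G z - kMap G P) (kMap G P - k₀)
    simpa using this
  have h6 : ‖kMap G P - k₀‖ ≤ ‖kMap G P - k₀‖ * (r + 1) ^ (1 - ε) :=
    le_mul_of_one_le_right (norm_nonneg _) h4
  rw [add_mul]; linarith

lemma norm_le_sub_wMap (S : ℂ) (R : ℝ) :
    ∃ R' : ℝ, ∀ z ∈ closure Ω, R' ≤ ‖z‖ → R ≤ ‖S - wMap G z‖ := by
  obtain ⟨P, hP⟩ := H.nonempty
  obtain ⟨R', h⟩ := H.norm_le_wMap (subset_closure hP) (R + ‖S - wMap G P‖)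
  refine ⟨R', fun z hz hz' => ?_⟩
  have h1 := h z hz hz'
  have := norm_sub_le (S - wMap G P) (S - wMap G z)
  rw [sub_sub_sub_cancel_left] at this
  linarith

/-- Phragmén–Lindelöf comparison with a power of an affine function of `wMap`. -/
lemma re_nonpos_of_sector {V : Set ℂ} (hV : IsOpen V) (hVΩ : V ⊆ Ω) {Ψ : ℂ → ℂ}
    (hΨ : DifferentiableOn ℂ Ψ V) (hΨc : ContinuousOn Ψ (closure V))
    (hfr : ∀ z ∈ frontier V, (Ψ z).re ≤ 0) {c S : ℂ} (hc : c ≠ 0) {q m a C : ℝ}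
    (hq : m * Real.arccos q < Real.pi / 2) (ha : 0 < a) (ham : a < m)
    (hsec : ∀ z ∈ closure Ω, q * ‖c * (S - wMap G z)‖ ≤ (c * (S - wMap G z)).re)
    (hslit : ∀ z ∈ closure Ω, c * (S - wMap G z) ∈ Complex.slitPlane)
    (hgr : ∀ z ∈ V, ‖Ψ z‖ ≤ C * (‖S - wMap G z‖ + 1) ^ a) {z : ℂ} (hz : z ∈ V) :
    (Ψ z).re ≤ 0 := by
  have hm : 0 < m := ha.trans ham
  have hcl : closure V ⊆ closure Ω := closure_mono hVΩ
  have hcos : 0 < Real.cos (m * Real.arccos q) :=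
    Real.cos_pos_of_mem_Ioo ⟨by
      have : 0 ≤ m * Real.arccos q := mul_nonneg hm.le (Real.arccos_nonneg _)
      linarith [Real.pi_pos], hq⟩
  have hre : ∀ z ∈ closure Ω, Real.cos (m * Real.arccos q) * ‖c * (S - wMap G z)‖ ^ m ≤
      ((c * (S - wMap G z)) ^ (m : ℂ)).re := fun z hz =>
    re_cpow_ge hm (by linarith [Real.pi_pos]) (hsec z hz)
  refine re_nonpos_of_comparison hV (Θ := fun z => (c * (S - wMap G z)) ^ (m : ℂ)) hΨ hΨc ?_ ?_ hfr
    ?_ ?_ hz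
  · exact differentiableOn_cpow (((H.diffW.mono hVΩ).const_sub _).const_mul _)
      fun z hz => hslit z (hcl (subset_closure hz))
  · have := H.contW
    refine continuousOn_cpow_of_re_nonneg hm (by fun_prop) fun z hz => ?_
    exact (hslit z (hcl hz)).imp le_of_lt id
  · intro z hz
    exact le_trans (by positivity) (hre z (hcl hz))
  · intro κ hκ
    have hcn : 0 < ‖c‖ := norm_pos_iff.2 hc
    obtain ⟨R, hR⟩ := exists_rpow_le (C := C) (c := Real.cos (m * Real.arccos q) * ‖c‖ ^ m) ha ham
      (by positivity) hκ
    obtain ⟨R', hR'⟩ := H.norm_le_sub_wMap S R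
    refine ⟨R', fun z hz hz' => ?_⟩
    have hzc := subset_closure (hVΩ hz)
    have h1 := hR _ (hR' z hzc hz')
    have h2 := hre z hzc
    rw [norm_mul, Real.mul_rpow (norm_nonneg _) (norm_nonneg _), ← mul_assoc] at h2
    calc (Ψ z).re ≤ ‖Ψ z‖ := Complex.re_le_norm _
      _ ≤ _ := (hgr z hz).trans (h1.trans (by gcongr))

end LimitConfig

end PlanarOT

namespace PlanarOT

lemma exists_arccos_lt {m q₀ : ℝ} {f : ℝ → ℝ} (hf : ContinuousAt f 0) (hf0 : f 0 = q₀)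
    (h : m * Real.arccos q₀ < Real.pi / 2) :
    ∃ δ : ℝ, 0 < δ ∧ δ < 1 ∧ m * Real.arccos (f δ) < Real.pi / 2 := by
  have hc : ContinuousAt (fun δ => m * Real.arccos (f δ)) 0 :=
    (Real.continuous_arccos.continuousAt.comp hf).const_mul m
  have h1 : ∀ᶠ δ in nhds (0:ℝ), m * Real.arccos (f δ) < Real.pi / 2 :=
    hc.eventually_lt_const (by simpa [hf0] using h)
  have h2 : ∀ᶠ δ in nhdsWithin (0:ℝ) (Ioi 0), m * Real.arccos (f δ) < Real.pi / 2 ∧ δ < 1 ∧ 0 < δ := by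
    filter_upwards [nhdsWithin_le_nhds h1, nhdsWithin_le_nhds (gt_mem_nhds one_pos),
      self_mem_nhdsWithin] with δ a b c using ⟨a, b, c⟩
  obtain ⟨δ, h3, h4, h5⟩ := h2.exists
  exact ⟨δ, h5, h4, h3⟩

namespace LimitConfig
variable {ε : ℝ} {G : ℂ → ℂ} {A B Ω : Set ℂ} (H : LimitConfig ε G A B Ω)
include H

lemma false_of_right_factor (hA : ¬ Recedes A 1) {j : ℝ} (hj : ∀ z ∈ Ω, (kMap G z).re < j)
    {E : ℂ → ℂ} (hEd : DifferentiableOn ℂ E Ω) (hEc : ContinuousOn E (closure Ω))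
    (hEs : ∀ z ∈ closure Ω, InSector (ε / 4 * (Real.pi / 2)) (E z)) (hE0 : ∀ z ∈ Ω, E z ≠ 0)
    (hEg : ∀ S : ℂ, ∃ C : ℝ, 0 ≤ C ∧
      ∀ z ∈ Ω, ‖E z‖ ≤ C * (‖S - wMap G z‖ + 1) ^ ((1 - ε) * (ε / 4)))
    (hfr : ∀ z ∈ frontier Ω, (kMap G z).re = j ∨ E z = 0) : False := by
  have hε := H.ε_pos
  have hε1 := H.ε_lt
  obtain ⟨z₁, hz₁⟩ := H.nonempty
  set η := ε / 4 with hη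
  set K₀ : ℂ := ⟨j, (kMap G z₁).im⟩
  set m := 1 - ε / 2 with hm
  have hm0 : 0 < m := by rw [hm]; linarith
  obtain ⟨δ, hδ, -, hδm⟩ := exists_arccos_lt (m := m) (q₀ := 0) (f := fun δ => -δ)
    (by fun_prop) (by simp) (by rw [Real.arccos_zero, hm]; nlinarith [Real.pi_pos])
  obtain ⟨C, hC⟩ := H.sector_re hA hδ
  set S : ℂ := ((C + 1 : ℝ) : ℂ)
  have hre : ∀ z ∈ closure Ω, 0 ≤ (K₀ - kMap G z).re := by
    intro z hz
    have : (kMap G z).re ≤ j := closure_minimal (t := {z | (kMap G z).re ≤ j})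
      (fun z hz => (hj z hz).le) (isClosed_le H.contKre continuous_const) hz
    simpa [K₀] using this
  obtain ⟨C₁, hC₁, hg₁⟩ := H.growth_pow S K₀
  obtain ⟨C₂, hC₂, hg₂⟩ := hEg S
  have hneg := H.re_nonpos_of_sector H.isOpen subset_rfl
    (Ψ := fun z => (K₀ - kMap G z) ^ ((1 + η : ℝ) : ℂ) * E z) (c := 1) (S := S) (q := -δ) (m := m)
    (a := (1 - ε) * (1 + 2 * η)) (C := C₁ ^ (1 + η) * C₂) ?_ ?_ ?_ one_ne_zero hδm ?_ ?_ ?_ ?_ ?_ hz₁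
  · refine absurd hneg (not_le.2 ((hEs z₁ (subset_closure hz₁)).re_cpow_mul_pos ?_ (by positivity)
      ?_ (hE0 z₁ hz₁)))
    · have h1 : K₀ - kMap G z₁ = ((j - (kMap G z₁).re : ℝ) : ℂ) := by
        apply Complex.ext <;> simp [K₀]
      rw [h1, Complex.arg_ofReal_of_nonneg (sub_nonneg.2 (hj z₁ hz₁).le)]
      rw [hη]; simp; nlinarith [Real.pi_pos]
    · intro h
      have := congrArg Complex.re h
      simp [K₀] at this
      linarith [hj z₁ hz₁]
  · refine (differentiableOn_cpow (H.diffK.const_sub _) fun z hz => ?_).mul hEd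
    left; simp [K₀]; exact hj z hz
  · have := H.contK
    exact (continuousOn_cpow_of_re_nonneg (by positivity) (by fun_prop)
      fun z hz => Or.inl (hre z hz)).mul hEc
  · intro z hz
    rcases hfr z hz with h | h
    · rcases eq_or_ne (K₀ - kMap G z) 0 with h0 | h0
      · have : ((1 + η : ℝ) : ℂ) ≠ 0 := Complex.ofReal_ne_zero.2 (by positivity)
        simp only [h0, Complex.zero_cpow this, zero_mul, Complex.zero_re, le_refl]
      · have harg : |(K₀ - kMap G z).arg| = Real.pi / 2 := by
          rw [abs_arg_eq_arccos h0]
          have : (K₀ - kMap G z).re = 0 := by simp [K₀, h]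
          rw [this, zero_div, Real.arccos_zero]
        refine (hEs z hz.1).re_cpow_mul_nonpos ?_ ?_ (by positivity)
        · rw [harg]; nlinarith
        · rw [harg, hη]; nlinarith [Real.pi_pos]
    · simp [h]
  · have : 0 < 1 - ε := by linarith
    positivity
  · rw [hη, hm]; nlinarith
  · intro z hz
    have h1 := hC z hz
    have h2 := Complex.abs_im_le_norm (1 * (S - wMap G z))
    simp only [one_mul, Complex.sub_im, Complex.sub_re] at h2 ⊢
    simp only [S, Complex.ofReal_im, zero_sub, abs_neg, Complex.ofReal_re] at h2 ⊢
    nlinarith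
  · intro z hz
    have h1 := hC z hz
    by_cases h : (wMap G z).im = 0
    · left; simp [S]; rw [h] at h1; simp at h1; linarith
    · right; simpa [S] using h
  · intro z hz
    set r := ‖S - wMap G z‖ + 1
    have hr : 0 < r := by positivity
    rw [norm_mul, norm_cpow_ofReal]
    have h1 : ‖K₀ - kMap G z‖ ^ (1 + η) ≤ C₁ ^ (1 + η) * r ^ ((1 - ε) * (1 + η)) := by
      rw [Real.rpow_mul hr.le, ← Real.mul_rpow hC₁ (by positivity), norm_sub_rev]
      exact Real.rpow_le_rpow (norm_nonneg _) (hg₁ z (subset_closure hz)) (by positivity)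
    calc _ ≤ (C₁ ^ (1 + η) * r ^ ((1 - ε) * (1 + η))) * (C₂ * r ^ ((1 - ε) * η)) := by
          gcongr; exact hg₂ z hz
      _ = C₁ ^ (1 + η) * C₂ * (r ^ ((1 - ε) * (1 + η)) * r ^ ((1 - ε) * η)) := by ring
      _ = _ := by rw [← Real.rpow_add hr]; congr 2; ring

lemma false_of_recedes_right (hA : ¬ Recedes A 1) (hB : Recedes B Complex.I) : False := by
  have hε := H.ε_pos
  have hε1 := H.ε_lt
  have hre : ∀ P ∈ frontier Ω, (∀ z ∈ Ω, (kMap G z).re < (kMap G P).re) ∨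
      (∀ z ∈ Ω, (kMap G P).re < (kMap G z).re) := fun P hP =>
    forall_lt_or_forall_gt H.conn H.contKre fun z hz => H.re_ne_of_recedes hB hz hP
  have him : ∀ P ∈ frontier Ω, (∀ z ∈ Ω, (kMap G P).re < (kMap G z).re) →
      (∀ z ∈ Ω, (kMap G z).im < (kMap G P).im) ∨ (∀ z ∈ Ω, (kMap G P).im < (kMap G z).im) :=
    fun P hP h => forall_lt_or_forall_gt H.conn H.contKim fun z hz h2 =>
      absurd (H.ray_horizontal hz hP h2).2 (not_lt.2 (h z hz).le)
  by_cases hright : ∃ P ∈ frontier Ω, ∀ z ∈ Ω, (kMap G z).re < (kMap G P).re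
  swap
  · push Not at hright
    refine H.false_of_extremal fun P hP => ?_
    have h1 := (hre P hP).resolve_left (fun h => by
      obtain ⟨z, hz, hz'⟩ := hright P hP; linarith [h z hz])
    exact ⟨Or.inr fun z hz => (h1 z hz).le, (him P hP h1).imp (fun h z hz => (h z hz).le)
      (fun h z hz => (h z hz).le)⟩
  obtain ⟨Q, hQ, hQΩ⟩ := hright
  have hrightval : ∀ P ∈ frontier Ω, (∀ z ∈ Ω, (kMap G z).re < (kMap G P).re) →
      (kMap G P).re = (kMap G Q).re := fun P hP h =>
    (eq_csSup_of_mem_closure H.contKre hP.1 fun z hz => (h z hz).le).trans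
      (eq_csSup_of_mem_closure H.contKre hQ.1 fun z hz => (hQΩ z hz).le).symm
  by_cases hleft : ∃ P ∈ frontier Ω, ∀ z ∈ Ω, (kMap G P).re < (kMap G z).re
  swap
  · push Not at hleft
    refine H.false_of_right_factor hA hQΩ (E := fun _ => 1) (by fun_prop) (by fun_prop) ?_ (by simp)
      ?_ ?_
    · intro z _; exact inSector_one.mono (by positivity)
    · intro S; refine ⟨1, zero_le_one, fun z _ => ?_⟩
      rw [norm_one, one_mul]
      have : 0 < 1 - ε := by linarith
      exact Real.one_le_rpow (by linarith [norm_nonneg (S - wMap G z)]) (by positivity)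
    · intro P hP
      left
      refine hrightval P hP ((hre P hP).resolve_right fun h => ?_)
      obtain ⟨z, hz, hz'⟩ := hleft P hP
      linarith [h z hz]
  obtain ⟨L, hL, hLΩ⟩ := hleft
  set j := (kMap G L).re
  set c : ℝ → ℂ := fun b => ⟨j, b⟩
  set b₁ := sSup ((fun z => (kMap G z).im) '' Ω)
  set b₂ := sInf ((fun z => (kMap G z).im) '' Ω)
  have hL' : ∀ z ∈ closure Ω, j ≤ (kMap G z).re := fun z hz =>
    closure_minimal (t := {z | j ≤ (kMap G z).re})
      (fun z hz => (hLΩ z hz).le) (isClosed_le continuous_const H.contKre) hz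
  have hcont := H.contK
  have hη : 0 < ε / 8 := by positivity
  refine H.false_of_right_factor hA hQΩ (E := fun z => (kMap G z - c b₁) ^ ((ε / 8 : ℝ) : ℂ) *
    (kMap G z - c b₂) ^ ((ε / 8 : ℝ) : ℂ)) ?_ ?_ ?_ ?_ ?_ ?_
  · refine (differentiableOn_cpow (H.diffK.sub_const _) fun z hz => ?_).mul
      (differentiableOn_cpow (H.diffK.sub_const _) fun z hz => ?_)
    · left; simpa [c] using hLΩ z hz
    · left; simpa [c] using hLΩ z hz
  · refine (continuousOn_cpow_of_re_nonneg hη (by fun_prop) fun z hz => ?_).mul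
      (continuousOn_cpow_of_re_nonneg hη (by fun_prop) fun z hz => ?_)
    · left; simpa [c] using hL' z hz
    · left; simpa [c] using hL' z hz
  · intro z hz
    have h1 : ∀ b, |(kMap G z - c b).arg| ≤ Real.pi / 2 := fun b =>
      Complex.abs_arg_le_pi_div_two_iff.2 (by simpa [c] using hL' z hz)
    have := (inSector_cpow hη (h1 b₁)).mul (inSector_cpow hη (h1 b₂))
    exact this.mono (by linarith)
  · intro z hz
    have h1 : ∀ b, kMap G z - c b ≠ 0 := by
      intro b h
      have := congrArg Complex.re h
      simp [c] at this
      linarith [hLΩ z hz]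
    exact mul_ne_zero (by simp [Complex.cpow_eq_zero_iff, h1])
      (by simp [Complex.cpow_eq_zero_iff, h1])
  · intro S
    obtain ⟨C₁, hC₁, hg₁⟩ := H.growth_pow S (c b₁)
    obtain ⟨C₂, hC₂, hg₂⟩ := H.growth_pow S (c b₂)
    refine ⟨C₁ ^ (ε / 8) * C₂ ^ (ε / 8), by positivity, fun z hz => ?_⟩
    set r := ‖S - wMap G z‖ + 1
    have hr : 0 < r := by positivity
    rw [norm_mul, norm_cpow_ofReal, norm_cpow_ofReal]
    calc _ ≤ (C₁ * r ^ (1 - ε)) ^ (ε / 8) * (C₂ * r ^ (1 - ε)) ^ (ε / 8) := by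
          gcongr
          · exact hg₁ z (subset_closure hz)
          · exact hg₂ z (subset_closure hz)
      _ = C₁ ^ (ε / 8) * C₂ ^ (ε / 8) * (r ^ ((1 - ε) * (ε / 8)) * r ^ ((1 - ε) * (ε / 8))) := by
          rw [Real.mul_rpow hC₁ (by positivity), Real.mul_rpow hC₂ (by positivity),
            Real.rpow_mul hr.le]; ring
      _ = _ := by rw [← Real.rpow_add hr]; congr 2; ring
  · intro P hP
    rcases hre P hP with h | h
    · left; exact hrightval P hP h
    · right
      have hne : ((ε / 8 : ℝ) : ℂ) ≠ 0 := Complex.ofReal_ne_zero.2 hη.ne'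
      have hj : (kMap G P).re = j :=
        (eq_csInf_of_mem_closure H.contKre hP.1 fun z hz => (h z hz).le).trans
          (eq_csInf_of_mem_closure H.contKre hL.1 fun z hz => (hLΩ z hz).le).symm
      rcases him P hP h with h2 | h2
      · have h3 := eq_csSup_of_mem_closure H.contKim hP.1 fun z hz => (h2 z hz).le
        have : kMap G P - c b₁ = 0 := by
          apply Complex.ext
          · simp [c, hj]
          · simpa [c, sub_eq_zero] using h3
        simp only [this, Complex.zero_cpow hne, zero_mul]
      · have h3 := eq_csInf_of_mem_closure H.contKim hP.1 fun z hz => (h2 z hz).le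
        have : kMap G P - c b₂ = 0 := by
          apply Complex.ext
          · simp [c, hj]
          · simpa [c, sub_eq_zero] using h3
        simp only [this, Complex.zero_cpow hne, mul_zero]

end LimitConfig

end PlanarOT

namespace PlanarOT

lemma sector_of_abs_le {δ a b : ℝ} (hδ : 0 < δ) (hδ1 : δ < 1) (ha : -(δ * |b|) + 1 ≤ a)
    (hb : -(δ * |a|) + 1 ≤ b) :
    0 < a + b ∧ (1 - δ) * (|a| + |b|) ≤ (1 + δ) * (a + b) := by
  rcases abs_cases a with ⟨h1, h2⟩ | ⟨h1, h2⟩ <;> rcases abs_cases b with ⟨h3, h4⟩ | ⟨h3, h4⟩ <;>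
    rw [h1] at hb ⊢ <;> rw [h3] at ha ⊢ <;> constructor <;> nlinarith

lemma norm_one_sub_I : ‖1 - Complex.I‖ = √2 := by
  rw [Complex.norm_def, Complex.normSq_apply]; norm_num

lemma norm_one_sub_I_mul (z : ℂ) : ‖(1 - Complex.I) * z‖ = √2 * ‖z‖ := by
  rw [norm_mul, norm_one_sub_I]

lemma re_one_sub_I_mul (z : ℂ) : ((1 - Complex.I) * z).re = z.re + z.im := by simp

lemma one_sub_I_ne_zero : (1 - Complex.I) ≠ 0 := by
  intro h; have := congrArg Complex.re h; simp at this

lemma arccos_sqrt_two_div_two : Real.arccos (√2 / 2) = Real.pi / 4 := by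
  rw [← Real.cos_pi_div_four, Real.arccos_cos] <;> linarith [Real.pi_pos]

lemma abs_arg_quadrant_le {z : ℂ} (h1 : 0 ≤ z.re) (h2 : 0 ≤ z.im) :
    |((1 - Complex.I) * z).arg| ≤ Real.pi / 4 := by
  rcases eq_or_ne z 0 with rfl | hz
  · simp; positivity
  have hn := norm_pos_iff.2 hz
  rw [abs_arg_eq_arccos (mul_ne_zero one_sub_I_ne_zero hz), ← arccos_sqrt_two_div_two,
    norm_one_sub_I_mul, re_one_sub_I_mul]
  apply Real.arccos_le_arccos
  rw [div_le_div_iff₀ (by norm_num) (by positivity)]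
  have : √2 * √2 = 2 := Real.mul_self_sqrt (by norm_num)
  have h3 : ‖z‖ ≤ z.re + z.im := by
    simpa [abs_of_nonneg h1, abs_of_nonneg h2] using Complex.norm_le_abs_re_add_abs_im z
  nlinarith

lemma abs_arg_quadrant_lt {z : ℂ} (h1 : 0 < z.re) (h2 : 0 < z.im) :
    |((1 - Complex.I) * z).arg| < Real.pi / 4 := by
  have hz : z ≠ 0 := by rintro rfl; simp at h1
  have hn := norm_pos_iff.2 hz
  have hs : √2 * √2 = 2 := Real.mul_self_sqrt (by norm_num)
  have h0 : 0 < √2 := by positivity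
  have hsq : ‖z‖ ^ 2 = z.re * z.re + z.im * z.im := by
    rw [← Complex.normSq_eq_norm_sq, Complex.normSq_apply]
  rw [abs_arg_eq_arccos (mul_ne_zero one_sub_I_ne_zero hz), ← arccos_sqrt_two_div_two,
    norm_one_sub_I_mul, re_one_sub_I_mul]
  have h3 : ‖z‖ < z.re + z.im := by nlinarith [mul_pos h1 h2]
  refine (Real.strictAntiOn_arccos.lt_iff_gt ⟨?_, ?_⟩ ⟨?_, ?_⟩).2 ?_
  · have : 0 ≤ (z.re + z.im) / (√2 * ‖z‖) := by positivity
    linarith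
  · rw [div_le_one (by positivity)]
    have : (z.re + z.im) ^ 2 ≤ (√2 * ‖z‖) ^ 2 := by
      rw [mul_pow, hsq, sq √2, hs]; nlinarith [sq_nonneg (z.re - z.im)]
    exact (abs_le_of_sq_le_sq' this (by positivity)).2
  · linarith
  · nlinarith
  · rw [div_lt_div_iff₀ (by norm_num) (by positivity)]
    nlinarith

lemma abs_arg_quadrant_eq {z : ℂ} (hz : z ≠ 0) (h1 : 0 ≤ z.re) (h2 : 0 ≤ z.im)
    (h : z.re = 0 ∨ z.im = 0) :
    |((1 - Complex.I) * z).arg| = Real.pi / 4 := by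
  have hn := norm_pos_iff.2 hz
  have hs : √2 * √2 = 2 := Real.mul_self_sqrt (by norm_num)
  have h0 : 0 < √2 := by positivity
  have h3 : ‖z‖ = z.re + z.im := by
    have : z.re * z.im = 0 := by rcases h with h | h <;> simp [h]
    rw [Complex.norm_def, Complex.normSq_apply, Real.sqrt_eq_iff_mul_self_eq (by positivity) (by positivity)]
    nlinarith
  rw [abs_arg_eq_arccos (mul_ne_zero one_sub_I_ne_zero hz), ← arccos_sqrt_two_div_two,
    norm_one_sub_I_mul, re_one_sub_I_mul, ← h3]
  congr 1
  rw [div_eq_div_iff (by positivity) (by norm_num)]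
  linear_combination -‖z‖ * hs

namespace LimitConfig
variable {ε : ℝ} {G : ℂ → ℂ} {A B Ω : Set ℂ} (H : LimitConfig ε G A B Ω)
include H

lemma quadrant {P : ℂ} (hP : P ∈ frontier Ω) :
    (∀ z ∈ Ω, (kMap G P).re < (kMap G z).re ∧ (kMap G P).im < (kMap G z).im) ∨
    (∀ z ∈ Ω, (kMap G z).re < (kMap G P).re ∨ (kMap G z).im < (kMap G P).im) := by
  have hcre := H.contKre
  have hcim := H.contKim
  refine H.conn.subset_or_subset
    (u := {z | (kMap G P).re < (kMap G z).re ∧ (kMap G P).im < (kMap G z).im})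
    (v := {z | (kMap G z).re < (kMap G P).re ∨ (kMap G z).im < (kMap G P).im}) ?_ ?_ ?_ ?_
  · exact (isOpen_lt continuous_const hcre).and (isOpen_lt continuous_const hcim)
  · exact (isOpen_lt hcre continuous_const).union (isOpen_lt hcim continuous_const)
  · rw [Set.disjoint_left]
    rintro z ⟨h1, h2⟩ (h | h) <;> linarith
  · intro z hz
    simp only [mem_union, mem_ofPred_eq]
    by_contra hcon
    push Not at hcon
    obtain ⟨h1, h2, h3⟩ := hcon
    rcases h2.eq_or_lt with h | h
    · linarith [(H.ray_vertical hz hP h.symm).2]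
    · have := h1 h
      linarith [(H.ray_horizontal hz hP (le_antisymm this h3)).2]

lemma exists_sector (hA : ¬ Recedes A 1) (hB : ¬ Recedes B Complex.I) :
    ∃ S : ℂ, ∃ q : ℝ, (2 - ε) * Real.arccos q < Real.pi / 2 ∧ ∀ z ∈ closure Ω,
      q * ‖(1 - Complex.I) * (S - wMap G z)‖ ≤ ((1 - Complex.I) * (S - wMap G z)).re ∧
      (1 - Complex.I) * (S - wMap G z) ∈ Complex.slitPlane := by
  have hε := H.ε_pos
  have hε1 := H.ε_lt
  obtain ⟨δ, hδ, hδ1, hδm⟩ := exists_arccos_lt (m := 2 - ε) (q₀ := √2 / 2)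
    (f := fun δ => (1 - δ) / (1 + δ) * (√2 / 2))
    (by
      refine ContinuousAt.mul (ContinuousAt.div (by fun_prop) (by fun_prop) (by norm_num)) ?_
      fun_prop) (by simp)
    (by rw [arccos_sqrt_two_div_two]; nlinarith [Real.pi_pos])
  obtain ⟨C, hC⟩ := H.sector_re hA hδ
  obtain ⟨D, hD⟩ := H.sector_im hB hδ
  have hδ' : 0 < 1 - δ := by linarith
  set S₀ := (|C| + |D| + 1) / (1 - δ) with hS₀
  have hS : (1 - δ) * S₀ = |C| + |D| + 1 := by rw [hS₀]; field_simp
  have hSpos : 0 < S₀ := by positivity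
  refine ⟨⟨S₀, S₀⟩, _, hδm, fun z hz => ?_⟩
  have h1 := hC z hz
  have h2 := hD z hz
  set s := (wMap G z).re
  set t := (wMap G z).im
  have h3 : |t| ≤ |S₀ - t| + S₀ := by
    have := abs_sub_abs_le_abs_sub t S₀
    rw [abs_of_pos hSpos, abs_sub_comm] at this; linarith
  have h4 : |s| ≤ |S₀ - s| + S₀ := by
    have := abs_sub_abs_le_abs_sub s S₀
    rw [abs_of_pos hSpos, abs_sub_comm] at this; linarith
  have := le_abs_self C
  have := le_abs_self D
  have := abs_nonneg C
  have := abs_nonneg D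
  obtain ⟨h5, h6⟩ := sector_of_abs_le (a := S₀ - s) (b := S₀ - t) hδ hδ1 (by nlinarith) (by nlinarith)
  constructor
  · rw [re_one_sub_I_mul, norm_one_sub_I_mul]
    have h7 := Complex.norm_le_abs_re_add_abs_im (⟨S₀, S₀⟩ - wMap G z)
    simp only [Complex.sub_re, Complex.sub_im] at h7 ⊢
    have hs : √2 * √2 = 2 := Real.mul_self_sqrt (by norm_num)
    calc (1 - δ) / (1 + δ) * (√2 / 2) * (√2 * ‖(⟨S₀, S₀⟩ : ℂ) - wMap G z‖)
        = (1 - δ) / (1 + δ) * (√2 * √2 / 2 * ‖(⟨S₀, S₀⟩ : ℂ) - wMap G z‖) := by ring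
      _ ≤ (1 - δ) / (1 + δ) * (|S₀ - s| + |S₀ - t|) := by
          rw [hs]; gcongr; linarith
      _ ≤ _ := by rw [div_mul_eq_mul_div, div_le_iff₀ (by linarith)]; linarith
  · left; rw [re_one_sub_I_mul]; simpa using h5

lemma not_southwest_of_factor (hA : ¬ Recedes A 1) (hB : ¬ Recedes B Complex.I)
    {z₀ z₁ : ℂ} (hz₀ : z₀ ∈ frontier Ω) (hz₁ : z₁ ∈ Ω) (hre : (kMap G z₁).re < (kMap G z₀).re)
    (him : (kMap G z₁).im < (kMap G z₀).im) {E : ℝ → ℂ → ℂ}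
    (hEd : ∀ η > 0, DifferentiableOn ℂ (E η) Ω) (hEc : ∀ η > 0, ContinuousOn (E η) (closure Ω))
    (hEs : ∀ η > 0, ∀ z ∈ closure Ω, InSector (η * (Real.pi / 4)) (E η z))
    (hE0 : ∀ η > 0, ∀ z ∈ Ω, E η z ≠ 0)
    (hEg : ∀ η > 0, ∀ S : ℂ, ∃ C : ℝ, 0 ≤ C ∧
      ∀ z ∈ Ω, ‖E η z‖ ≤ C * (‖S - wMap G z‖ + 1) ^ ((1 - ε) * η))
    (hfr : ∀ z ∈ frontier Ω,
      (∀ z' ∈ Ω, (kMap G z).re < (kMap G z').re ∧ (kMap G z).im < (kMap G z').im) →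
      ∀ η > 0, E η z = 0) : False := by
  have hε := H.ε_pos
  have hε1 := H.ε_lt
  have hcre := H.contKre
  have hcim := H.contKim
  obtain ⟨S, q, hq, hsec⟩ := H.exists_sector hA hB
  set V := {z ∈ Ω | (kMap G z).re < (kMap G z₀).re ∧ (kMap G z).im < (kMap G z₀).im} with hVdef
  have hV : IsOpen V := H.isOpen.and
    ((isOpen_lt hcre continuous_const).and (isOpen_lt hcim continuous_const))
  have hVΩ : V ⊆ Ω := fun z hz => hz.1
  have hVc : ∀ z ∈ closure V, z ∈ closure Ω ∧ 0 ≤ (kMap G z₀ - kMap G z).re ∧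
      0 ≤ (kMap G z₀ - kMap G z).im := by
    intro z hz
    refine ⟨closure_mono hVΩ hz, ?_⟩
    refine closure_minimal (t := {z | 0 ≤ (kMap G z₀ - kMap G z).re ∧
      0 ≤ (kMap G z₀ - kMap G z).im}) (fun z hz => ?_) ?_ hz
    · simp only [mem_ofPred_eq, Complex.sub_re, Complex.sub_im]
      exact ⟨by linarith [hz.2.1], by linarith [hz.2.2]⟩
    · simp only [Complex.sub_re, Complex.sub_im]
      exact (isClosed_le continuous_const (continuous_const.sub hcre)).inter
        (isClosed_le continuous_const (continuous_const.sub hcim))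
  set x₁ := (1 - Complex.I) * (kMap G z₀ - kMap G z₁) with hx₁
  have harg : |x₁.arg| < Real.pi / 4 := abs_arg_quadrant_lt (by simpa using hre) (by simpa using him)
  have hpi := Real.pi_pos
  set η := min (ε / 2) ((Real.pi / 2 - 2 * |x₁.arg|) / Real.pi) with hη
  have hη0 : 0 < η := lt_min (by positivity) (div_pos (by linarith) hpi)
  have hη1 : η ≤ ε / 2 := min_le_left _ _
  have hη2 : η * Real.pi ≤ Real.pi / 2 - 2 * |x₁.arg| :=
    (le_div_iff₀ hpi).1 (min_le_right _ _)
  obtain ⟨C₁, hC₁, hg₁⟩ := H.growth_pow S (kMap G z₀)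
  obtain ⟨C₂, hC₂, hg₂⟩ := hEg η hη0 S
  have hne : ((2 + η : ℝ) : ℂ) ≠ 0 := Complex.ofReal_ne_zero.2 (by positivity)
  have hneg := H.re_nonpos_of_sector hV hVΩ
    (Ψ := fun z => ((1 - Complex.I) * (kMap G z₀ - kMap G z)) ^ ((2 + η : ℝ) : ℂ) * E η z)
    (c := 1 - Complex.I) (S := S) (q := q) (m := 2 - ε)
    (a := (1 - ε) * (2 + 2 * η)) (C := (√2 * C₁) ^ (2 + η) * C₂) ?_ ?_ ?_ one_sub_I_ne_zero hq ?_ ?_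
    (fun z hz => (hsec z hz).1) (fun z hz => (hsec z hz).2) ?_ (z := z₁) ⟨hz₁, hre, him⟩
  · refine absurd hneg (not_le.2 ((hEs η hη0 z₁ (subset_closure hz₁)).re_cpow_mul_pos ?_
      (by positivity) ?_ (hE0 η hη0 z₁ hz₁)))
    · nlinarith
    · refine mul_ne_zero one_sub_I_ne_zero fun h => ?_
      have := congrArg Complex.re h
      simp at this
      linarith
  · refine (differentiableOn_cpow (((H.diffK.mono hVΩ).const_sub _).const_mul _)
      fun z hz => ?_).mul ((hEd η hη0).mono hVΩ)
    left
    rw [re_one_sub_I_mul]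
    simp only [Complex.sub_re, Complex.sub_im]
    linarith [hz.2.1, hz.2.2]
  · have := H.contK
    refine (continuousOn_cpow_of_re_nonneg (by positivity) (by fun_prop)
      fun z hz => Or.inl ?_).mul ((hEc η hη0).mono (closure_mono hVΩ))
    rw [re_one_sub_I_mul]
    linarith [(hVc z hz).2.1, (hVc z hz).2.2]
  · intro z hz
    obtain ⟨hzΩ, h1, h2⟩ := hVc z hz.1
    by_cases h : (kMap G z₀ - kMap G z).re = 0 ∨ (kMap G z₀ - kMap G z).im = 0
    · rcases eq_or_ne (kMap G z₀ - kMap G z) 0 with h0 | h0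
      · simp only [h0, mul_zero, Complex.zero_cpow hne, zero_mul, Complex.zero_re, le_refl]
      · have harg := abs_arg_quadrant_eq h0 h1 h2 h
        refine (hEs η hη0 z hzΩ).re_cpow_mul_nonpos ?_ ?_ (by positivity)
        · rw [harg]; nlinarith
        · rw [harg]; nlinarith
    · push Not at h
      have h3 := lt_of_le_of_ne h1 h.1.symm
      have h4 := lt_of_le_of_ne h2 h.2.symm
      simp only [Complex.sub_re, Complex.sub_im, sub_pos] at h3 h4
      have hzn : z ∉ Ω := fun hzΩ' => hz.2 (by rw [hV.interior_eq]; exact ⟨hzΩ', h3, h4⟩)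
      have hzf : z ∈ frontier Ω := ⟨hzΩ, fun hh => hzn (interior_subset hh)⟩
      have hbot := (H.quadrant hzf).resolve_right fun hq => by
        have : (kMap G z₀).re ≤ (kMap G z).re ∨ (kMap G z₀).im ≤ (kMap G z).im := by
          refine closure_minimal (t := {y | (kMap G y).re ≤ (kMap G z).re ∨
            (kMap G y).im ≤ (kMap G z).im}) (fun y hy => (hq y hy).imp le_of_lt le_of_lt) ?_ hz₀.1
          exact (isClosed_le hcre continuous_const).union (isClosed_le hcim continuous_const)
        rcases this with h | h <;> linarith
      simp [hfr z hzf hbot η hη0]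
  · have : 0 < 1 - ε := by linarith
    positivity
  · nlinarith
  · intro z hz
    set r := ‖S - wMap G z‖ + 1
    have hr : 0 < r := by positivity
    rw [norm_mul, norm_cpow_ofReal, norm_one_sub_I_mul, norm_sub_rev]
    have h1 : (√2 * ‖kMap G z - kMap G z₀‖) ^ (2 + η) ≤
        (√2 * C₁) ^ (2 + η) * r ^ ((1 - ε) * (2 + η)) := by
      rw [Real.rpow_mul hr.le, ← Real.mul_rpow (by positivity) (by positivity), mul_assoc]
      have := hg₁ z (subset_closure (hVΩ hz))
      gcongr
    calc _ ≤ ((√2 * C₁) ^ (2 + η) * r ^ ((1 - ε) * (2 + η))) * (C₂ * r ^ ((1 - ε) * η)) := by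
          gcongr; exact hg₂ z (hVΩ hz)
      _ = (√2 * C₁) ^ (2 + η) * C₂ * (r ^ ((1 - ε) * (2 + η)) * r ^ ((1 - ε) * η)) := by ring
      _ = _ := by rw [← Real.rpow_add hr]; congr 2; ring

lemma not_southwest (hA : ¬ Recedes A 1) (hB : ¬ Recedes B Complex.I)
    {z₀ z₁ : ℂ} (hz₀ : z₀ ∈ frontier Ω) (hz₁ : z₁ ∈ Ω) (hre : (kMap G z₁).re < (kMap G z₀).re)
    (him : (kMap G z₁).im < (kMap G z₀).im) : False := by
  have hε1 := H.ε_lt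
  by_cases hbot : ∃ P ∈ frontier Ω,
    ∀ z ∈ Ω, (kMap G P).re < (kMap G z).re ∧ (kMap G P).im < (kMap G z).im
  swap
  · refine H.not_southwest_of_factor hA hB hz₀ hz₁ hre him (E := fun _ _ => 1) (by fun_prop)
      (by fun_prop) (fun η hη z _ => inSector_one.mono (by positivity)) (by simp) ?_
      fun z hz h => absurd ⟨z, hz, h⟩ hbot
    intro η hη S
    refine ⟨1, zero_le_one, fun z _ => ?_⟩
    rw [norm_one, one_mul]
    have : 0 < 1 - ε := by linarith
    exact Real.one_le_rpow (by linarith [norm_nonneg (S - wMap G z)]) (by positivity)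
  obtain ⟨P, hP, hPΩ⟩ := hbot
  have hcre := H.contKre
  have hcim := H.contKim
  have hcont := H.contK
  have hPc : ∀ z ∈ closure Ω, 0 ≤ (kMap G z - kMap G P).re ∧ 0 ≤ (kMap G z - kMap G P).im := by
    intro z hz
    refine closure_minimal (t := {z | 0 ≤ (kMap G z - kMap G P).re ∧
      0 ≤ (kMap G z - kMap G P).im}) (fun z hz => ?_) ?_ hz
    · simp only [mem_ofPred_eq, Complex.sub_re, Complex.sub_im]
      exact ⟨by linarith [(hPΩ z hz).1], by linarith [(hPΩ z hz).2]⟩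
    · simp only [Complex.sub_re, Complex.sub_im]
      exact (isClosed_le continuous_const (hcre.sub continuous_const)).inter
        (isClosed_le continuous_const (hcim.sub continuous_const))
  refine H.not_southwest_of_factor hA hB hz₀ hz₁ hre him
    (E := fun η z => ((1 - Complex.I) * (kMap G z - kMap G P)) ^ (η : ℂ)) ?_ ?_ ?_ ?_ ?_ ?_
  · intro η _
    refine differentiableOn_cpow ((H.diffK.sub_const _).const_mul _) fun z hz => ?_
    left
    rw [re_one_sub_I_mul]
    simp only [Complex.sub_re, Complex.sub_im]
    linarith [(hPΩ z hz).1, (hPΩ z hz).2]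
  · intro η hη
    refine continuousOn_cpow_of_re_nonneg hη (by fun_prop) fun z hz => Or.inl ?_
    rw [re_one_sub_I_mul]
    linarith [(hPc z hz).1, (hPc z hz).2]
  · intro η hη z hz
    exact inSector_cpow hη (abs_arg_quadrant_le (hPc z hz).1 (hPc z hz).2)
  · intro η hη z hz
    have : (1 - Complex.I) * (kMap G z - kMap G P) ≠ 0 := by
      refine mul_ne_zero one_sub_I_ne_zero fun h => ?_
      have := congrArg Complex.re h
      simp at this
      linarith [(hPΩ z hz).1]
    simp [Complex.cpow_eq_zero_iff, this]
  · intro η hη S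
    obtain ⟨C₁, hC₁, hg₁⟩ := H.growth_pow S (kMap G P)
    refine ⟨(√2 * C₁) ^ η, by positivity, fun z hz => ?_⟩
    set r := ‖S - wMap G z‖ + 1
    have hr : 0 < r := by positivity
    rw [norm_cpow_ofReal, norm_one_sub_I_mul, Real.rpow_mul hr.le,
      ← Real.mul_rpow (by positivity) (by positivity), mul_assoc]
    have := hg₁ z (subset_closure hz)
    gcongr
  · intro z hz h η hη
    have hne : (η : ℂ) ≠ 0 := Complex.ofReal_ne_zero.2 hη.ne'
    have h1 : (kMap G z).re = (kMap G P).re :=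
      (eq_csInf_of_mem_closure hcre hz.1 fun z hz => (h z hz).1.le).trans
          (eq_csInf_of_mem_closure hcre hP.1 fun z hz => (hPΩ z hz).1.le).symm
    have h2 : (kMap G z).im = (kMap G P).im :=
      (eq_csInf_of_mem_closure hcim hz.1 fun z hz => (h z hz).2.le).trans
          (eq_csInf_of_mem_closure hcim hP.1 fun z hz => (hPΩ z hz).2.le).symm
    have : kMap G z - kMap G P = 0 := by apply Complex.ext <;> simp [h1, h2]
    simp only [this, mul_zero, Complex.zero_cpow hne]

lemma false_of_not_recedes (hA : ¬ Recedes A 1) (hB : ¬ Recedes B Complex.I) : False := by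
  have hcre := H.contKre
  have hcim := H.contKim
  refine H.false_of_extremal fun P hP => ?_
  rcases H.quadrant hP with h | h
  · exact ⟨Or.inr fun z hz => (h z hz).1.le, Or.inr fun z hz => (h z hz).2.le⟩
  have hsw := fun z hz => H.not_southwest hA hB (z₁ := z) hP hz
  rcases isPreconnected_iff_subset_of_disjoint.1 H.conn {z | (kMap G z).re < (kMap G P).re}
    {z | (kMap G z).im < (kMap G P).im} (isOpen_lt hcre continuous_const)
    (isOpen_lt hcim continuous_const) h
    (eq_empty_of_forall_notMem fun z hz => hsw z hz.1 hz.2.1 hz.2.2) with h1 | h1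
  · exact ⟨Or.inl fun z hz => (h1 hz).le, Or.inr fun z hz => not_lt.1 (hsw z hz (h1 hz))⟩
  · exact ⟨Or.inr fun z hz => not_lt.1 fun h2 => hsw z hz h2 (h1 hz), Or.inl fun z hz => (h1 hz).le⟩

lemma elim : False := by
  by_cases hA : Recedes A 1 <;> by_cases hB : Recedes B Complex.I
  · exact H.false_of_recedes_both hA hB
  · refine H.swap.false_of_recedes_right (fun h => hB ?_) ?_
    · have := h.of_reflect
      rw [reflect_circleI] at this
      exact this
    · have := hA.reflect circleI
      rw [reflect_circleI] at this
      exact this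
  · exact H.false_of_recedes_right hA hB
  · exact H.false_of_not_recedes hA hB

end LimitConfig

namespace LimitBase
variable {ε : ℝ} {G : ℂ → ℂ} {A B Ω : Set ℂ}

lemma elim_of_left (H : LimitBase ε G A B Ω) (hA : Recedes A (-1))
    (hB : Recedes B Complex.I ∨ Recedes B (-Complex.I)) : False := by
  rcases hB with hB | hB
  · refine LimitConfig.elim
      { H.conjBy 1 (xMap_conjBy_one G) (pMap_conjBy_one G) with leftA := ?_, downB := ?_ }
    · have := hA.reflect 1
      rw [reflect_one] at this
      convert this using 1
      apply Complex.ext <;> simp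
    · have := hB.reflect 1
      rw [reflect_one] at this
      convert this using 1
      apply Complex.ext <;> simp
  · exact LimitConfig.elim { H with leftA := hA, downB := hB }

/-- There is no limit configuration in which `A` recedes in a horizontal direction and `B` recedes
in a vertical direction. -/
lemma elim (H : LimitBase ε G A B Ω) (hA : Recedes A 1 ∨ Recedes A (-1))
    (hB : Recedes B Complex.I ∨ Recedes B (-Complex.I)) : False := by
  rcases hA with hA | hA
  · refine (H.conjBy (-1) (xMap_conjBy_neg_one G) (pMap_conjBy_neg_one G)).elim_of_left ?_ ?_
    · have := hA.reflect (-1)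
      rw [reflect_neg_one] at this
      convert this using 1
      apply Complex.ext <;> simp
    · refine hB.imp (fun h => ?_) (fun h => ?_)
      · have := h.reflect (-1)
        rw [reflect_neg_one] at this
        convert this using 1
        apply Complex.ext <;> simp
      · have := h.reflect (-1)
        rw [reflect_neg_one] at this
        convert this using 1
        apply Complex.ext <;> simp
  · exact H.elim_of_left hA hB

end LimitBase

end PlanarOT

namespace PlanarOT

open scoped ComplexConjugate

lemma xMap_eq (G : ℂ → ℂ) (z : ℂ) : xMap G z = (z + conj (G z)) / 2 := by
  apply Complex.ext
  · simp [wMap]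
  · simp [kMap]; ring

lemma pMap_eq (G : ℂ → ℂ) (z : ℂ) : pMap G z = (z - conj (G z)) / 2 := by
  apply Complex.ext
  · simp [kMap]
  · simp [wMap]

lemma lipschitz_xMap {G : ℂ → ℂ} (hG : LipschitzWith 1 G) : LipschitzWith 1 (xMap G) := by
  refine LipschitzWith.of_dist_le_mul fun z z' => ?_
  have h := hG.dist_le_mul z z'
  simp only [NNReal.coe_one, one_mul, dist_eq_norm, xMap_eq] at h ⊢
  rw [show (z + conj (G z)) / 2 - (z' + conj (G z')) / 2 = ((z - z') + conj (G z - G z')) / 2 by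
    rw [map_sub]; ring, norm_div, Complex.norm_ofNat]
  have := norm_add_le (z - z') (conj (G z - G z'))
  rw [RCLike.norm_conj] at this
  linarith

lemma lipschitz_pMap {G : ℂ → ℂ} (hG : LipschitzWith 1 G) : LipschitzWith 1 (pMap G) := by
  refine LipschitzWith.of_dist_le_mul fun z z' => ?_
  have h := hG.dist_le_mul z z'
  simp only [NNReal.coe_one, one_mul, dist_eq_norm, pMap_eq] at h ⊢
  rw [show (z - conj (G z)) / 2 - (z' - conj (G z')) / 2 = ((z - z') - conj (G z - G z')) / 2 by
    rw [map_sub]; ring, norm_div, Complex.norm_ofNat]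
  have := norm_sub_le (z - z') (conj (G z - G z'))
  rw [RCLike.norm_conj] at this
  linarith

/-- A holomorphic function whose real part has a local maximum has locally constant real part. -/
lemma eventually_re_eq_of_isLocalMax {h : ℂ → ℂ} {z₀ : ℂ}
    (hd : ∀ᶠ z in nhds z₀, DifferentiableAt ℂ h z) (hmax : ∀ᶠ z in nhds z₀, (h z).re ≤ (h z₀).re) :
    ∀ᶠ z in nhds z₀, (h z).re = (h z₀).re := by
  have h1 := Complex.eventually_eq_of_isLocalMax_norm (f := fun z => Complex.exp (h z)) (c := z₀)
    (hd.mono fun z hz => hz.cexp) (by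
      filter_upwards [hmax] with z hz
      simpa [Complex.norm_exp] using hz)
  filter_upwards [h1] with z hz
  have := congrArg norm hz
  simpa [Complex.norm_exp] using this

lemma real_clm_apply (f : ℂ →L[ℝ] ℝ) (z : ℂ) :
    f z = (conj (⟨f 1, f Complex.I⟩ : ℂ) * z).re := by
  have h : f z = z.re * f 1 + z.im * f Complex.I := by
    conv_lhs => rw [← Complex.re_add_im z]
    rw [map_add, ← Complex.real_smul, ← smul_eq_mul, ← mul_one (z.re : ℂ), ← smul_eq_mul (z.re : ℂ),
      Complex.coe_smul, map_smul, map_smul]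
    simp
  rw [h]; simp; ring

/-- A linear functional of `xMap G` that is locally maximal is locally constant. -/
lemma eventually_eq_of_isLocalMax_xMap {G : ℂ → ℂ} {z₀ : ℂ}
    (hd : ∀ᶠ z in nhds z₀, DifferentiableAt ℂ G z) (f : ℂ →L[ℝ] ℝ)
    (hmax : ∀ᶠ z in nhds z₀, f (xMap G z) ≤ f (xMap G z₀)) :
    ∀ᶠ z in nhds z₀, f (xMap G z) = f (xMap G z₀) := by
  set c : ℂ := ⟨f 1, f Complex.I⟩ with hc
  have key : ∀ z, f (xMap G z) = ((conj c * z + c * G z) / 2).re := by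
    intro z
    rw [real_clm_apply, xMap_eq]
    simp [hc]
    ring
  simp only [key] at hmax ⊢
  refine eventually_re_eq_of_isLocalMax ?_ hmax
  filter_upwards [hd] with z hz
  fun_prop

lemma norm_deriv_le_one {G : ℂ → ℂ} (hG : LipschitzWith 1 G) (z : ℂ) : ‖deriv G z‖ ≤ 1 := by
  simpa using norm_deriv_le_of_lipschitz (x₀ := z) hG

/-- If the derivative of a nonexpansive map has norm less than one at a point, then distances to
this point are strictly decreased. -/
lemma strict_of_norm_deriv_lt {G : ℂ → ℂ} (hG : LipschitzWith 1 G) {z z' : ℂ}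
    (hd : DifferentiableAt ℂ G z) (h : ‖deriv G z‖ < 1) (hz : z' ≠ z) :
    ‖G z - G z'‖ < ‖z - z'‖ := by
  have hle : ∀ x y, ‖G x - G y‖ ≤ ‖x - y‖ := fun x y => by
    simpa [dist_eq_norm] using hG.dist_le_mul x y
  refine lt_of_le_of_ne (hle z z') fun heq => ?_
  have hpos : 0 < ‖z' - z‖ := norm_pos_iff.2 (sub_ne_zero.2 hz)
  have hseg : ∀ t ∈ Ioo (0:ℝ) 1, ‖G (z + t * (z' - z)) - G z‖ = t * ‖z' - z‖ := by
    intro t ht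
    set y := z + t * (z' - z) with hy
    have h1 : ‖y - z‖ = t * ‖z' - z‖ := by
      rw [hy, add_sub_cancel_left, norm_mul, Complex.norm_real, Real.norm_of_nonneg ht.1.le]
    have h2 : ‖y - z'‖ = (1 - t) * ‖z' - z‖ := by
      rw [show y - z' = -(((1 - t : ℝ) : ℂ) * (z' - z)) by rw [hy]; push_cast; ring, norm_neg,
        norm_mul, Complex.norm_real, Real.norm_of_nonneg (by linarith [ht.2])]
    have h3 := hle y z
    have h4 := hle y z'
    have h5 : ‖G z - G z'‖ ≤ ‖G y - G z‖ + ‖G y - G z'‖ := by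
      rw [norm_sub_rev (G y)]; exact norm_sub_le_norm_sub_add_norm_sub _ _ _
    rw [heq, norm_sub_rev z] at h5
    apply le_antisymm (h1 ▸ h3)
    linarith
  have hder : HasDerivAt (fun t : ℝ => G (z + t * (z' - z))) (deriv G z * (z' - z)) 0 := by
    have h1 : HasDerivAt (fun t : ℂ => z + t * (z' - z)) (z' - z) ((0 : ℝ) : ℂ) := by
      simpa using ((hasDerivAt_id ((0 : ℝ) : ℂ)).mul_const (z' - z)).const_add z
    have h2 : HasDerivAt G (deriv G z) (z + ((0 : ℝ) : ℂ) * (z' - z)) := by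
      simpa using hd.hasDerivAt
    exact (h2.comp ((0 : ℝ) : ℂ) h1).comp_ofReal
  have hlim := hder.tendsto_slope_zero_right
  have h2 : Filter.Tendsto (fun t : ℝ => ‖z' - z‖) (nhdsWithin 0 (Ioi 0))
      (nhds ‖deriv G z * (z' - z)‖) := by
    refine hlim.norm.congr' ?_
    filter_upwards [Ioo_mem_nhdsGT (zero_lt_one (α := ℝ))] with t ht
    simp only [zero_add, Complex.ofReal_zero, zero_mul, add_zero]
    rw [norm_smul, hseg t ht, norm_inv, Real.norm_of_nonneg ht.1.le]
    field_simp [ht.1.ne']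
  have h3 := tendsto_nhds_unique h2 tendsto_const_nhds
  rw [norm_mul] at h3
  nlinarith

/-- At a point where the derivative of the holomorphic map `G` has norm less than one, `pMap G` is
open. -/
lemma map_nhds_pMap {G : ℂ → ℂ} {z : ℂ} (hd : ∀ᶠ y in nhds z, DifferentiableAt ℂ G y)
    (h : ‖deriv G z‖ < 1) : Filter.map (pMap G) (nhds z) = nhds (pMap G z) := by
  have hs : HasStrictDerivAt G (deriv G z) z := by
    refine AnalyticAt.hasStrictDerivAt ?_
    exact DifferentiableOn.analyticAt (s := {y | DifferentiableAt ℂ G y})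
      (fun y hy => hy.differentiableWithinAt) hd
  have h1 := (hs.hasStrictFDerivAt).restrictScalars ℝ
  have h2 := (Complex.conjCLE.toContinuousLinearMap.hasStrictFDerivAt (x := G z)).comp z h1
  have h3 := ((hasStrictFDerivAt_id (𝕜 := ℝ) z).sub h2).const_smul (2⁻¹ : ℝ)
  have h4 : (2⁻¹ : ℝ) • (id - fun y => (Complex.conjCLE : ℂ →L[ℝ] ℂ) (G y)) = pMap G := by
    funext y
    rw [pMap_eq]
    simp
    ring
  have h4' : HasStrictFDerivAt (pMap G) _ z := h4 ▸ h3
  refine h4'.map_nhds_eq_of_surj ?_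
  rw [LinearMap.range_eq_top]
  refine LinearMap.injective_iff_surjective.1 ?_
  rw [← LinearMap.ker_eq_bot, LinearMap.ker_eq_bot']
  intro m hm
  have hm' : m = conj (m * deriv G z) := by
    have : (2⁻¹ : ℂ) * (m - conj (m * deriv G z)) = 0 := by simpa using hm
    have := (mul_eq_zero.1 this).resolve_left (by norm_num)
    exact sub_eq_zero.1 this
  by_contra hne
  have hn := congrArg norm hm'
  rw [RCLike.norm_conj, norm_mul] at hn
  have := norm_pos_iff.2 hne
  nlinarith

section rigid
variable {G : ℂ → ℂ} {Ω O : Set ℂ} (hG : LipschitzWith 1 G) (hΩ : IsOpen Ω)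
  (hconn : IsPreconnected Ω) (hd : DifferentiableOn ℂ G Ω)
include hG hΩ hconn hd

lemma eqOn_affine_of_norm_deriv_eq {z₁ : ℂ} (hz₁ : z₁ ∈ Ω) (h : ‖deriv G z₁‖ = 1) :
    ∃ μ : ℂ, ‖μ‖ = 1 ∧ ∃ β : ℂ, ∀ z ∈ Ω, G z = conj μ ^ 2 * z + β := by
  set γ := deriv G z₁
  have h1 : EqOn (deriv G) (Function.const ℂ γ) Ω :=
    Complex.eqOn_of_isPreconnected_of_isMaxOn_norm hconn hΩ (hd.deriv hΩ) hz₁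
      (fun z _ => by
        change ‖deriv G z‖ ≤ ‖deriv G z₁‖
        rw [h]; exact norm_deriv_le_one hG z)
  obtain ⟨ν, hν⟩ := IsAlgClosed.exists_pow_nat_eq γ (n := 2) (by norm_num)
  refine ⟨conj ν, ?_, G z₁ - γ * z₁, ?_⟩
  · rw [RCLike.norm_conj]
    have := congrArg norm hν
    rw [norm_pow, h] at this
    exact (pow_eq_one_iff_of_nonneg (norm_nonneg _) (by norm_num)).1 this
  · rw [Complex.conj_conj, hν]
    refine hΩ.eqOn_of_deriv_eq hconn hd (by fun_prop) (fun z hz => ?_) hz₁ (by ring)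
    rw [h1 hz]
    simp [deriv_add_const]

/-- If the derivative of `G` reaches norm one, then `Ω` is a union of parallel lines along which
`wMap G` and `kMap G` are affine. -/
lemma exists_line_of_norm_deriv_eq (h1 : ∀ z ∈ Ω, xMap G z ∈ O)
    (h2 : ∀ z ∈ closure Ω, xMap G z ∈ O → z ∈ Ω) {z₁ : ℂ} (hz₁ : z₁ ∈ Ω)
    (h : ‖deriv G z₁‖ = 1) :
    ∃ μ : ℂ, ‖μ‖ = 1 ∧ ∀ τ : ℝ, z₁ + τ * (μ * Complex.I) ∈ Ω ∧
      wMap G (z₁ + τ * (μ * Complex.I)) = wMap G z₁ + τ * μ.re * Complex.I ∧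
      kMap G (z₁ + τ * (μ * Complex.I)) = kMap G z₁ - τ * μ.im := by
  obtain ⟨μ, hμ, β, hβ⟩ := eqOn_affine_of_norm_deriv_eq hG hΩ hconn hd hz₁ h
  have hμ2 : conj μ * μ = 1 := by
    rw [← Complex.normSq_eq_conj_mul_self, Complex.normSq_eq_norm_sq, hμ]; simp
  have hcl : ∀ z ∈ closure Ω, G z = conj μ ^ 2 * z + β := fun z hz =>
    closure_minimal (t := {z | G z = conj μ ^ 2 * z + β}) hβ
      (isClosed_eq hG.continuous (by fun_prop)) hz
  have hline : ∀ τ : ℝ, conj μ ^ 2 * (z₁ + τ * (μ * Complex.I)) + β =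
      conj μ ^ 2 * z₁ + β + τ * conj μ * Complex.I := fun τ => by
    linear_combination (conj μ * τ * Complex.I) * hμ2
  have hmem : {τ : ℝ | z₁ + τ * (μ * Complex.I) ∈ Ω} = univ := by
    have hc : Continuous fun τ : ℝ => z₁ + τ * (μ * Complex.I) := by fun_prop
    refine IsClopen.eq_univ ⟨isClosed_of_closure_subset fun τ hτ => ?_, hΩ.preimage hc⟩
      ⟨0, by simpa using hz₁⟩
    have h3 : z₁ + τ * (μ * Complex.I) ∈ closure Ω := hc.closure_preimage_subset _ hτ
    refine h2 _ h3 ?_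
    have h4 : xMap G (z₁ + τ * (μ * Complex.I)) = xMap G z₁ := by
      rw [xMap_eq, xMap_eq, hcl _ h3, hline, hβ z₁ hz₁]
      simp
      ring
    rw [h4]; exact h1 _ hz₁
  refine ⟨μ, hμ, fun τ => ?_⟩
  have h3 : z₁ + τ * (μ * Complex.I) ∈ Ω := by
    have : τ ∈ {τ : ℝ | z₁ + τ * (μ * Complex.I) ∈ Ω} := hmem ▸ mem_univ τ
    exact this
  refine ⟨h3, ?_, ?_⟩
  · rw [wMap, wMap, hβ _ h3, hline, hβ z₁ hz₁]
    apply Complex.ext <;> simp <;> ring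
  · rw [kMap, kMap, hβ _ h3, hline, hβ z₁ hz₁]
    apply Complex.ext <;> simp <;> ring

end rigid

/-- A connected component of an open set contains every point of the set adherent to it. -/
lemma mem_connectedComponentIn_of_mem_closure {O : Set ℂ} {z₀ z : ℂ} (h₀ : z₀ ∈ O) (hz : z ∈ O)
    (hcl : z ∈ closure (connectedComponentIn O z₀)) : z ∈ connectedComponentIn O z₀ := by
  have h1 : IsPreconnected (insert z (connectedComponentIn O z₀)) :=
    isPreconnected_connectedComponentIn.subset_closure (subset_insert _ _)
      (insert_subset hcl subset_closure)
  exact h1.subset_connectedComponentIn (mem_insert_of_mem _ (mem_connectedComponentIn h₀))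
    (insert_subset hz (connectedComponentIn_subset _ _)) (mem_insert _ _)

end PlanarOT

namespace PlanarOT

/-- The complex form of an optimal transport problem between the convex sets `U` and `V`. -/
structure TransportSystem (G : ℂ → ℂ) (U V : Set ℂ) : Prop where
  lip : LipschitzWith 1 G
  openU : IsOpen U
  openV : IsOpen V
  convexU : Convex ℝ U
  convexV : Convex ℝ V
  preimage_eq : xMap G ⁻¹' U = pMap G ⁻¹' V
  diff : DifferentiableOn ℂ G (xMap G ⁻¹' U)
  surjX : U ⊆ range (xMap G)
  surjP : V ⊆ range (pMap G)

/-- The lower limit of a sequence of sets along a filter. -/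
def limSet (l : Filter ℕ) (U : ℕ → Set ℂ) : Set ℂ :=
  {y | ∀ ε > 0, ∀ᶠ n in l, ∃ x ∈ U n, dist x y < ε}

section limSet
variable {l : Filter ℕ} {U : ℕ → Set ℂ}

lemma isClosed_limSet : IsClosed (limSet l U) := by
  refine isClosed_of_closure_subset fun y hy ε hε => ?_
  obtain ⟨y', hy', hd⟩ := Metric.mem_closure_iff.1 hy (ε / 2) (by positivity)
  filter_upwards [hy' (ε / 2) (by positivity)] with n ⟨x, hx, hxy⟩
  exact ⟨x, hx, by linarith [dist_triangle x y' y, dist_comm y y']⟩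

lemma convex_limSet (hU : ∀ n, Convex ℝ (U n)) : Convex ℝ (limSet l U) := by
  intro y hy y' hy' a b ha hb hab ε hε
  filter_upwards [hy ε hε, hy' ε hε] with n ⟨x, hx, hxy⟩ ⟨x', hx', hxy'⟩
  refine ⟨a • x + b • x', hU n hx hx' ha hb hab, ?_⟩
  rw [dist_eq_norm] at *
  rw [show a • x + b • x' - (a • y + b • y') = a • (x - y) + b • (x' - y') by
    rw [smul_sub, smul_sub]; abel]
  refine (norm_add_le _ _).trans_lt ?_
  rw [norm_smul, norm_smul, Real.norm_of_nonneg ha, Real.norm_of_nonneg hb]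
  rcases ha.eq_or_lt with rfl | ha'
  · simp at hab; subst hab; simpa using hxy'
  · nlinarith

lemma mem_limSet_of_tendsto {x : ℕ → ℂ} {y : ℂ} (hx : ∀ᶠ n in l, x n ∈ closure (U n))
    (h : Filter.Tendsto x l (nhds y)) : y ∈ limSet l U := by
  intro ε hε
  filter_upwards [hx, Metric.tendsto_nhds.1 h (ε / 2) (by positivity)] with n hn hn'
  obtain ⟨x', hx', hd⟩ := Metric.mem_closure_iff.1 hn (ε / 2) (by positivity)
  exact ⟨x', hx', by linarith [dist_triangle x' (x n) y, dist_comm x' (x n)]⟩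

lemma abs_clm_le (f : ℂ →L[ℝ] ℝ) (z : ℂ) : |f z| ≤ (|f 1| + |f Complex.I|) * ‖z‖ := by
  have h : f z = z.re * f 1 + z.im * f Complex.I := by
    rw [real_clm_apply f z]; simp; ring
  rw [h]
  refine (abs_add_le _ _).trans ?_
  rw [abs_mul, abs_mul, add_mul]
  have h1 := Complex.abs_re_le_norm z
  have h2 := Complex.abs_im_le_norm z
  have := abs_nonneg (f 1)
  have := abs_nonneg (f Complex.I)
  nlinarith

/-- Balls well inside the limit set are eventually contained in the convex sets. -/
lemma eventually_ball_subset (hU : ∀ n, Convex ℝ (U n)) (hUo : ∀ n, IsOpen (U n)) {y : ℂ} {r : ℝ}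
    (hr : 0 < r) (h : closedBall y (4 * r) ⊆ limSet l U) : ∀ᶠ n in l, ball y r ⊆ U n := by
  have hmem : ∀ c : ℂ, ‖c‖ = 1 → ∀ᶠ n in l, ∃ x ∈ U n, dist x (y + (4 * r : ℝ) * c) < r / 2 := by
    intro c hc
    refine h ?_ _ (by positivity)
    rw [mem_closedBall, dist_eq_norm, add_sub_cancel_left, norm_mul, hc, Complex.norm_real,
      Real.norm_of_nonneg (by positivity), mul_one]
  filter_upwards [hmem 1 (by simp), hmem (-1) (by simp), hmem Complex.I (by simp),
    hmem (-Complex.I) (by simp)] with n h1 h2 h3 h4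
  intro y' hy'
  by_contra hcon
  obtain ⟨f, hf⟩ := geometric_hahn_banach_open_point (hU n) (hUo n) hcon
  set M := |f 1| + |f Complex.I| with hM
  have hM0 : 0 ≤ M := by positivity
  have key : ∀ c : ℂ, (∃ x ∈ U n, dist x (y + (4 * r : ℝ) * c) < r / 2) →
      4 * r * f c < 3 / 2 * r * M ∨ M = 0 := by
    rintro c ⟨x, hx, hd⟩
    have h5 := hf x hx
    have h6 := abs_clm_le f (y' - y)
    have h7 := abs_clm_le f (x - (y + (4 * r : ℝ) * c))
    rw [mem_ball, dist_eq_norm] at hy'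
    rw [dist_eq_norm] at hd
    have h8 : f (x - (y + (4 * r : ℝ) * c)) = f x - f y - 4 * r * f c := by
      rw [map_sub, map_add, ← Complex.real_smul, map_smul, smul_eq_mul]; ring
    rw [h8] at h7
    rw [map_sub] at h6
    have h9 := (abs_le.1 h7).1
    have h10 := (abs_le.1 h6).2
    rcases hM0.eq_or_lt with h0 | h0
    · right; exact h0.symm
    · left; nlinarith
  have hM1 : M ≠ 0 := by
    intro h0
    obtain ⟨x, hx, -⟩ := h1
    have h6 := abs_clm_le f (x - y')
    rw [← hM, h0, zero_mul, map_sub] at h6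
    have := abs_nonpos_iff.1 h6
    linarith [hf x hx]
  have k1 := (key _ h1).resolve_right hM1
  have k2 := (key _ h2).resolve_right hM1
  have k3 := (key _ h3).resolve_right hM1
  have k4 := (key _ h4).resolve_right hM1
  rw [map_neg] at k2 k4
  have hM2 : 0 < M := lt_of_le_of_ne hM0 hM1.symm
  have a1 : 4 * r * |f 1| < 3 / 2 * r * M := by rcases abs_cases (f 1) with h | h <;> nlinarith
  have a2 : 4 * r * |f Complex.I| < 3 / 2 * r * M := by
    rcases abs_cases (f Complex.I) with h | h <;> nlinarith
  nlinarith [mul_pos hr hM2]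

lemma exists_ball_of_mem_interior (hU : ∀ n, Convex ℝ (U n)) (hUo : ∀ n, IsOpen (U n)) {y : ℂ}
    (h : y ∈ interior (limSet l U)) : ∃ r > 0, ∀ᶠ n in l, ball y r ⊆ U n := by
  obtain ⟨R, hR, hsub⟩ := Metric.nhds_basis_closedBall.mem_iff.1 (mem_interior_iff_mem_nhds.1 h)
  exact ⟨R / 4, by positivity, eventually_ball_subset hU hUo (by positivity)
    (by rwa [mul_div_cancel₀ R (by norm_num)])⟩

lemma recedes_limSet (hU : ∀ n, Convex ℝ (U n)) {q : ℕ → ℂ} (hq : ∀ n, q n ∈ U n)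
    (hinf : Filter.Tendsto (fun n => ‖q n‖) l Filter.atTop) {c : ℂ}
    (hc : Filter.Tendsto (fun n => q n / ‖q n‖) l (nhds c)) : Recedes (limSet l U) c := by
  intro a ha T hT ε hε
  have h1 : Filter.Tendsto (fun n => T / ‖q n‖) l (nhds 0) := hinf.const_div_atTop T
  have h2 : Filter.Tendsto (fun n => ε / 3 + T / ‖q n‖ * (‖a‖ + ε) + T * ‖q n / ‖q n‖ - c‖) l
      (nhds (ε / 3 + 0 * (‖a‖ + ε) + T * 0)) := by
    refine (tendsto_const_nhds.add (h1.mul_const _)).add (Filter.Tendsto.const_mul _ ?_)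
    have := (hc.sub_const c).norm
    simpa using this
  have h3 := h2.eventually_lt_const (show ε / 3 + 0 * (‖a‖ + ε) + T * 0 < ε by linarith)
  filter_upwards [ha (ε / 3) (by positivity), h1.eventually_lt_const zero_lt_one, h3,
    hinf.eventually_gt_atTop 0] with n ⟨x, hx, hxa⟩ hθ hlt hpos
  set θ := T / ‖q n‖ with hθdef
  have hθ0 : 0 ≤ θ := by positivity
  refine ⟨(1 - θ) • x + θ • q n, hU n hx (hq n) (by linarith) hθ0 (by ring), ?_⟩
  refine lt_of_le_of_lt ?_ hlt
  rw [dist_eq_norm] at hxa ⊢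
  have heq : (1 - θ) • x + θ • q n - (a + T * c) =
      (x - a) + ((-θ : ℝ) : ℂ) * x + (T : ℂ) * (q n / ‖q n‖ - c) := by
    simp only [Complex.real_smul, hθdef]; push_cast; ring
  rw [heq]
  refine (norm_add₃_le).trans ?_
  rw [norm_mul, norm_mul, Complex.norm_real, Complex.norm_real, norm_neg, Real.norm_of_nonneg hθ0,
    Real.norm_of_nonneg hT]
  have hx' : ‖x‖ ≤ ‖a‖ + ε := by
    have := norm_add_le (x - a) a
    rw [sub_add_cancel] at this; linarith
  gcongr

end limSet

end PlanarOT

namespace PlanarOT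

/-- A sublinear self-bound bounds the quantity. -/
lemma exists_bound_of_le_rpow {ε : ℝ} (hε : 0 < ε) (hε1 : ε < 1) {C : ℝ} (hC : 0 ≤ C) :
    ∃ M : ℝ, ∀ x : ℝ, 0 ≤ x → x ≤ (C * (x + 1)) ^ (1 - ε) → x ≤ M := by
  set D := max C 1 with hD
  have hD1 : 1 ≤ D := le_max_right _ _
  refine ⟨max 1 (((2 * D) ^ (1 - ε)) ^ (1 / ε)), fun x hx h => ?_⟩
  by_contra hcon
  obtain ⟨h1, h2⟩ := max_lt_iff.1 (not_le.1 hcon)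
  have hx0 : 0 < x := by linarith
  have hle : x ≤ (2 * D) ^ (1 - ε) * x ^ (1 - ε) := by
    refine h.trans ?_
    rw [← Real.mul_rpow (by positivity) hx]
    refine Real.rpow_le_rpow (by positivity) ?_ (by linarith)
    nlinarith [le_max_left C 1]
  have h3 : x ^ ε ≤ (2 * D) ^ (1 - ε) := by
    have h4 : x ^ ε * x ^ (1 - ε) = x := by
      rw [← Real.rpow_add hx0]; simp
    have h5 : 0 < x ^ (1 - ε) := Real.rpow_pos_of_pos hx0 _
    nlinarith
  have h4 : x ≤ ((2 * D) ^ (1 - ε)) ^ (1 / ε) := by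
    have := Real.rpow_le_rpow (by positivity) h3 (by positivity : 0 ≤ 1 / ε)
    rwa [← Real.rpow_mul hx, mul_one_div_cancel hε.ne', Real.rpow_one] at this
  linarith

lemma exists_tendsto_of_bounded (u : Ultrafilter ℕ) {x : ℕ → ℂ} {R : ℝ}
    (h : ∀ᶠ n in (u : Filter ℕ), ‖x n‖ ≤ R) : ∃ y, Filter.Tendsto x u (nhds y) := by
  obtain ⟨y, -, hy⟩ := (isCompact_closedBall (0 : ℂ) R).ultrafilter_le_nhds (u.map x) (by
    rw [Filter.le_principal_iff]
    exact h.mono fun n hn => by simpa using hn)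
  exact ⟨y, hy⟩

section limit
variable {l : Filter ℕ} {g : ℕ → ℂ → ℂ} {G : ℂ → ℂ}
  (hg : ∀ n, LipschitzWith 1 (g n)) (hlim : ∀ z, Filter.Tendsto (fun n => g n z) l (nhds (G z)))
include hg hlim

lemma lipschitz_of_tendsto [l.NeBot] : LipschitzWith 1 G := by
  refine LipschitzWith.of_dist_le_mul fun z z' => ?_
  refine le_of_tendsto ((hlim z).dist (hlim z')) (Filter.Eventually.of_forall fun n => ?_)
  exact (hg n).dist_le_mul z z'

lemma tendsto_apply_of_tendsto {z : ℕ → ℂ} {z₀ : ℂ} (hz : Filter.Tendsto z l (nhds z₀)) :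
    Filter.Tendsto (fun n => g n (z n)) l (nhds (G z₀)) := by
  have h1 : Filter.Tendsto (fun n => g n (z n) - g n z₀) l (nhds 0) := by
    refine squeeze_zero_norm (fun n => ?_) (tendsto_iff_norm_sub_tendsto_zero.1 hz)
    simpa [dist_eq_norm] using (hg n).dist_le_mul (z n) z₀
  simpa using h1.add (hlim z₀)

lemma tendsto_wMap {z : ℕ → ℂ} {z₀ : ℂ} (hz : Filter.Tendsto z l (nhds z₀)) :
    Filter.Tendsto (fun n => wMap (g n) (z n)) l (nhds (wMap G z₀)) :=
  (hz.add (tendsto_apply_of_tendsto hg hlim hz)).div_const 2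

lemma tendsto_kMap {z : ℕ → ℂ} {z₀ : ℂ} (hz : Filter.Tendsto z l (nhds z₀)) :
    Filter.Tendsto (fun n => kMap (g n) (z n)) l (nhds (kMap G z₀)) :=
  (hz.sub (tendsto_apply_of_tendsto hg hlim hz)).div_const 2

lemma tendsto_xMap {z : ℕ → ℂ} {z₀ : ℂ} (hz : Filter.Tendsto z l (nhds z₀)) :
    Filter.Tendsto (fun n => xMap (g n) (z n)) l (nhds (xMap G z₀)) := by
  simp only [xMap_eq]
  exact (hz.add ((Complex.continuous_conj.tendsto _).comp
    (tendsto_apply_of_tendsto hg hlim hz))).div_const 2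

lemma tendsto_pMap {z : ℕ → ℂ} {z₀ : ℂ} (hz : Filter.Tendsto z l (nhds z₀)) :
    Filter.Tendsto (fun n => pMap (g n) (z n)) l (nhds (pMap G z₀)) := by
  simp only [pMap_eq]
  exact (hz.sub ((Complex.continuous_conj.tendsto _).comp
    (tendsto_apply_of_tendsto hg hlim hz))).div_const 2

lemma tendstoLocallyUniformly_of_lipschitz : TendstoLocallyUniformly g G l := by
  rcases l.eq_or_neBot with rfl | hl
  · intro u _ x; exact ⟨univ, Filter.univ_mem, by simp⟩
  rw [Metric.tendstoLocallyUniformly_iff]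
  intro ε hε z
  refine ⟨ball z (ε / 3), ball_mem_nhds _ (by positivity), ?_⟩
  filter_upwards [Metric.tendsto_nhds.1 (hlim z) (ε / 3) (by positivity)] with n hn y hy
  have h1 := (hg n).dist_le_mul z y
  have h2 := (lipschitz_of_tendsto hg hlim).dist_le_mul y z
  rw [mem_ball] at hy
  rw [dist_comm z y] at h1
  simp only [NNReal.coe_one, one_mul] at h1 h2
  have h3 := dist_triangle4 (G y) (G z) (g n z) (g n y)
  rw [dist_comm (G z) (g n z)] at h3
  linarith

lemma eventually_differentiableAt_of_tendsto [l.NeBot] {z : ℂ} {r : ℝ} (hr : 0 < r)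
    (hd : ∀ᶠ n in l, DifferentiableOn ℂ (g n) (ball z r)) :
    ∀ᶠ y in nhds z, DifferentiableAt ℂ G y := by
  have h := (tendstoLocallyUniformly_of_lipschitz hg hlim).tendstoLocallyUniformlyOn
    (s := ball z r) |>.differentiableOn hd isOpen_ball
  filter_upwards [isOpen_ball.mem_nhds (mem_ball_self hr)] with y hy
  exact h.differentiableAt (isOpen_ball.mem_nhds hy)

lemma eventually_ball_subset_preimage_xMap {U : ℕ → Set ℂ} (hU : ∀ n, Convex ℝ (U n))
    (hUo : ∀ n, IsOpen (U n)) {z : ℂ} (hz : xMap G z ∈ interior (limSet l U)) :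
    ∃ r > 0, ∀ᶠ n in l, ball z r ⊆ xMap (g n) ⁻¹' U n := by
  obtain ⟨r, hr, h⟩ := exists_ball_of_mem_interior hU hUo hz
  refine ⟨r / 2, by positivity, ?_⟩
  filter_upwards [h, Metric.tendsto_nhds.1 (tendsto_xMap hg hlim (tendsto_const_nhds (x := z)))
    (r / 2) (by positivity)] with n hn hn' y hy
  apply hn
  have := (lipschitz_xMap (hg n)).dist_le_mul y z
  rw [mem_ball] at hy ⊢
  simp only [NNReal.coe_one, one_mul] at this
  linarith [dist_triangle (xMap (g n) y) (xMap (g n) z) (xMap G z)]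

lemma eventually_ball_subset_preimage_pMap {V : ℕ → Set ℂ} (hV : ∀ n, Convex ℝ (V n))
    (hVo : ∀ n, IsOpen (V n)) {z : ℂ} (hz : pMap G z ∈ interior (limSet l V)) :
    ∃ r > 0, ∀ᶠ n in l, ball z r ⊆ pMap (g n) ⁻¹' V n := by
  obtain ⟨r, hr, h⟩ := exists_ball_of_mem_interior hV hVo hz
  refine ⟨r / 2, by positivity, ?_⟩
  filter_upwards [h, Metric.tendsto_nhds.1 (tendsto_pMap hg hlim (tendsto_const_nhds (x := z)))
    (r / 2) (by positivity)] with n hn hn' y hy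
  apply hn
  have := (lipschitz_pMap (hg n)).dist_le_mul y z
  rw [mem_ball] at hy ⊢
  simp only [NNReal.coe_one, one_mul] at this
  linarith [dist_triangle (pMap (g n) y) (pMap (g n) z) (pMap G z)]

end limit

end PlanarOT

namespace PlanarOT

/-- A sequence of rescaled transport systems whose domains become unbounded in one direction. -/
structure BlowupSeq (ε : ℝ) (g : ℕ → ℂ → ℂ) (U V : ℕ → Set ℂ) (z q p : ℕ → ℂ) : Prop where
  ε_pos : 0 < ε
  ε_lt : ε < 1
  sys : ∀ n, TransportSystem (g n) (U n) (V n)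
  growth : ∀ n, ∀ a ∈ closure (xMap (g n) ⁻¹' U n), ∀ b ∈ closure (xMap (g n) ⁻¹' U n),
    ‖kMap (g n) a - kMap (g n) b‖ ≤ (‖wMap (g n) a - wMap (g n) b‖ + 1) ^ (1 - ε)
  map_zero : ∀ n, g n 0 = 0
  zero_mem : ∀ n, 0 ∈ closure (xMap (g n) ⁻¹' U n)
  mem : ∀ n, z n ∈ closure (xMap (g n) ⁻¹' U n)
  norm_kMap : ∀ n, ‖kMap (g n) (z n)‖ = 1
  norm_wMap : ∀ n, ‖wMap (g n) (z n)‖ ≤ 1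
  q_mem : ∀ n, q n ∈ U n
  q_atTop : Filter.Tendsto (fun n => ‖q n‖) Filter.atTop Filter.atTop
  q_im : Filter.Tendsto (fun n => (q n).im / ‖q n‖) Filter.atTop (nhds 0)
  p_mem : ∀ n, p n ∈ V n
  p_atTop : Filter.Tendsto (fun n => ‖p n‖) Filter.atTop Filter.atTop
  p_re : Filter.Tendsto (fun n => (p n).re / ‖p n‖) Filter.atTop (nhds 0)

/-- A limit of a blow-up sequence. -/
structure BlowupLimit (ε : ℝ) (g : ℕ → ℂ → ℂ) (U V : ℕ → Set ℂ) (z q p : ℕ → ℂ)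
    (u : Ultrafilter ℕ) (G : ℂ → ℂ) (z₀ : ℂ) : Prop
    extends BlowupSeq ε g U V z q p where
  le : (u : Filter ℕ) ≤ Filter.atTop
  lim : ∀ y, Filter.Tendsto (fun n => g n y) u (nhds (G y))
  lim_z : Filter.Tendsto z u (nhds z₀)

lemma BlowupSeq.exists_limit {ε : ℝ} {g : ℕ → ℂ → ℂ} {U V : ℕ → Set ℂ} {z q p : ℕ → ℂ}
    (H : BlowupSeq ε g U V z q p) : ∃ u G z₀, BlowupLimit ε g U V z q p u G z₀ := by
  have h1 : ∀ y, ∃ x, Filter.Tendsto (fun n => g n y) (Filter.hyperfilter ℕ) (nhds x) := by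
    intro y
    refine exists_tendsto_of_bounded _ (R := ‖y‖) (Filter.Eventually.of_forall fun n => ?_)
    simpa [dist_eq_norm, H.map_zero n] using (H.sys n).lip.dist_le_mul y 0
  choose G hG using h1
  obtain ⟨z₀, hz₀⟩ := exists_tendsto_of_bounded (Filter.hyperfilter ℕ) (x := z) (R := 2)
    (Filter.Eventually.of_forall fun n => by
      have h : ‖z n‖ = ‖wMap (g n) (z n) + kMap (g n) (z n)‖ := by simp [wMap, kMap]; ring_nf
      linarith [norm_add_le (wMap (g n) (z n)) (kMap (g n) (z n)), H.norm_kMap n, H.norm_wMap n])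
  exact ⟨_, G, z₀, ⟨H, Nat.hyperfilter_le_atTop, hG, hz₀⟩⟩

lemma recedes_or_of_tendsto (u : Ultrafilter ℕ) {U : ℕ → Set ℂ} (hU : ∀ n, Convex ℝ (U n))
    {q : ℕ → ℂ} (hq : ∀ n, q n ∈ U n)
    (hinf : Filter.Tendsto (fun n => ‖q n‖) u Filter.atTop) :
    ∃ c, ‖c‖ = 1 ∧ Filter.Tendsto (fun n => q n / ‖q n‖) u (nhds c) ∧
      Recedes (limSet u U) c := by
  have h1 : ∀ᶠ n in (u : Filter ℕ), ‖q n / ‖q n‖‖ = 1 := by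
    filter_upwards [hinf.eventually_gt_atTop 0] with n hn
    rw [norm_div, Complex.norm_real, norm_norm, div_self hn.ne']
  obtain ⟨c, hc⟩ := exists_tendsto_of_bounded u (h1.mono fun n hn => hn.le)
  refine ⟨c, ?_, hc, recedes_limSet hU hq hinf hc⟩
  exact tendsto_nhds_unique (hc.norm.congr' h1) tendsto_const_nhds

lemma eq_one_or_of_im_eq_zero {c : ℂ} (hc : ‖c‖ = 1) (h : c.im = 0) : c = 1 ∨ c = -1 := by
  have h1 : c.re ^ 2 = 1 := by
    have := Complex.sq_norm c
    rw [hc, Complex.normSq_apply, h] at this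
    nlinarith
  rcases mul_self_eq_one_iff.1 ((sq c.re).symm.trans h1) with h2 | h2
  · left; apply Complex.ext <;> simp [h, h2]
  · right; apply Complex.ext <;> simp [h, h2]

lemma eq_I_or_of_re_eq_zero {c : ℂ} (hc : ‖c‖ = 1) (h : c.re = 0) :
    c = Complex.I ∨ c = -Complex.I := by
  rcases eq_one_or_of_im_eq_zero (c := c * -Complex.I) (by simp [hc]) (by simp [h]) with h1 | h1
  · left; linear_combination Complex.I * h1 + c * Complex.I_sq
  · right; linear_combination Complex.I * h1 + c * Complex.I_sq

namespace BlowupLimit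
variable {ε : ℝ} {g : ℕ → ℂ → ℂ} {U V : ℕ → Set ℂ} {z q p : ℕ → ℂ} {u : Ultrafilter ℕ} {G : ℂ → ℂ}
  {z₀ : ℂ} (H : BlowupLimit ε g U V z q p u G z₀)
include H

lemma lips (n : ℕ) : LipschitzWith 1 (g n) := (H.sys n).lip

lemma lip : LipschitzWith 1 G := lipschitz_of_tendsto H.lips H.lim

lemma map_zero' : G 0 = 0 :=
  tendsto_nhds_unique (H.lim 0) (by simp only [H.map_zero]; exact tendsto_const_nhds)

lemma norm_kMap_lim : ‖kMap G z₀‖ = 1 :=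
  tendsto_nhds_unique ((tendsto_kMap H.lips H.lim H.lim_z).norm)
    (by simp only [H.norm_kMap]; exact tendsto_const_nhds)

lemma recedesA : Recedes (limSet u U) 1 ∨ Recedes (limSet u U) (-1) := by
  obtain ⟨c, hc, hlim, hrec⟩ := recedes_or_of_tendsto u (fun n => (H.sys n).convexU) H.q_mem
    (H.q_atTop.mono_left H.le)
  have h1 : c.im = 0 := by
    refine tendsto_nhds_unique ((Complex.continuous_im.tendsto _).comp hlim) ?_
    refine (H.q_im.mono_left H.le).congr fun n => ?_
    simp [Complex.div_ofReal_im]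
  rcases eq_one_or_of_im_eq_zero hc h1 with rfl | rfl
  exacts [Or.inl hrec, Or.inr hrec]

lemma recedesB : Recedes (limSet u V) Complex.I ∨ Recedes (limSet u V) (-Complex.I) := by
  obtain ⟨c, hc, hlim, hrec⟩ := recedes_or_of_tendsto u (fun n => (H.sys n).convexV) H.p_mem
    (H.p_atTop.mono_left H.le)
  have h1 : c.re = 0 := by
    refine tendsto_nhds_unique ((Complex.continuous_re.tendsto _).comp hlim) ?_
    refine (H.p_re.mono_left H.le).congr fun n => ?_
    simp [Complex.div_ofReal_re]
  rcases eq_I_or_of_re_eq_zero hc h1 with rfl | rfl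
  exacts [Or.inl hrec, Or.inr hrec]

lemma xMap_mem_of_tendsto {a : ℕ → ℂ} {b : ℂ}
    (ha : ∀ᶠ n in (u : Filter ℕ), a n ∈ closure (xMap (g n) ⁻¹' U n))
    (hab : Filter.Tendsto a u (nhds b)) : xMap G b ∈ limSet u U := by
  refine mem_limSet_of_tendsto (ha.mono fun n hn => ?_) (tendsto_xMap H.lips H.lim hab)
  exact (continuous_xMap (H.lips n)).closure_preimage_subset _ hn

lemma pMap_mem_of_tendsto {a : ℕ → ℂ} {b : ℂ}
    (ha : ∀ᶠ n in (u : Filter ℕ), a n ∈ closure (xMap (g n) ⁻¹' U n))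
    (hab : Filter.Tendsto a u (nhds b)) : pMap G b ∈ limSet u V := by
  refine mem_limSet_of_tendsto (ha.mono fun n hn => ?_) (tendsto_pMap H.lips H.lim hab)
  rw [(H.sys n).preimage_eq] at hn
  exact (continuous_pMap (H.lips n)).closure_preimage_subset _ hn

lemma exists_ball_of_xMap_mem {y : ℂ} (hy : xMap G y ∈ interior (limSet u U)) :
    ∃ r > 0, ∀ᶠ n in (u : Filter ℕ), ball y r ⊆ xMap (g n) ⁻¹' U n :=
  eventually_ball_subset_preimage_xMap H.lips H.lim (fun n => (H.sys n).convexU)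
    (fun n => (H.sys n).openU) hy

lemma exists_ball_of_pMap_mem {y : ℂ} (hy : pMap G y ∈ interior (limSet u V)) :
    ∃ r > 0, ∀ᶠ n in (u : Filter ℕ), ball y r ⊆ xMap (g n) ⁻¹' U n := by
  obtain ⟨r, hr, h⟩ := eventually_ball_subset_preimage_pMap H.lips H.lim
    (fun n => (H.sys n).convexV) (fun n => (H.sys n).openV) hy
  exact ⟨r, hr, h.mono fun n hn => (H.sys n).preimage_eq ▸ hn⟩

lemma eventually_differentiableAt {y : ℂ} {r : ℝ} (hr : 0 < r)
    (h : ∀ᶠ n in (u : Filter ℕ), ball y r ⊆ xMap (g n) ⁻¹' U n) :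
    ∀ᶠ x in nhds y, DifferentiableAt ℂ G x :=
  eventually_differentiableAt_of_tendsto H.lips H.lim hr
    (h.mono fun n hn => (H.sys n).diff.mono hn)

lemma growth_lim {y y' : ℂ} (hy : xMap G y ∈ interior (limSet u U))
    (hy' : xMap G y' ∈ interior (limSet u U)) :
    ‖kMap G y - kMap G y'‖ ≤ (‖wMap G y - wMap G y'‖ + 1) ^ (1 - ε) := by
  obtain ⟨r, hr, h⟩ := H.exists_ball_of_xMap_mem hy
  obtain ⟨r', hr', h'⟩ := H.exists_ball_of_xMap_mem hy'
  have hK := ((tendsto_kMap H.lips H.lim (tendsto_const_nhds (x := y))).sub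
    (tendsto_kMap H.lips H.lim (tendsto_const_nhds (x := y')))).norm
  have hW := ((((tendsto_wMap H.lips H.lim (tendsto_const_nhds (x := y))).sub
    (tendsto_wMap H.lips H.lim (tendsto_const_nhds (x := y')))).norm).add_const 1).rpow_const
    (p := 1 - ε) (Or.inr (by linarith [H.ε_lt]))
  refine le_of_tendsto_of_tendsto hK hW ?_
  filter_upwards [h, h'] with n hn hn'
  exact H.growth n _ (subset_closure (hn (mem_ball_self hr))) _
    (subset_closure (hn' (mem_ball_self hr')))

/-- The limit set contains an open half strip when the limit point has a nonzero height. -/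
lemma exists_mem_interior (hv : (kMap G z₀).im ≠ 0) :
    ∃ y ∈ interior (limSet u U), y.im = (kMap G z₀).im / 2 := by
  set v := (kMap G z₀).im with hvdef
  set s := (wMap G z₀).re with hs
  have h0 : (0 : ℂ) ∈ limSet u U := by
    have := H.xMap_mem_of_tendsto (Filter.Eventually.of_forall H.zero_mem) tendsto_const_nhds
    rwa [xMap_eq, H.map_zero', map_zero, add_zero, zero_div] at this
  have h1 : xMap G z₀ ∈ limSet u U :=
    H.xMap_mem_of_tendsto (Filter.Eventually.of_forall H.mem) H.lim_z
  have hconv : Convex ℝ (limSet u U) := convex_limSet fun n => (H.sys n).convexU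
  have key : ∀ c : ℝ, (c = 1 ∨ c = -1) → Recedes (limSet u U) c →
      ∃ y ∈ interior (limSet u U), y.im = v / 2 := by
    intro c hc hrec
    have hcc : c * c = 1 := by rcases hc with rfl | rfl <;> norm_num
    have hopen : IsOpen {y : ℂ | |s| < c * y.re ∧ 0 < y.im / v ∧ y.im / v < 1} := by
      refine (isOpen_lt continuous_const (continuous_const.mul Complex.continuous_re)).and ?_
      exact (isOpen_lt continuous_const (Complex.continuous_im.div_const _)).and
        (isOpen_lt (Complex.continuous_im.div_const _) continuous_const)
    refine ⟨⟨c * (|s| + 1), v / 2⟩, interior_maximal ?_ hopen ?_, rfl⟩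
    · rintro y ⟨hy1, hy2, hy3⟩
      set θ := y.im / v with hθ
      have h2 : (θ : ℂ) * xMap G z₀ ∈ limSet u U := by
        have := hconv h1 h0 hy2.le (by linarith : 0 ≤ 1 - θ) (by ring)
        simpa using this
      have hT : 0 ≤ c * y.re - θ * c * s := by
        have : |θ * c * s| ≤ |s| := by
          rw [abs_mul, abs_mul, show |c| = 1 by rcases hc with rfl | rfl <;> simp,
            abs_of_pos hy2]
          nlinarith [abs_nonneg s]
        linarith [le_abs_self (θ * c * s)]
      have h3 := hrec _ h2 _ hT
      convert h3 using 1
      apply Complex.ext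
      · simp [← hs]; linear_combination (θ * s - y.re) * hcc
      · simp [← hvdef, hθ]; field_simp
    · refine ⟨?_, ?_, ?_⟩
      · change |s| < c * (c * (|s| + 1)); rw [← mul_assoc, hcc]; linarith
      · change 0 < v / 2 / v; rw [div_right_comm, div_self hv]; norm_num
      · change v / 2 / v < 1; rw [div_right_comm, div_self hv]; norm_num
  rcases H.recedesA with h | h
  · exact key 1 (Or.inl rfl) (by simpa using h)
  · exact key (-1) (Or.inr rfl) (by simpa using h)

end BlowupLimit

end PlanarOT

namespace PlanarOT

lemma abs_le_of_monotone_pos {s t u v s' t' u' v' : ℝ} (hv : 0 < v) (h0 : 0 ≤ s * u + t * (v / 2))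
    (h1 : 0 ≤ (s - s') * (u - u') + (t - t') * (v / 2 - v')) (hs : |s'| ≤ 1) (ht : |t'| ≤ 1)
    (hu : |u'| ≤ 1) (hv' : |v' - v| < v / 4) : |t| ≤ 1 + 4 * (|s| + 1) * (|u| + 1) / v := by
  have hsu : |s * u| ≤ (|s| + 1) * (|u| + 1) := by
    rw [abs_mul]; nlinarith [abs_nonneg s, abs_nonneg u]
  have hsu' : |(s - s') * (u - u')| ≤ (|s| + 1) * (|u| + 1) := by
    rw [abs_mul]
    gcongr
    · exact (abs_sub _ _).trans (by linarith)
    · exact (abs_sub _ _).trans (by linarith)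
  have hX : 0 ≤ (|s| + 1) * (|u| + 1) := by positivity
  obtain ⟨hv1, hv2⟩ := abs_lt.1 hv'
  have h2 := le_abs_self (s * u)
  have h3 := le_abs_self ((s - s') * (u - u'))
  obtain ⟨ht1, ht2⟩ := abs_le.1 ht
  set X := (|s| + 1) * (|u| + 1) with hXdef
  have h4 : 4 * (|s| + 1) * (|u| + 1) / v = 4 * X / v := by rw [hXdef]; ring
  rw [h4, abs_le]
  have h5 : 4 * X / v * v = 4 * X := by field_simp
  have h6 : 0 ≤ 4 * X / v := by positivity
  set Y := 4 * X / v
  constructor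
  · nlinarith
  · by_contra hcon
    push Not at hcon
    have h7 : 0 < t - t' := by linarith
    nlinarith

lemma abs_le_of_monotone {s t u v s' t' u' v' : ℝ} (hv : v ≠ 0) (h0 : 0 ≤ s * u + t * (v / 2))
    (h1 : 0 ≤ (s - s') * (u - u') + (t - t') * (v / 2 - v')) (hs : |s'| ≤ 1) (ht : |t'| ≤ 1)
    (hu : |u'| ≤ 1) (hv' : |v' - v| < |v| / 4) :
    |t| ≤ (1 + 4 * (|s| + 1) / |v|) * (|u| + 1) := by
  have key : |t| ≤ 1 + 4 * (|s| + 1) * (|u| + 1) / |v| := by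
    rcases hv.lt_or_gt with hneg | hpos
    · have := abs_le_of_monotone_pos (s := s) (t := -t) (u := u) (v := -v) (s' := s') (t' := -t')
        (u' := u') (v' := -v') (by linarith) (by linarith) (by linarith) hs (by rwa [abs_neg]) hu
        (by rw [abs_of_neg hneg] at hv'; rwa [neg_sub_neg, abs_sub_comm])
      rwa [abs_neg, ← abs_of_neg hneg] at this
    · rw [abs_of_pos hpos] at hv' ⊢
      exact abs_le_of_monotone_pos hpos h0 h1 hs ht hu hv'
  refine key.trans ?_
  rw [add_mul, one_mul, div_mul_eq_mul_div]
  linarith [abs_nonneg u]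

namespace BlowupLimit
variable {ε : ℝ} {g : ℕ → ℂ → ℂ} {U V : ℕ → Set ℂ} {z q p : ℕ → ℂ} {u : Ultrafilter ℕ} {G : ℂ → ℂ}
  {z₀ : ℂ} (H : BlowupLimit ε g U V z q p u G z₀)
include H

lemma exists_xMap_mem (hv : (kMap G z₀).im ≠ 0) : ∃ ζ, xMap G ζ ∈ interior (limSet u U) := by
  obtain ⟨y, hy, hyim⟩ := H.exists_mem_interior hv
  set v := (kMap G z₀).im with hvdef
  have hyU : ∀ᶠ n in (u : Filter ℕ), y ∈ U n := by
    obtain ⟨r, hr, h⟩ := exists_ball_of_mem_interior (fun n => (H.sys n).convexU)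
      (fun n => (H.sys n).openU) hy
    exact h.mono fun n hn => hn (mem_ball_self hr)
  have hex : ∀ n, ∃ ζ, y ∈ U n → xMap (g n) ζ = y := fun n => by
    by_cases h : y ∈ U n
    · obtain ⟨ζ, hζ⟩ := (H.sys n).surjX h
      exact ⟨ζ, fun _ => hζ⟩
    · exact ⟨0, fun h' => absurd h' h⟩
  choose ζ hζ using hex
  set D := 1 + 4 * (|y.re| + 1) / |v| with hD
  have hv0 : 0 < |v| := abs_pos.2 hv
  have hD0 : 0 ≤ D := by positivity
  obtain ⟨M, hM⟩ := exists_bound_of_le_rpow H.ε_pos H.ε_lt (C := |y.re| + D + 1) (by positivity)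
  have hbd : ∀ᶠ n in (u : Filter ℕ), ‖ζ n‖ ≤ |y.re| + D * (M + 1) + (M + |v / 2|) := by
    have hvn := Metric.tendsto_nhds.1 ((Complex.continuous_im.tendsto _).comp
      (tendsto_kMap H.lips H.lim H.lim_z)) (|v| / 4) (by positivity)
    filter_upwards [hyU, hvn] with n hn hvn
    have hx := hζ n hn
    have hs : (wMap (g n) (ζ n)).re = y.re := by simpa using congrArg Complex.re hx
    have hv : (kMap (g n) (ζ n)).im = v / 2 := by
      rw [← hyim]; simpa using congrArg Complex.im hx
    have hw0 : wMap (g n) 0 = 0 := by simp [wMap, H.map_zero]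
    have hk0 : kMap (g n) 0 = 0 := by simp [kMap, H.map_zero]
    have m0 := monotone_of_lipschitz (H.lips n) (ζ n) 0
    have m1 := monotone_of_lipschitz (H.lips n) (ζ n) (z n)
    simp only [hw0, hk0, hs, hv, Complex.zero_re, Complex.zero_im, sub_zero] at m0
    simp only [hs, hv] at m1
    have ht := abs_le_of_monotone (by assumption) m0 m1
      ((Complex.abs_re_le_norm _).trans (H.norm_wMap n))
      ((Complex.abs_im_le_norm _).trans (H.norm_wMap n))
      ((Complex.abs_re_le_norm _).trans (H.norm_kMap n).le) hvn
    have hgr := H.growth n (ζ n) (subset_closure (by rw [mem_preimage, hx]; exact hn)) 0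
      (H.zero_mem n)
    rw [hw0, hk0, sub_zero, sub_zero] at hgr
    have hw : ‖wMap (g n) (ζ n)‖ ≤ |y.re| + |(wMap (g n) (ζ n)).im| :=
      hs ▸ Complex.norm_le_abs_re_add_abs_im _
    have hk : ‖kMap (g n) (ζ n)‖ ≤ |(kMap (g n) (ζ n)).re| + |v / 2| :=
      hv ▸ Complex.norm_le_abs_re_add_abs_im _
    have hu := hM |(kMap (g n) (ζ n)).re| (abs_nonneg _) (by
      refine ((Complex.abs_re_le_norm _).trans hgr).trans ?_
      refine Real.rpow_le_rpow (by positivity) ?_ (by linarith [H.ε_lt])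
      nlinarith [abs_nonneg (kMap (g n) (ζ n)).re, abs_nonneg y.re])
    have hsum : ‖ζ n‖ ≤ ‖wMap (g n) (ζ n)‖ + ‖kMap (g n) (ζ n)‖ := by
      conv_lhs => rw [← wMap_add_kMap (G := g n) (ζ n)]
      exact norm_add_le _ _
    have : D * (|(kMap (g n) (ζ n)).re| + 1) ≤ D * (M + 1) := by gcongr
    linarith
  obtain ⟨ζ₀, hζ₀⟩ := exists_tendsto_of_bounded u hbd
  refine ⟨ζ₀, ?_⟩
  have h1 := tendsto_xMap H.lips H.lim hζ₀
  have h2 : xMap G ζ₀ = y := tendsto_nhds_unique h1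
    (tendsto_const_nhds.congr' (hyU.mono fun n hn => (hζ n hn).symm))
  rwa [h2]

/-- The limit is strictly nonexpansive wherever it is holomorphic, unless the height of the limit
point vanishes. -/
lemma norm_deriv_lt (hv : (kMap G z₀).im ≠ 0) {Ω : Set ℂ} (hΩ : IsOpen Ω)
    (hconn : IsPreconnected Ω) (hd : DifferentiableOn ℂ G Ω)
    (h1 : ∀ y ∈ Ω, xMap G y ∈ interior (limSet u U))
    (h2 : ∀ y ∈ closure Ω, xMap G y ∈ interior (limSet u U) → y ∈ Ω) {y : ℂ} (hy : y ∈ Ω) :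
    ‖deriv G y‖ < 1 := by
  refine lt_of_le_of_ne (norm_deriv_le_one H.lip y) fun heq => ?_
  obtain ⟨μ, hμ, hline⟩ := exists_line_of_norm_deriv_eq H.lip hΩ hconn hd h1 h2 hy heq
  have him : μ.im = 0 := by
    by_contra hne
    have hb : 0 < |μ.im| := abs_pos.2 hne
    obtain ⟨M, hM⟩ := exists_bound_of_le_rpow H.ε_pos H.ε_lt (C := 1 + 1 / |μ.im|) (by positivity)
    have h3 := hM (|M| + 1) (by positivity) (by
      set τ := (|M| + 1) / |μ.im| with hτ
      have hτ0 : 0 ≤ τ := by positivity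
      obtain ⟨m1, hw, hk⟩ := hline τ
      have := H.growth_lim (h1 _ m1) (h1 _ hy)
      rw [hw, hk, add_sub_cancel_left, sub_sub_cancel_left, norm_neg] at this
      have e1 : ‖(τ : ℂ) * μ.im‖ = |M| + 1 := by
        rw [norm_mul, Complex.norm_real, Complex.norm_real, Real.norm_of_nonneg hτ0,
          Real.norm_eq_abs, hτ, div_mul_cancel₀ _ hb.ne']
      have e2 : ‖(τ : ℂ) * μ.re * Complex.I‖ ≤ τ := by
        rw [norm_mul, norm_mul, Complex.norm_I, mul_one, Complex.norm_real, Complex.norm_real,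
          Real.norm_of_nonneg hτ0, Real.norm_eq_abs]
        have := Complex.abs_re_le_norm μ
        rw [hμ] at this
        nlinarith
      rw [e1] at this
      refine this.trans (Real.rpow_le_rpow (by positivity) ?_ (by linarith [H.ε_lt]))
      have e3 : τ = 1 / |μ.im| * (|M| + 1) := by rw [hτ]; ring
      have e4 : 0 ≤ 1 / |μ.im| := by positivity
      nlinarith [abs_nonneg M])
    linarith [le_abs_self M]
  have hre : μ.re * μ.re = 1 := by
    have := Complex.sq_norm μ
    rw [hμ, Complex.normSq_apply, him] at this
    linarith
  have hconst : ∀ x, (kMap G x).im = (kMap G y).im := by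
    intro x
    by_contra hne
    have hne' : (kMap G x).im - (kMap G y).im ≠ 0 := sub_ne_zero.2 hne
    set a := ((wMap G x).re - (wMap G y).re) * ((kMap G x).re - (kMap G y).re)
    set b := (wMap G x).im - (wMap G y).im
    set c := (kMap G x).im - (kMap G y).im
    obtain ⟨-, hw, hk⟩ := hline (μ.re * ((a + 1) / c + b))
    have hm := monotone_of_lipschitz H.lip x
      (y + ((μ.re * ((a + 1) / c + b) : ℝ) : ℂ) * (μ * Complex.I))
    rw [hw, hk, him] at hm
    simp only [Complex.add_re, Complex.add_im, Complex.mul_re, Complex.mul_im, Complex.ofReal_re,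
      Complex.ofReal_im, Complex.I_re, Complex.I_im, Complex.sub_re, Complex.sub_im] at hm
    ring_nf at hm
    have h4 : 0 ≤ a + (b - μ.re * μ.re * ((a + 1) / c + b)) * c := by
      convert hm using 1
      simp only [a, b, c]
      ring
    rw [hre] at h4
    have h5 : (a + 1) / c * c = a + 1 := div_mul_cancel₀ _ hne'
    nlinarith
  apply hv
  rw [hconst z₀, ← hconst 0]
  simp [kMap, H.map_zero']

end BlowupLimit

end PlanarOT

namespace PlanarOT

namespace BlowupLimit
variable {ε : ℝ} {g : ℕ → ℂ → ℂ} {U V : ℕ → Set ℂ} {z q p : ℕ → ℂ} {u : Ultrafilter ℕ} {G : ℂ → ℂ}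
  {z₀ : ℂ} (H : BlowupLimit ε g U V z q p u G z₀)
include H

/-- The limit of a blow-up sequence is a limit configuration. -/
lemma exists_limitBase (hv : (kMap G z₀).im ≠ 0) :
    ∃ Ω, LimitBase ε G (limSet u U) (limSet u V) Ω := by
  obtain ⟨ζ, hζ⟩ := H.exists_xMap_mem hv
  set A := limSet u U with hA
  set B := limSet u V with hB
  set O := xMap G ⁻¹' interior A with hO
  have hOo : IsOpen O := isOpen_interior.preimage (continuous_xMap H.lip)
  set Ω := connectedComponentIn O ζ with hΩdef
  have hΩ : IsOpen Ω := hOo.connectedComponentIn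
  have hconn : IsPreconnected Ω := isPreconnected_connectedComponentIn
  have hsub : Ω ⊆ O := connectedComponentIn_subset _ _
  have hdO : ∀ y ∈ O, DifferentiableAt ℂ G y := fun y hy => by
    obtain ⟨r, hr, h⟩ := H.exists_ball_of_xMap_mem hy
    exact (H.eventually_differentiableAt hr h).self_of_nhds
  have hd : DifferentiableOn ℂ G Ω := fun y hy => (hdO y (hsub hy)).differentiableWithinAt
  have h2 : ∀ y ∈ closure Ω, xMap G y ∈ interior A → y ∈ Ω := fun y hy hy' =>
    mem_connectedComponentIn_of_mem_closure hζ hy' hy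
  have hlt : ∀ y ∈ Ω, ‖deriv G y‖ < 1 := fun y hy =>
    H.norm_deriv_lt hv hΩ hconn hd hsub h2 hy
  have hPB : ∀ y ∈ O, pMap G y ∈ B := fun y hy => by
    obtain ⟨r, hr, h⟩ := H.exists_ball_of_xMap_mem hy
    exact H.pMap_mem_of_tendsto (h.mono fun n hn => subset_closure (hn (mem_ball_self hr)))
      tendsto_const_nhds
  have hAc : IsClosed A := isClosed_limSet
  have hBc : IsClosed B := isClosed_limSet
  have hAconv : Convex ℝ A := convex_limSet fun n => (H.sys n).convexU
  have hP : ∀ y ∈ Ω, pMap G y ∈ interior B := fun y hy => by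
    rw [mem_interior_iff_mem_nhds, ← map_nhds_pMap _ (hlt y hy)]
    · rw [Filter.mem_map]
      filter_upwards [hΩ.mem_nhds hy] with x hx using hPB x (hsub hx)
    · filter_upwards [hΩ.mem_nhds hy] with x hx using hdO x (hsub hx)
  have hfr : ∀ y ∈ frontier Ω, y ∈ closure Ω ∧ y ∉ Ω := fun y hy => by
    rw [hΩ.frontier_eq] at hy; exact hy
  refine ⟨Ω, ⟨H.ε_pos, H.ε_lt, H.lip, hAc, hBc, hAconv, convex_limSet fun n => (H.sys n).convexV,
    hΩ, hconn, ⟨ζ, mem_connectedComponentIn hζ⟩, hd, fun y hy y' hy' =>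
      strict_of_norm_deriv_lt H.lip (hdO y (hsub hy)) (hlt y hy) hy', hsub, hP, ?_, ?_, ?_⟩⟩
  · intro y hy
    obtain ⟨hy1, hy2⟩ := hfr y hy
    exact ⟨closure_minimal (t := xMap G ⁻¹' A) (fun x hx => interior_subset (s := A) (hsub hx))
      (hAc.preimage (continuous_xMap H.lip)) hy1, fun h => hy2 (h2 y hy1 h)⟩
  · intro y hy
    obtain ⟨hy1, hy2⟩ := hfr y hy
    refine ⟨closure_minimal (t := pMap G ⁻¹' B) (fun x hx => interior_subset (s := B) (hP x hx))
      (hBc.preimage (continuous_pMap H.lip)) hy1, fun h => ?_⟩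
    have hyA : xMap G y ∉ interior A := fun h => hy2 (h2 y hy1 h)
    obtain ⟨f, hf⟩ := geometric_hahn_banach_open_point hAconv.interior isOpen_interior hyA
    obtain ⟨r, hr, hball⟩ := H.exists_ball_of_pMap_mem h
    have hle : ∀ a ∈ A, f a ≤ f (xMap G y) := by
      intro a ha
      have : a ∈ closure (interior A) := by
        rw [hAconv.closure_interior_eq_closure_of_nonempty_interior ⟨_, hζ⟩]
        exact subset_closure ha
      exact closure_minimal (t := {a | f a ≤ f (xMap G y)}) (fun a ha => (hf a ha).le)
        (isClosed_le f.continuous continuous_const) this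
    have hev : ∀ᶠ x in nhds y, f (xMap G x) ≤ f (xMap G y) := by
      filter_upwards [ball_mem_nhds y hr] with x hx
      exact hle _ (H.xMap_mem_of_tendsto (hball.mono fun n hn => subset_closure (hn hx))
        tendsto_const_nhds)
    have heq := eventually_eq_of_isLocalMax_xMap (H.eventually_differentiableAt hr hball) f hev
    obtain ⟨x, hx, hxΩ⟩ := mem_closure_iff_nhds.1 hy1 _ heq
    exact (hf _ (hsub hxΩ)).ne hx
  · have hcl : IsClosed {x : ℂ × ℂ | ‖kMap G x.1 - kMap G x.2‖ ≤
        (‖wMap G x.1 - wMap G x.2‖ + 1) ^ (1 - ε)} := by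
      have hk := continuous_kMap H.lip
      have hw := continuous_wMap H.lip
      refine isClosed_le (by fun_prop) (Continuous.rpow_const (by fun_prop) fun x => ?_)
      exact Or.inr (by linarith [H.ε_lt])
    intro a ha b hb
    have hmem : (a, b) ∈ closure (Ω ×ˢ Ω) := by rw [closure_prod_eq]; exact ⟨ha, hb⟩
    exact closure_minimal (fun x hx => H.growth_lim (hsub hx.1) (hsub hx.2)) hcl hmem

lemma im_kMap_eq_zero : (kMap G z₀).im = 0 := by
  by_contra hv
  obtain ⟨Ω, h⟩ := H.exists_limitBase hv
  exact h.elim H.recedesA H.recedesB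

end BlowupLimit

lemma preimage_xMap_conjBy (G : ℂ → ℂ) (V : Set ℂ) :
    xMap (conjBy circleI G) ⁻¹' (reflect circleI ⁻¹' V) = reflect circleI ⁻¹' (pMap G ⁻¹' V) := by
  ext y; simp only [mem_preimage, xMap_conjBy_circleI, reflect_reflect]

lemma preimage_pMap_conjBy (G : ℂ → ℂ) (U : Set ℂ) :
    pMap (conjBy circleI G) ⁻¹' (reflect circleI ⁻¹' U) = reflect circleI ⁻¹' (xMap G ⁻¹' U) := by
  ext y; simp only [mem_preimage, pMap_conjBy_circleI, reflect_reflect]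

/-- Exchanging the roles of the two domains. -/
lemma TransportSystem.swap {G : ℂ → ℂ} {U V : Set ℂ} (H : TransportSystem G U V) :
    TransportSystem (conjBy circleI G) (reflect circleI ⁻¹' V) (reflect circleI ⁻¹' U) where
  lip := lipschitz_conjBy _ H.lip
  openU := H.openV.preimage (reflect circleI).continuous
  openV := H.openU.preimage (reflect circleI).continuous
  convexU := H.convexV.linear_preimage (reflect circleI).toLinearEquiv.toLinearMap
  convexV := H.convexU.linear_preimage (reflect circleI).toLinearEquiv.toLinearMap
  preimage_eq := by rw [preimage_xMap_conjBy, preimage_pMap_conjBy, H.preimage_eq]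
  diff := by
    rw [preimage_xMap_conjBy, ← H.preimage_eq]
    intro y hy
    refine (differentiableAt_conjBy _ (H.diff.differentiableAt ?_)).differentiableWithinAt
    exact (H.openU.preimage (continuous_xMap H.lip)).mem_nhds hy
  surjX := by
    intro y hy
    obtain ⟨x, hx⟩ := H.surjP hy
    exact ⟨reflect circleI x, by rw [xMap_conjBy_circleI, reflect_reflect, hx, reflect_reflect]⟩
  surjP := by
    intro y hy
    obtain ⟨x, hx⟩ := H.surjX hy
    exact ⟨reflect circleI x, by rw [pMap_conjBy_circleI, reflect_reflect, hx, reflect_reflect]⟩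

namespace BlowupSeq
variable {ε : ℝ} {g : ℕ → ℂ → ℂ} {U V : ℕ → Set ℂ} {z q p : ℕ → ℂ}
  (H : BlowupSeq ε g U V z q p)
include H

lemma closure_swap (n : ℕ) {y : ℂ} :
    y ∈ closure (xMap (conjBy circleI (g n)) ⁻¹' (reflect circleI ⁻¹' V n)) ↔
      reflect circleI y ∈ closure (xMap (g n) ⁻¹' U n) := by
  rw [preimage_xMap_conjBy, ← (H.sys n).preimage_eq]
  exact (Set.ext_iff.1 ((reflect circleI).toHomeomorph.preimage_closure _) y).symm

lemma swap : BlowupSeq ε (fun n => conjBy circleI (g n)) (fun n => reflect circleI ⁻¹' V n)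
    (fun n => reflect circleI ⁻¹' U n) (fun n => reflect circleI (z n))
    (fun n => reflect circleI (p n)) (fun n => reflect circleI (q n)) where
  ε_pos := H.ε_pos
  ε_lt := H.ε_lt
  sys n := (H.sys n).swap
  growth n a ha b hb := by
    have := H.growth n _ ((H.closure_swap n).1 ha) _ ((H.closure_swap n).1 hb)
    simpa only [kMap_conjBy, wMap_conjBy, ← map_sub, LinearIsometryEquiv.norm_map] using this
  map_zero n := by simp [conjBy, H.map_zero n]
  zero_mem n := (H.closure_swap n).2 (by simpa using H.zero_mem n)
  mem n := (H.closure_swap n).2 (by simpa using H.mem n)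
  norm_kMap n := by simpa [kMap_conjBy] using H.norm_kMap n
  norm_wMap n := by simpa [wMap_conjBy] using H.norm_wMap n
  q_mem n := by simpa using H.p_mem n
  q_atTop := by simpa using H.p_atTop
  q_im := by
    simp only [LinearIsometryEquiv.norm_map]
    simpa only [reflect_circleI] using H.p_re
  p_mem n := by simpa using H.q_mem n
  p_atTop := by simpa using H.q_atTop
  p_re := by
    simp only [LinearIsometryEquiv.norm_map]
    simpa only [reflect_circleI] using H.q_im

/-- There are no blow-up sequences. -/
theorem elim : False := by
  obtain ⟨u, G, z₀, h⟩ := H.exists_limit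
  have h1 := h.im_kMap_eq_zero
  have h2 : BlowupLimit ε (fun n => conjBy circleI (g n)) (fun n => reflect circleI ⁻¹' V n)
    (fun n => reflect circleI ⁻¹' U n) (fun n => reflect circleI (z n))
    (fun n => reflect circleI (p n)) (fun n => reflect circleI (q n)) u (conjBy circleI G)
    (reflect circleI z₀) := ⟨H.swap, h.le, fun y =>
      ((reflect circleI).continuous.tendsto _).comp (h.lim (reflect circleI y)),
      ((reflect circleI).continuous.tendsto _).comp h.lim_z⟩
  have h3 := h2.im_kMap_eq_zero
  rw [kMap_conjBy, reflect_reflect, reflect_circleI] at h3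
  have h4 := h.norm_kMap_lim
  rw [show kMap G z₀ = 0 from Complex.ext h3 h1, norm_zero] at h4
  exact zero_ne_one h4

end BlowupSeq

end PlanarOT

namespace PlanarOT

/-- A coordinatewise affine change of variables. -/
def stretch (a b : ℝ) (c y : ℂ) : ℂ := ⟨y.re / a + c.re, y.im / b + c.im⟩

@[simp] lemma stretch_re (a b : ℝ) (c y : ℂ) : (stretch a b c y).re = y.re / a + c.re := rfl
@[simp] lemma stretch_im (a b : ℝ) (c y : ℂ) : (stretch a b c y).im = y.im / b + c.im := rfl

lemma continuous_stretch (a b : ℝ) (c : ℂ) : Continuous (stretch a b c) := by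
  have : stretch a b c = fun y => ((y.re / a + c.re : ℝ) : ℂ) + ((y.im / b + c.im : ℝ) : ℂ)
      * Complex.I := by
    funext y; apply Complex.ext <;> simp
  rw [this]
  have h1 : Continuous fun y : ℂ => y.re / a + c.re :=
    (Complex.continuous_re.div_const a).add continuous_const
  have h2 : Continuous fun y : ℂ => y.im / b + c.im :=
    (Complex.continuous_im.div_const b).add continuous_const
  exact (Complex.continuous_ofReal.comp h1).add
    ((Complex.continuous_ofReal.comp h2).mul continuous_const)

lemma Convex.preimage_stretch {U : Set ℂ} (hU : Convex ℝ U) (a b : ℝ) (c : ℂ) :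
    Convex ℝ (stretch a b c ⁻¹' U) := by
  intro x hx y hy s t hs ht hst
  have := hU hx hy hs ht hst
  rw [mem_preimage]
  convert this using 1
  apply Complex.ext
  · simp; linear_combination -c.re * hst
  · simp; linear_combination -c.im * hst

/-- The map `z ↦ z + κ * G z` for a nonexpansive map `G` and `|κ| < 1`. -/
lemma exists_homeomorph_add_mul {G : ℂ → ℂ} (hG : LipschitzWith 1 G) {κ : ℝ} (hκ : |κ| < 1) :
    ∃ T : ℂ ≃ₜ ℂ, ∀ z, T z = z + κ * G z := by
  have h : ApproximatesLinearOn (fun z => z + κ * G z)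
      ((ContinuousLinearEquiv.refl ℝ ℂ : ℂ ≃L[ℝ] ℂ) : ℂ →L[ℝ] ℂ) univ ⟨|κ|, abs_nonneg κ⟩ := by
    intro x _ y _
    have h1 := hG.dist_le_mul x y
    simp only [NNReal.coe_one, one_mul, dist_eq_norm] at h1
    simp only [ContinuousLinearEquiv.coe_refl, ContinuousLinearMap.coe_id', id]
    rw [show x + κ * G x - (y + κ * G y) - (x - y) = κ * (G x - G y) by ring, norm_mul,
      Complex.norm_real, Real.norm_eq_abs]
    exact mul_le_mul_of_nonneg_left h1 (abs_nonneg κ)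
  refine ⟨h.toHomeomorph _ (Or.inr ?_), fun z => rfl⟩
  have h2 : ‖((ContinuousLinearEquiv.refl ℝ ℂ).symm : ℂ →L[ℝ] ℂ)‖₊ = 1 := by
    rw [ContinuousLinearEquiv.refl_symm, ContinuousLinearEquiv.coe_refl]
    exact Subtype.ext ContinuousLinearMap.norm_id
  rw [h2, inv_one]
  exact hκ

/-- Anisotropic rescalings of a transport system. -/
lemma TransportSystem.exists_rescale {G : ℂ → ℂ} {U V : Set ℂ} (H : TransportSystem G U V)
    {a b : ℝ} (ha : 0 < a) (hb : 0 < b) (w' k' : ℂ) :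
    ∃ (T : ℂ ≃ₜ ℂ) (G' : ℂ → ℂ), (∀ z, T z = a * (wMap G z - w') + b * (kMap G z - k')) ∧
      (∀ z, wMap G' (T z) = a * (wMap G z - w')) ∧ (∀ z, kMap G' (T z) = b * (kMap G z - k')) ∧
      TransportSystem G' (stretch a b ⟨w'.re, k'.im⟩ ⁻¹' U) (stretch b a ⟨k'.re, w'.im⟩ ⁻¹' V) ∧
      xMap G' ⁻¹' (stretch a b ⟨w'.re, k'.im⟩ ⁻¹' U) = T.symm ⁻¹' (xMap G ⁻¹' U) := by
  have hab : 0 < a + b := by positivity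
  have habc : ((a : ℂ) + b) ≠ 0 := by exact_mod_cast hab.ne'
  have hκ : |(a - b) / (a + b)| < 1 := by
    rw [abs_div, abs_of_pos hab, div_lt_one hab, abs_lt]; constructor <;> linarith
  obtain ⟨T₀, hT₀⟩ := exists_homeomorph_add_mul H.lip hκ
  have hc : ((a : ℂ) + b) / 2 ≠ 0 := div_ne_zero habc (by norm_num)
  set T : ℂ ≃ₜ ℂ := (T₀.trans (Homeomorph.mulLeft₀ _ hc)).trans
    (Homeomorph.addRight (-(a * w' + b * k'))) with hTdef
  have hT : ∀ z, T z = a * (wMap G z - w') + b * (kMap G z - k') := by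
    intro z
    simp only [hTdef, Homeomorph.trans_apply, Homeomorph.coe_mulLeft₀, Homeomorph.coe_addRight,
      hT₀, wMap, kMap]
    push_cast
    field_simp
    ring
  set S : ℂ → ℂ := fun z => a * (wMap G z - w') - b * (kMap G z - k') with hS
  set G' : ℂ → ℂ := fun y => S (T.symm y) with hG'
  have hG'T : ∀ z, G' (T z) = S z := fun z => by simp [hG']
  have hW : ∀ z, wMap G' (T z) = a * (wMap G z - w') := fun z => by
    rw [wMap, hG'T, hT]; simp only [hS]; ring
  have hK : ∀ z, kMap G' (T z) = b * (kMap G z - k') := fun z => by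
    rw [kMap, hG'T, hT]; simp only [hS]; ring
  have hlip : LipschitzWith 1 G' := by
    refine LipschitzWith.of_dist_le_mul fun x y => ?_
    obtain ⟨x, rfl⟩ := T.surjective x
    obtain ⟨y, rfl⟩ := T.surjective y
    have h1 := normSq_sub_normSq (G := G') (T x) (T y)
    have h2 := monotone_of_lipschitz H.lip x y
    rw [hW, hW, hK, hK] at h1
    simp only [NNReal.coe_one, one_mul, dist_eq_norm]
    refine abs_le_of_sq_le_sq' ?_ (norm_nonneg _) |>.2
    simp [Complex.mul_re, Complex.mul_im] at h1
    nlinarith [mul_nonneg (mul_pos ha hb).le h2]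
  have hX : ∀ z, stretch a b ⟨w'.re, k'.im⟩ (xMap G' (T z)) = xMap G z := fun z => by
    apply Complex.ext
    · simp [hW]; field_simp; ring
    · simp [hK]; field_simp; ring
  have hP : ∀ z, stretch b a ⟨k'.re, w'.im⟩ (pMap G' (T z)) = pMap G z := fun z => by
    apply Complex.ext
    · simp [hK]; field_simp; ring
    · simp [hW]; field_simp; ring
  have hXpre : xMap G' ⁻¹' (stretch a b ⟨w'.re, k'.im⟩ ⁻¹' U) = T.symm ⁻¹' (xMap G ⁻¹' U) := by
    ext y
    obtain ⟨y, rfl⟩ := T.surjective y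
    simp [mem_preimage, hX]
  have hPpre : pMap G' ⁻¹' (stretch b a ⟨k'.re, w'.im⟩ ⁻¹' V) = T.symm ⁻¹' (pMap G ⁻¹' V) := by
    ext y
    obtain ⟨y, rfl⟩ := T.surjective y
    simp [mem_preimage, hP]
  have hinj : ∀ {a b : ℝ}, 0 < a → 0 < b → ∀ c, Function.Injective (stretch a b c) := by
    intro a b ha hb c x y hxy
    have h1 := congrArg Complex.re hxy
    have h2 := congrArg Complex.im hxy
    simp only [stretch_re, stretch_im, add_left_inj] at h1 h2
    apply Complex.ext
    · field_simp at h1; exact h1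
    · field_simp at h2; exact h2
  refine ⟨T, G', hT, hW, hK, ⟨hlip, H.openU.preimage (continuous_stretch _ _ _),
    H.openV.preimage (continuous_stretch _ _ _), Convex.preimage_stretch H.convexU _ _ _,
    Convex.preimage_stretch H.convexV _ _ _, by rw [hXpre, hPpre, H.preimage_eq], ?_, ?_, ?_⟩,
    hXpre⟩
  · rw [hXpre]
    intro y hy
    refine DifferentiableAt.differentiableWithinAt ?_
    have hd : DifferentiableAt ℂ G (T.symm y) := H.diff.differentiableAt
      ((H.openU.preimage (continuous_xMap H.lip)).mem_nhds hy)
    have hTd : HasDerivAt T (a * ((1 + deriv G (T.symm y)) / 2)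
        + b * ((1 - deriv G (T.symm y)) / 2)) (T.symm y) := by
      have : (T : ℂ → ℂ) = fun z => a * ((z + G z) / 2 - w') + b * ((z - G z) / 2 - k') :=
        funext hT
      rw [this]
      exact (((((hasDerivAt_id _).add hd.hasDerivAt).div_const 2).sub_const w').const_mul _).add
        (((((hasDerivAt_id _).sub hd.hasDerivAt).div_const 2).sub_const k').const_mul _)
    have hne : a * ((1 + deriv G (T.symm y)) / 2) + b * ((1 - deriv G (T.symm y)) / 2) ≠ 0 := by
      intro h0
      have h1 : (((a + b : ℝ)) : ℂ) = ((b - a : ℝ) : ℂ) * deriv G (T.symm y) := by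
        push_cast; linear_combination 2 * h0
      have h2 := congrArg norm h1
      rw [norm_mul, Complex.norm_real, Complex.norm_real, Real.norm_of_nonneg hab.le,
        Real.norm_eq_abs] at h2
      have h3 := norm_deriv_le_one H.lip (T.symm y)
      have h4 : |b - a| < a + b := by rw [abs_lt]; constructor <;> linarith
      nlinarith [abs_nonneg (b - a)]
    have hsymm := HasDerivAt.of_local_left_inverse (g := T.symm) T.symm.continuous.continuousAt
      hTd hne (Filter.Eventually.of_forall fun x => T.apply_symm_apply x)
    have hSd : DifferentiableAt ℂ S (T.symm y) := by
      simp only [hS, wMap, kMap]; fun_prop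
    exact hSd.comp y hsymm.differentiableAt
  · intro y hy
    obtain ⟨x, hx⟩ := H.surjX hy
    exact ⟨T x, hinj ha hb _ ((hX x).trans hx)⟩
  · intro y hy
    obtain ⟨x, hx⟩ := H.surjP hy
    exact ⟨T x, hinj hb ha _ ((hP x).trans hx)⟩

end PlanarOT

namespace PlanarOT

lemma volume_le_of_subset_rectangle {U : Set ℂ} {a b c d : ℝ}
    (h : ∀ x ∈ U, x.re ∈ Icc a b ∧ x.im ∈ Icc c d) :
    volume U ≤ ENNReal.ofReal (b - a) * ENNReal.ofReal (d - c) := by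
  have h1 : U ⊆ Complex.measurableEquivRealProd ⁻¹' (Icc a b ×ˢ Icc c d) := fun x hx => h x hx
  refine (measure_mono h1).trans ?_
  rw [Complex.volume_preserving_equiv_real_prod.measure_preimage
    (measurableSet_Icc.prod measurableSet_Icc).nullMeasurableSet, Measure.volume_eq_prod,
    Measure.prod_prod, Real.volume_Icc, Real.volume_Icc]

lemma exists_re_far {U : Set ℂ} (hU : volume U = 1) (hb : Bornology.IsBounded U) {d : ℝ}
    (hd : diam U ≤ d) (hd1 : 1 ≤ d) (c : ℝ) : ∃ x ∈ U, 1 / (8 * d) ≤ |x.re - c| := by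
  by_contra hcon
  push Not at hcon
  obtain ⟨x₀, hx₀⟩ : U.Nonempty := by
    rw [nonempty_iff_ne_empty]; rintro rfl; simp at hU
  have h1 := volume_le_of_subset_rectangle (U := U) (a := c - 1 / (8 * d)) (b := c + 1 / (8 * d))
    (c := x₀.im - d) (d := x₀.im + d) (fun x hx => by
      have h2 := abs_lt.1 (hcon x hx)
      have h3 : |(x - x₀).im| ≤ d := (Complex.abs_im_le_norm _).trans
        (by rw [← dist_eq_norm]; exact (dist_le_diam_of_mem hb hx hx₀).trans hd)
      rw [Complex.sub_im, abs_le] at h3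
      exact ⟨⟨by linarith, by linarith⟩, by linarith, by linarith⟩)
  rw [hU, ← ENNReal.ofReal_mul (by ring_nf; positivity), ← ENNReal.ofReal_one,
    ENNReal.ofReal_le_ofReal_iff (by ring_nf; positivity)] at h1
  have h2 : (c + 1 / (8 * d) - (c - 1 / (8 * d))) * (x₀.im + d - (x₀.im - d)) = 1 / 2 := by
    field_simp; ring
  linarith

lemma volume_preimage_linearIsometryEquiv (e : ℂ ≃ₗᵢ[ℝ] ℂ) (U : Set ℂ) :
    volume (e ⁻¹' U) = volume U :=
  MeasurePreserving.measure_preimage_equiv (f := e.toHomeomorph.toMeasurableEquiv)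
    e.measurePreserving U

lemma exists_im_far {U : Set ℂ} (hU : volume U = 1) (hb : Bornology.IsBounded U) {d : ℝ}
    (hd : diam U ≤ d) (hd1 : 1 ≤ d) (c : ℝ) : ∃ x ∈ U, 1 / (8 * d) ≤ |x.im - c| := by
  have h1 : reflect circleI ⁻¹' U = reflect circleI '' U := by
    ext y
    exact ⟨fun h => ⟨_, h, reflect_reflect _ _⟩, by rintro ⟨x, hx, rfl⟩; simpa using hx⟩
  obtain ⟨x, hx, hxc⟩ := exists_re_far (U := reflect circleI ⁻¹' U) (d := d)
    (by rw [volume_preimage_linearIsometryEquiv, hU])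
    (by rw [h1]; exact (reflect circleI).lipschitz.isBounded_image hb)
    (by rw [h1, (reflect circleI).isometry.diam_image]; exact hd) hd1 c
  exact ⟨_, hx, by rwa [reflect_circleI]⟩

/-- One rescaled transport system. -/
structure BlowupStep (ε d N : ℝ) (g : ℂ → ℂ) (U V : Set ℂ) (z q p : ℂ) (ρ lam : ℝ) : Prop where
  sys : TransportSystem g U V
  growth : ∀ a ∈ closure (xMap g ⁻¹' U), ∀ b ∈ closure (xMap g ⁻¹' U),
    ‖kMap g a - kMap g b‖ ≤ (‖wMap g a - wMap g b‖ + 1) ^ (1 - ε)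
  map_zero : g 0 = 0
  zero_mem : 0 ∈ closure (xMap g ⁻¹' U)
  mem : z ∈ closure (xMap g ⁻¹' U)
  norm_kMap : ‖kMap g z‖ = 1
  norm_wMap : ‖wMap g z‖ ≤ 1
  q_mem : q ∈ U
  q_large : 1 / (8 * d * ρ) ≤ ‖q‖
  q_im : |q.im| ≤ d / (lam * ρ)
  p_mem : p ∈ V
  p_large : 1 / (8 * d * ρ) ≤ ‖p‖
  p_re : |p.re| ≤ d / (lam * ρ)
  ρ_pos : 0 < ρ
  lam_ge : N * ρ ^ (-ε) ≤ lam
  le : lam * ρ ≤ 2 * d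

/-- The uniform bounds on a transport system between planar domains of area one. -/
structure UnitSystem (d : ℝ) (G : ℂ → ℂ) (U V : Set ℂ) : Prop extends TransportSystem G U V where
  volU : volume U = 1
  volV : volume V = 1
  bddU : Bornology.IsBounded U
  bddV : Bornology.IsBounded V
  diamU : diam U ≤ d
  diamV : diam V ≤ d

namespace UnitSystem
variable {d : ℝ} {G : ℂ → ℂ} {U V : Set ℂ} (H : UnitSystem d G U V)
include H

lemma xMap_mem_closure {z : ℂ} (hz : z ∈ closure (xMap G ⁻¹' U)) : xMap G z ∈ closure U :=
  (continuous_xMap H.lip).closure_preimage_subset _ hz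

lemma pMap_mem_closure {z : ℂ} (hz : z ∈ closure (xMap G ⁻¹' U)) : pMap G z ∈ closure V := by
  rw [H.preimage_eq] at hz
  exact (continuous_pMap H.lip).closure_preimage_subset _ hz

lemma norm_sub_le_of_mem_closureU {x y : ℂ} (hx : x ∈ closure U) (hy : y ∈ closure U) :
    ‖x - y‖ ≤ d := by
  rw [← dist_eq_norm]
  exact (dist_le_diam_of_mem H.bddU.closure hx hy).trans (by rw [diam_closure]; exact H.diamU)

lemma norm_sub_le_of_mem_closureV {x y : ℂ} (hx : x ∈ closure V) (hy : y ∈ closure V) :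
    ‖x - y‖ ≤ d := by
  rw [← dist_eq_norm]
  exact (dist_le_diam_of_mem H.bddV.closure hx hy).trans (by rw [diam_closure]; exact H.diamV)

lemma isCompact_closure : IsCompact (closure (xMap G ⁻¹' U)) := by
  refine Metric.isCompact_of_isClosed_isBounded isClosed_closure ?_
  obtain ⟨R, hR⟩ := H.bddU.closure.exists_norm_le
  obtain ⟨R', hR'⟩ := H.bddV.closure.exists_norm_le
  refine isBounded_iff_forall_norm_le.2 ⟨R + R', fun z hz => ?_⟩
  have h1 := hR _ (H.xMap_mem_closure hz)
  have h2 := hR' _ (H.pMap_mem_closure hz)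
  have h3 : z = xMap G z + pMap G z := (xMap_add_pMap z).symm
  rw [h3]
  linarith [norm_add_le (xMap G z) (pMap G z)]

lemma norm_kMap_sub_le {z z' : ℂ} (hz : z ∈ closure (xMap G ⁻¹' U))
    (hz' : z' ∈ closure (xMap G ⁻¹' U)) : ‖kMap G z - kMap G z'‖ ≤ 2 * d := by
  have h1 := H.norm_sub_le_of_mem_closureU (H.xMap_mem_closure hz) (H.xMap_mem_closure hz')
  have h2 := H.norm_sub_le_of_mem_closureV (H.pMap_mem_closure hz) (H.pMap_mem_closure hz')
  have h3 := (Complex.abs_im_le_norm _).trans h1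
  have h4 := (Complex.abs_re_le_norm _).trans h2
  simp only [Complex.sub_re, Complex.sub_im, xMap_im, pMap_re] at h3 h4
  have h5 := Complex.norm_le_abs_re_add_abs_im (kMap G z - kMap G z')
  rw [Complex.sub_re, Complex.sub_im] at h5
  linarith

lemma exists_blowupStep (hd : 1 ≤ d) {ε N : ℝ} (hε1 : ε < 1) (hN : 0 < N)
    {z z' : ℂ} (hz : z ∈ closure (xMap G ⁻¹' U)) (hz' : z' ∈ closure (xMap G ⁻¹' U))
    (h : N * ‖wMap G z - wMap G z'‖ ^ (1 - ε) < ‖kMap G z - kMap G z'‖) :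
    ∃ g U' V' z₁ q p ρ lam, BlowupStep ε d N g U' V' z₁ q p ρ lam := by
  have hε' : 0 < 1 - ε := by linarith
  have hk := continuous_kMap H.lip
  have hw := continuous_wMap H.lip
  obtain ⟨τ, hτ, hτ0⟩ : ∃ τ : ℝ, N * (‖wMap G z - wMap G z'‖ + τ) ^ (1 - ε)
      < ‖kMap G z - kMap G z'‖ ∧ 0 < τ := by
    have hc : Continuous fun τ : ℝ => N * (‖wMap G z - wMap G z'‖ + τ) ^ (1 - ε) :=
      continuous_const.mul ((continuous_const.add continuous_id).rpow_const fun _ =>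
        Or.inr hε'.le)
    have h1 : ∀ᶠ τ in nhds (0 : ℝ), N * (‖wMap G z - wMap G z'‖ + τ) ^ (1 - ε)
      < ‖kMap G z - kMap G z'‖ := hc.continuousAt.eventually_lt_const (by simpa using h)
    exact ((h1.filter_mono nhdsWithin_le_nhds).and
      (self_mem_nhdsWithin (a := (0 : ℝ)) (s := Ioi 0))).exists
  have hpos : ∀ x y, 0 < ‖wMap G x - wMap G y‖ + τ := fun x y => by positivity
  set Q := closure (xMap G ⁻¹' U) with hQ
  obtain ⟨⟨P, P'⟩, ⟨hP, hP'⟩, hmax⟩ := (H.isCompact_closure.prod H.isCompact_closure).exists_isMaxOn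
    (f := fun x : ℂ × ℂ => ‖kMap G x.1 - kMap G x.2‖ / (‖wMap G x.1 - wMap G x.2‖ + τ) ^ (1 - ε))
    ⟨(z, z'), hz, hz'⟩ (Continuous.continuousOn (by
      refine Continuous.div (by fun_prop) (Continuous.rpow_const (by fun_prop) fun x =>
        Or.inr hε'.le) fun x => (Real.rpow_pos_of_pos (hpos _ _) _).ne'))
  simp only at hP hP'
  set ρ := ‖wMap G P - wMap G P'‖ + τ with hρ
  have hρ0 : 0 < ρ := hpos P P'
  set M := ‖kMap G P - kMap G P'‖ / ρ ^ (1 - ε) with hM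
  have hρp : 0 < ρ ^ (1 - ε) := Real.rpow_pos_of_pos hρ0 _
  have hle : ∀ x ∈ Q, ∀ y ∈ Q, ‖kMap G x - kMap G y‖ ≤
      M * (‖wMap G x - wMap G y‖ + τ) ^ (1 - ε) := fun x hx y hy => by
    have h1 : _ ≤ M := hmax (show (x, y) ∈ Q ×ˢ Q from ⟨hx, hy⟩)
    rwa [div_le_iff₀ (Real.rpow_pos_of_pos (hpos _ _) _)] at h1
  have hNM : N < M := by
    have h1 := hτ.trans_le (hle z hz z' hz')
    exact lt_of_mul_lt_mul_right h1 (Real.rpow_nonneg (hpos _ _).le _)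
  have hM0 : 0 < M := hN.trans hNM
  set lam := M * ρ ^ (-ε) with hlam
  have hlam0 : 0 < lam := mul_pos hM0 (Real.rpow_pos_of_pos hρ0 _)
  have hlr : lam * ρ = M * ρ ^ (1 - ε) := by
    rw [hlam, mul_assoc]
    congr 1
    conv_lhs => rw [← Real.rpow_one ρ, ← Real.rpow_mul hρ0.le, ← Real.rpow_add hρ0]
    congr 1; ring
  have hlr' : ‖kMap G P - kMap G P'‖ = lam * ρ := by
    rw [hlr, hM, div_mul_cancel₀ _ hρp.ne']
  have hlr0 : 0 < lam * ρ := by positivity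
  have ha : 0 < 1 / ρ := by positivity
  have hb : 0 < 1 / (lam * ρ) := by positivity
  obtain ⟨T, g, hT, hgw, hgk, hsys, hpre⟩ :=
    H.toTransportSystem.exists_rescale ha hb (wMap G P') (kMap G P')
  have hcl : closure (xMap g ⁻¹' (stretch (1 / ρ) (1 / (lam * ρ))
      ⟨(wMap G P').re, (kMap G P').im⟩ ⁻¹' U)) = T.symm ⁻¹' Q := by
    rw [hpre, hQ, T.symm.preimage_closure]
  have hT0 : T P' = 0 := by rw [hT]; simp
  have hTs0 : T.symm 0 = P' := by rw [← hT0, T.symm_apply_apply]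
  obtain ⟨x, hx, hxc⟩ := exists_re_far H.volU H.bddU H.diamU hd (wMap G P').re
  obtain ⟨y, hy, hyc⟩ := exists_im_far H.volV H.bddV H.diamV hd (wMap G P').im
  have hxi : |x.im - (kMap G P').im| ≤ d := by
    have := (Complex.abs_im_le_norm _).trans (H.norm_sub_le_of_mem_closureU (subset_closure hx)
      (H.xMap_mem_closure hP'))
    simpa using this
  have hyr : |y.re - (kMap G P').re| ≤ d := by
    have := (Complex.abs_re_le_norm _).trans (H.norm_sub_le_of_mem_closureV (subset_closure hy)
      (H.pMap_mem_closure hP'))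
    simpa using this
  refine ⟨g, _, _, T P, ⟨1 / ρ * (x.re - (wMap G P').re), 1 / (lam * ρ) * (x.im - (kMap G P').im)⟩,
    ⟨1 / (lam * ρ) * (y.re - (kMap G P').re), 1 / ρ * (y.im - (wMap G P').im)⟩, ρ, lam,
    ⟨hsys, ?_, ?_, ?_, ?_, ?_, ?_, ?_, ?_, ?_, ?_, ?_, ?_, hρ0, ?_, ?_⟩⟩
  · rw [hcl]
    intro a ha' b hb'
    obtain ⟨a, rfl⟩ := T.surjective a
    obtain ⟨b, rfl⟩ := T.surjective b
    rw [mem_preimage, T.symm_apply_apply] at ha' hb'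
    rw [hgk, hgk, hgw, hgw, ← mul_sub, ← mul_sub, sub_sub_sub_cancel_right,
      sub_sub_sub_cancel_right, norm_mul, norm_mul, Complex.norm_real, Complex.norm_real,
      Real.norm_of_nonneg ha.le, Real.norm_of_nonneg hb.le, hlr, one_div_mul_eq_div,
      one_div_mul_eq_div, div_le_iff₀ (by positivity)]
    refine (hle a ha' b hb').trans ?_
    rw [mul_left_comm, ← Real.mul_rpow (by positivity) hρ0.le]
    gcongr
    rw [add_mul, div_mul_cancel₀ _ hρ0.ne']
    linarith [norm_nonneg (wMap G P - wMap G P')]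
  · have h1 := hgw P'
    have h2 := hgk P'
    rw [hT0] at h1 h2
    have h3 := wMap_sub_kMap (G := g) 0
    rw [h1, h2] at h3
    rw [← h3]; simp
  · rw [hcl, mem_preimage, hTs0]; exact hP'
  · rw [hcl, mem_preimage, T.symm_apply_apply]; exact hP
  · rw [hgk, norm_mul, Complex.norm_real, Real.norm_of_nonneg hb.le, hlr',
      one_div_mul_cancel hlr0.ne']
  · rw [hgw, norm_mul, Complex.norm_real, Real.norm_of_nonneg ha.le, one_div_mul_eq_div,
      div_le_one hρ0]
    linarith
  · rw [mem_preimage]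
    convert hx
    apply Complex.ext
    · simp; field_simp; ring
    · simp; field_simp; ring
  · refine le_trans ?_ (Complex.abs_re_le_norm _)
    simp only [abs_mul, abs_of_pos ha]
    rw [show 1 / (8 * d * ρ) = 1 / ρ * (1 / (8 * d)) by field_simp]
    gcongr
  · simp only [abs_mul, abs_of_pos hb]
    rw [one_div_mul_eq_div]
    gcongr
  · rw [mem_preimage]
    convert hy
    apply Complex.ext
    · simp; field_simp; ring
    · simp; field_simp; ring
  · refine le_trans ?_ (Complex.abs_im_le_norm _)
    simp only [abs_mul, abs_of_pos ha]
    rw [show 1 / (8 * d * ρ) = 1 / ρ * (1 / (8 * d)) by field_simp]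
    gcongr
  · simp only [abs_mul, abs_of_pos hb]
    rw [one_div_mul_eq_div]
    gcongr
  · rw [hlam]; gcongr
  · rw [← hlr']; exact H.norm_kMap_sub_le hP hP'

end UnitSystem

/-- The increments of `kMap` are controlled by those of `wMap`, uniformly over transport systems of
bounded size. -/
theorem exists_holder_constant {ε : ℝ} (hε : 0 < ε) (hε1 : ε < 1) {d : ℝ} (hd : 1 ≤ d) :
    ∃ C > 0, ∀ G U V, UnitSystem d G U V → ∀ z ∈ closure (xMap G ⁻¹' U),
      ∀ z' ∈ closure (xMap G ⁻¹' U),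
        ‖kMap G z - kMap G z'‖ ≤ C * ‖wMap G z - wMap G z'‖ ^ (1 - ε) := by
  by_contra hcon
  push Not at hcon
  have hstep : ∀ n : ℕ, ∃ g U' V' z₁ q p ρ lam,
      BlowupStep ε d ((n : ℝ) + 1) g U' V' z₁ q p ρ lam := fun n => by
    obtain ⟨G, U, V, H, z, hz, z', hz', h⟩ := hcon ((n : ℝ) + 1) (by positivity)
    exact H.exists_blowupStep hd hε1 (by positivity) hz hz' h
  choose g U V z q p ρ lam H using hstep
  have hε' : 0 < 1 - ε := by linarith
  have hinv : Filter.Tendsto (fun n : ℕ => 2 * d / ((n : ℝ) + 1)) Filter.atTop (nhds 0) :=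
    (Filter.tendsto_atTop_add_const_right _ 1 tendsto_natCast_atTop_atTop).const_div_atTop _
  have hρ : Filter.Tendsto ρ Filter.atTop (nhds 0) := by
    have h1 : Filter.Tendsto (fun n : ℕ => (2 * d / ((n : ℝ) + 1)) ^ (1 / (1 - ε))) Filter.atTop
        (nhds 0) := by
      have := hinv.rpow_const (p := 1 / (1 - ε)) (Or.inr (by positivity))
      rwa [Real.zero_rpow (by positivity)] at this
    refine squeeze_zero (fun n => (H n).ρ_pos.le) (fun n => ?_) h1
    have h2 := (H n).ρ_pos
    have h3 : ((n : ℝ) + 1) * ρ n ^ (1 - ε) ≤ 2 * d := by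
      refine le_trans ?_ (H n).le
      rw [show (1 - ε) = -ε + 1 by ring, Real.rpow_add h2, Real.rpow_one, ← mul_assoc]
      have := (H n).lam_ge
      gcongr
    have h4 : ρ n ^ (1 - ε) ≤ 2 * d / ((n : ℝ) + 1) := by
      rw [le_div_iff₀ (by positivity)]; linarith
    have := Real.rpow_le_rpow (by positivity) h4 (by positivity : 0 ≤ 1 / (1 - ε))
    rwa [← Real.rpow_mul h2.le, mul_one_div_cancel hε'.ne', Real.rpow_one] at this
  have hlam0 : ∀ n, 0 < lam n := fun n => lt_of_lt_of_le
    (mul_pos (by positivity) (Real.rpow_pos_of_pos (H n).ρ_pos _)) (H n).lam_ge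
  have hlam : Filter.Tendsto lam Filter.atTop Filter.atTop := by
    refine Filter.tendsto_atTop_mono' _ ?_ tendsto_natCast_atTop_atTop
    filter_upwards [hρ.eventually_le_const zero_lt_one] with n hn
    refine le_trans ?_ (H n).lam_ge
    have h1 : 1 ≤ ρ n ^ (-ε) :=
      Real.one_le_rpow_of_pos_of_le_one_of_nonpos (H n).ρ_pos hn (by linarith)
    nlinarith [(n.cast_nonneg : (0 : ℝ) ≤ n)]
  have hlarge : Filter.Tendsto (fun n => 1 / (8 * d * ρ n)) Filter.atTop Filter.atTop := by
    have h1 : Filter.Tendsto (fun n => 8 * d * ρ n) Filter.atTop (nhdsWithin 0 (Ioi 0)) := by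
      refine tendsto_nhdsWithin_iff.2 ⟨by simpa using hρ.const_mul (8 * d),
        Filter.Eventually.of_forall fun n => ?_⟩
      have := (H n).ρ_pos
      exact mul_pos (by positivity) this
    exact h1.inv_tendsto_nhdsGT_zero.congr fun n => by simp
  have hsmall : Filter.Tendsto (fun n => 8 * d ^ 2 / lam n) Filter.atTop (nhds 0) :=
    hlam.const_div_atTop _
  have hratio : ∀ n, ∀ x y : ℝ, 1 / (8 * d * ρ n) ≤ x → |y| ≤ d / (lam n * ρ n) →
      ‖y / x‖ ≤ 8 * d ^ 2 / lam n := by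
    intro n x y hx hy
    have h1 := (H n).ρ_pos
    have h2 := hlam0 n
    have h3 : 0 < 1 / (8 * d * ρ n) := by positivity
    have h4 : 0 < x := h3.trans_le hx
    rw [norm_div, Real.norm_eq_abs, Real.norm_of_nonneg h4.le, div_le_iff₀ h4]
    refine hy.trans ?_
    calc d / (lam n * ρ n) = 8 * d ^ 2 / lam n * (1 / (8 * d * ρ n)) := by field_simp
      _ ≤ _ := by gcongr
  exact BlowupSeq.elim (ε := ε) (g := g) (U := U) (V := V) (z := z) (q := q) (p := p)
    { ε_pos := hε
      ε_lt := hε1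
      sys := fun n => (H n).sys
      growth := fun n => (H n).growth
      map_zero := fun n => (H n).map_zero
      zero_mem := fun n => (H n).zero_mem
      mem := fun n => (H n).mem
      norm_kMap := fun n => (H n).norm_kMap
      norm_wMap := fun n => (H n).norm_wMap
      q_mem := fun n => (H n).q_mem
      q_atTop := Filter.tendsto_atTop_mono (fun n => (H n).q_large) hlarge
      q_im := squeeze_zero_norm (fun n => hratio n _ _ (H n).q_large (H n).q_im) hsmall
      p_mem := fun n => (H n).p_mem
      p_atTop := Filter.tendsto_atTop_mono (fun n => (H n).p_large) hlarge
      p_re := squeeze_zero_norm (fun n => hratio n _ _ (H n).p_large (H n).p_re) hsmall }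

end PlanarOT

namespace PlanarOT

open scoped ComplexConjugate

/-- The map `G` seen in the frame rotated by the unit complex number `e`. -/
def rotate (e : ℂ) (G : ℂ → ℂ) (z : ℂ) : ℂ := e * G (e * z)

section rotate
variable {e : ℂ} {G : ℂ → ℂ} {U V : Set ℂ}

lemma conj_mul_self_of_norm_eq_one (he : ‖e‖ = 1) : conj e * e = 1 := by
  rw [mul_comm, Complex.mul_conj, Complex.normSq_eq_norm_sq, he]; simp

lemma mul_xMap_rotate (he : ‖e‖ = 1) (z : ℂ) : e * xMap (rotate e G) z = xMap G (e * z) := by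
  rw [xMap_eq, xMap_eq, rotate, map_mul]
  linear_combination (conj (G (e * z)) / 2) * conj_mul_self_of_norm_eq_one he

lemma mul_pMap_rotate (he : ‖e‖ = 1) (z : ℂ) : e * pMap (rotate e G) z = pMap G (e * z) := by
  rw [pMap_eq, pMap_eq, rotate, map_mul]
  linear_combination (-conj (G (e * z)) / 2) * conj_mul_self_of_norm_eq_one he

lemma xMap_rotate_preimage (he : ‖e‖ = 1) (U : Set ℂ) :
    xMap (rotate e G) ⁻¹' ((e * ·) ⁻¹' U) = (e * ·) ⁻¹' (xMap G ⁻¹' U) := by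
  ext z
  simp only [mem_preimage, mul_xMap_rotate he]

lemma pMap_rotate_preimage (he : ‖e‖ = 1) (U : Set ℂ) :
    pMap (rotate e G) ⁻¹' ((e * ·) ⁻¹' U) = (e * ·) ⁻¹' (pMap G ⁻¹' U) := by
  ext z
  simp only [mem_preimage, mul_pMap_rotate he]

lemma hasDerivAt_rotate {z : ℂ} (h : DifferentiableAt ℂ G (e * z)) :
    HasDerivAt (rotate e G) (e ^ 2 * deriv G (e * z)) z := by
  have h1 : HasDerivAt (fun z : ℂ => e * z) e z := by
    simpa using (hasDerivAt_id z).const_mul e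
  have h2 := (h.hasDerivAt.comp z h1).const_mul e
  exact h2.congr_deriv (by ring)

lemma convex_rotate (e : ℂ) (hU : Convex ℝ U) : Convex ℝ ((e * ·) ⁻¹' U) :=
  hU.linear_preimage (LinearMap.mulLeft ℝ e)

lemma TransportSystem.rotate (H : TransportSystem G U V) (he : ‖e‖ = 1) :
    TransportSystem (rotate e G) ((e * ·) ⁻¹' U) ((e * ·) ⁻¹' V) where
  lip := by
    refine LipschitzWith.of_dist_le_mul fun z z' => ?_
    have := H.lip.dist_le_mul (e * z) (e * z')
    simpa [PlanarOT.rotate, dist_eq_norm, ← mul_sub, he] using this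
  openU := H.openU.preimage (by fun_prop)
  openV := H.openV.preimage (by fun_prop)
  convexU := convex_rotate e H.convexU
  convexV := convex_rotate e H.convexV
  preimage_eq := by rw [xMap_rotate_preimage he, pMap_rotate_preimage he, H.preimage_eq]
  diff := by
    rw [xMap_rotate_preimage he]
    intro z hz
    have hd : DifferentiableAt ℂ G (e * z) := (H.diff _ hz).differentiableAt
      ((H.openU.preimage (continuous_xMap H.lip)).mem_nhds hz)
    exact (hasDerivAt_rotate hd).differentiableAt.differentiableWithinAt
  surjX := by
    intro x hx
    obtain ⟨z, hz⟩ := H.surjX hx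
    refine ⟨conj e * z, ?_⟩
    have h1 := mul_xMap_rotate (G := G) he (conj e * z)
    rw [← mul_assoc e, mul_comm e (conj e), conj_mul_self_of_norm_eq_one he, one_mul, hz] at h1
    exact mul_left_cancel₀ (norm_ne_zero_iff.1 (by rw [he]; simp)) h1
  surjP := by
    intro x hx
    obtain ⟨z, hz⟩ := H.surjP hx
    refine ⟨conj e * z, ?_⟩
    have h1 := mul_pMap_rotate (G := G) he (conj e * z)
    rw [← mul_assoc e, mul_comm e (conj e), conj_mul_self_of_norm_eq_one he, one_mul, hz] at h1
    exact mul_left_cancel₀ (norm_ne_zero_iff.1 (by rw [he]; simp)) h1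

lemma diam_rotate_le (he : ‖e‖ = 1) (hU : Bornology.IsBounded U) :
    diam ((e * ·) ⁻¹' U) ≤ diam U := by
  refine diam_le_of_forall_dist_le diam_nonneg fun x hx y hy => ?_
  have := dist_le_diam_of_mem hU hx hy
  simpa [dist_eq_norm, ← mul_sub, he] using this

lemma isBounded_rotate (he : ‖e‖ = 1) (hU : Bornology.IsBounded U) :
    Bornology.IsBounded ((e * ·) ⁻¹' U) := by
  obtain ⟨R, hR⟩ := hU.exists_norm_le
  exact isBounded_iff_forall_norm_le.2 ⟨R, fun z hz => by simpa [he] using hR _ hz⟩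

lemma volume_rotate (he : ‖e‖ = 1) (U : Set ℂ) : volume ((e * ·) ⁻¹' U) = volume U :=
  volume_preimage_linearIsometryEquiv (rotation ⟨e, by simp [Submonoid.unitSphere, he]⟩) U

lemma UnitSystem.rotate {d : ℝ} (H : UnitSystem d G U V) (he : ‖e‖ = 1) :
    UnitSystem d (rotate e G) ((e * ·) ⁻¹' U) ((e * ·) ⁻¹' V) where
  toTransportSystem := H.toTransportSystem.rotate he
  volU := (volume_rotate he U).trans H.volU
  volV := (volume_rotate he V).trans H.volV
  bddU := isBounded_rotate he H.bddU
  bddV := isBounded_rotate he H.bddV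
  diamU := (diam_rotate_le he H.bddU).trans H.diamU
  diamV := (diam_rotate_le he H.bddV).trans H.diamV

end rotate

lemma exists_sq_mul_eq_neg_norm (g : ℂ) : ∃ e : ℂ, ‖e‖ = 1 ∧ e ^ 2 * g = -‖g‖ := by
  rcases eq_or_ne g 0 with rfl | hg
  · exact ⟨1, by simp⟩
  obtain ⟨e, he⟩ := IsAlgClosed.exists_pow_nat_eq (-‖g‖ / g : ℂ) two_pos
  have h1 : ‖e‖ = 1 := by
    have := congrArg norm he
    rw [norm_pow, norm_div, norm_neg, Complex.norm_real, norm_norm,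
      div_self (norm_ne_zero_iff.2 hg)] at this
    exact (pow_eq_one_iff_of_nonneg (norm_nonneg _) two_ne_zero).1 this
  exact ⟨e, h1, by rw [he, div_mul_cancel₀ _ hg]⟩

end PlanarOT

namespace PlanarOT

section interior
variable {d : ℝ} {G : ℂ → ℂ} {U V : Set ℂ}

lemma UnitSystem.norm_wMap_sub_le (H : UnitSystem d G U V) {z z' : ℂ}
    (hz : z ∈ closure (xMap G ⁻¹' U)) (hz' : z' ∈ closure (xMap G ⁻¹' U)) :
    ‖wMap G z - wMap G z'‖ ≤ 2 * d := by
  have h1 := H.norm_sub_le_of_mem_closureU (H.xMap_mem_closure hz) (H.xMap_mem_closure hz')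
  have h2 := H.norm_sub_le_of_mem_closureV (H.pMap_mem_closure hz) (H.pMap_mem_closure hz')
  have h3 := (Complex.abs_re_le_norm _).trans h1
  have h4 := (Complex.abs_im_le_norm _).trans h2
  simp only [Complex.sub_re, Complex.sub_im, xMap_re, pMap_im] at h3 h4
  have h5 := Complex.norm_le_abs_re_add_abs_im (wMap G z - wMap G z')
  rw [Complex.sub_re, Complex.sub_im] at h5
  linarith

lemma norm_xMap_sub_le (z z' : ℂ) :
    ‖xMap G z - xMap G z'‖ ≤ ‖wMap G z - wMap G z'‖ + ‖kMap G z - kMap G z'‖ := by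
  have h1 := Complex.norm_le_abs_re_add_abs_im (xMap G z - xMap G z')
  have h2 := Complex.abs_re_le_norm (wMap G z - wMap G z')
  have h3 := Complex.abs_im_le_norm (kMap G z - kMap G z')
  simp only [Complex.sub_re, Complex.sub_im, xMap_re, xMap_im] at h1 h2 h3
  linarith

lemma wMap_ne_of_strict {z z' : ℂ} (h : ‖G z - G z'‖ < ‖z - z'‖) : wMap G z ≠ wMap G z' := by
  intro heq
  have := monotone_strict h
  simp [heq] at this

/-- A Hölder bound for pairs of points gives a bound for the derivative at an interior point, in
terms of the distance to the boundary in the `wMap` variable. -/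
lemma UnitSystem.norm_deriv_kMap_le (H : UnitSystem d G U V) {C ε : ℝ} (hε : 0 ≤ ε) (hC : 0 < C)
    (hhol : ∀ z ∈ closure (xMap G ⁻¹' U), ∀ z' ∈ closure (xMap G ⁻¹' U),
      ‖kMap G z - kMap G z'‖ ≤ C * ‖wMap G z - wMap G z'‖ ^ (1 - ε))
    {z₁ : ℂ} (hz₁ : xMap G z₁ ∈ U) (hg : ‖deriv G z₁‖ < 1) {δ : ℝ} (hδ : 0 < δ)
    (hδ' : ∀ z ∈ frontier (xMap G ⁻¹' U), δ < ‖wMap G z - wMap G z₁‖) :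
    ‖1 - deriv G z₁‖ ≤ C * δ ^ (-ε) * ‖1 + deriv G z₁‖ := by
  set Ω := xMap G ⁻¹' U with hΩ
  have hΩo : IsOpen Ω := H.openU.preimage (continuous_xMap H.lip)
  have hΩn : Ω ∈ nhds z₁ := hΩo.mem_nhds hz₁
  have hd₁ : DifferentiableAt ℂ G z₁ := H.diff.differentiableAt hΩn
  have hw' : HasDerivAt (wMap G) ((1 + deriv G z₁) / 2) z₁ :=
    ((hasDerivAt_id z₁).add hd₁.hasDerivAt).div_const 2
  have hk' : HasDerivAt (kMap G) ((1 - deriv G z₁) / 2) z₁ :=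
    ((hasDerivAt_id z₁).sub hd₁.hasDerivAt).div_const 2
  have hwd : DifferentiableOn ℂ (wMap G) Ω := (differentiableOn_id.add H.diff).div_const 2
  have hkd : DifferentiableOn ℂ (kMap G) Ω := (differentiableOn_id.sub H.diff).div_const 2
  have hne1 : (1 + deriv G z₁) / 2 ≠ 0 := by
    intro h0
    have : deriv G z₁ = -1 := by linear_combination 2 * h0
    rw [this] at hg; simp at hg
  have hwne : ∀ z, z ≠ z₁ → wMap G z ≠ wMap G z₁ := fun z hz =>
    (wMap_ne_of_strict (strict_of_norm_deriv_lt H.lip hd₁ hg hz)).symm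
  have hds : ∀ z, dslope (wMap G) z₁ z ≠ 0 := by
    intro z
    rcases eq_or_ne z z₁ with rfl | hz
    · rwa [dslope_same, hw'.deriv]
    · rw [dslope_of_ne _ hz, slope_def_field]
      exact div_ne_zero (sub_ne_zero.2 (hwne z hz)) (sub_ne_zero.2 hz)
  set q : ℂ → ℂ := fun z => dslope (kMap G) z₁ z / dslope (wMap G) z₁ z with hq
  have hqd : DifferentiableOn ℂ q Ω :=
    ((Complex.differentiableOn_dslope hΩn).2 hkd).div
      ((Complex.differentiableOn_dslope hΩn).2 hwd) fun z _ => hds z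
  have hqle : ∀ z ∈ Ω, δ ≤ ‖wMap G z - wMap G z₁‖ → ‖q z‖ ≤ C * δ ^ (-ε) := by
    intro z hz hzδ
    have hz1 : z ≠ z₁ := by
      rintro rfl
      simp at hzδ; linarith
    have hpos : 0 < ‖wMap G z - wMap G z₁‖ := hδ.trans_le hzδ
    have h1 : q z = (kMap G z - kMap G z₁) / (wMap G z - wMap G z₁) := by
      rw [hq]
      simp only [dslope_of_ne _ hz1, slope_def_field]
      rw [div_div_div_cancel_right₀ (sub_ne_zero.2 hz1)]
    rw [h1, norm_div, div_le_iff₀ hpos]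
    refine (hhol z (subset_closure hz) z₁ (subset_closure hz₁)).trans ?_
    rw [mul_assoc]
    gcongr
    rw [show 1 - ε = -ε + 1 by ring, Real.rpow_add_one hpos.ne']
    exact mul_le_mul_of_nonneg_right
      (Real.rpow_le_rpow_of_nonpos hδ hzδ (neg_nonpos.2 hε)) (norm_nonneg _)
  set D : Set ℂ := Ω ∩ {z | ‖wMap G z - wMap G z₁‖ < δ} with hD
  have hwc := continuous_wMap H.lip
  have hnc : Continuous fun z => ‖wMap G z - wMap G z₁‖ := by fun_prop
  have hDo : IsOpen D := hΩo.inter (isOpen_lt hnc continuous_const)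
  have hDcl : closure D ⊆ Ω := by
    intro z hz
    by_contra hzn
    have h1 : z ∈ frontier Ω :=
      ⟨closure_mono inter_subset_left hz, by rwa [hΩo.interior_eq]⟩
    have h2 : ‖wMap G z - wMap G z₁‖ ≤ δ := by
      refine closure_minimal (fun y hy => ?_) (isClosed_le hnc continuous_const) hz
      exact le_of_lt (mem_ofPred_eq ▸ hy.2)
    exact absurd (hδ' z h1) (not_lt.2 h2)
  have hDb : Bornology.IsBounded D :=
    H.isCompact_closure.isBounded.subset (inter_subset_left.trans subset_closure)
  have hmain : ‖q z₁‖ ≤ C * δ ^ (-ε) := by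
    refine Complex.norm_le_of_forall_mem_frontier_norm_le hDb
      ⟨hqd.mono inter_subset_left, hqd.continuousOn.mono hDcl⟩ (fun z hz => ?_)
      (subset_closure ⟨hz₁, by simpa using hδ⟩)
    refine hqle z (hDcl hz.1) (not_lt.1 fun hlt => hz.2 ?_)
    rw [hDo.interior_eq]
    exact ⟨hDcl hz.1, hlt⟩
  rw [hq] at hmain
  simp only [dslope_same, hw'.deriv, hk'.deriv, div_div_div_cancel_right₀ (two_ne_zero' ℂ),
    norm_div] at hmain
  rwa [div_le_iff₀] at hmain
  refine norm_pos_iff.2 fun h0 => hne1 ?_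
  rw [h0, zero_div]

end interior

/-- The dilatation of a transport system at an interior point is controlled by a power of the
distance to the boundary. -/
theorem exists_dilatation_constant {ε d : ℝ} (hε : 0 < ε) (hd : 1 ≤ d) :
    ∃ C > 0, ∀ G U V, UnitSystem d G U V → ∀ z, xMap G z ∈ U → ‖deriv G z‖ < 1 →
      ∀ r > 0, ball (xMap G z) r ⊆ U → 1 + ‖deriv G z‖ ≤ C * r ^ (-ε) * (1 - ‖deriv G z‖) := by
  set η := ε / (1 + ε) with hη
  have hη0 : 0 < η := by positivity
  have hη1 : η < 1 := by rw [hη, div_lt_one (by positivity)]; linarith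
  obtain ⟨C, hC, hhol⟩ := exists_holder_constant hη0 hη1 hd
  set A := (2 * d) ^ η + C with hA
  have hA0 : 0 < A := by positivity
  refine ⟨C * (2 ^ η * A ^ ε), by positivity, fun G U V H z hz hg r hr hball => ?_⟩
  obtain ⟨e, he, heg⟩ := exists_sq_mul_eq_neg_norm (deriv G z)
  have he0 : e ≠ 0 := norm_ne_zero_iff.1 (by rw [he]; simp)
  set g := rotate e G with hgdef
  have H' : UnitSystem d g ((e * ·) ⁻¹' U) ((e * ·) ⁻¹' V) := H.rotate he
  set z₁ := z / e with hz₁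
  have hez : e * z₁ = z := mul_div_cancel₀ _ he0
  have hxz : e * xMap g z₁ = xMap G z := by rw [hgdef, mul_xMap_rotate he, hez]
  have hdz : DifferentiableAt ℂ G (e * z₁) := by
    rw [hez]
    exact H.diff.differentiableAt ((H.openU.preimage (continuous_xMap H.lip)).mem_nhds hz)
  have hgd : deriv g z₁ = -‖deriv G z‖ := by
    rw [hgdef, (hasDerivAt_rotate hdz).deriv, hez, heg]
  have hz₁U : xMap g z₁ ∈ (e * ·) ⁻¹' U := by
    change e * xMap g z₁ ∈ U
    rwa [hxz]
  set Ω := xMap g ⁻¹' ((e * ·) ⁻¹' U) with hΩ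
  have hΩo : IsOpen Ω := H'.openU.preimage (continuous_xMap H'.lip)
  have hwc := continuous_wMap H'.lip
  have hfr : (frontier Ω).Nonempty := by
    by_contra hne
    rw [not_nonempty_iff_eq_empty, ← isClopen_iff_frontier_eq_empty, isClopen_iff] at hne
    rcases hne with h | h
    · exact absurd hz₁U (by change z₁ ∉ Ω; simp [h])
    · exact NormedSpace.unbounded_univ ℝ ℂ
        (h ▸ H'.isCompact_closure.isBounded.subset subset_closure)
  have hfc : IsCompact (frontier Ω) :=
    H'.isCompact_closure.of_isClosed_subset isClosed_frontier frontier_subset_closure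
  obtain ⟨z₀, hz₀, hmin⟩ := hfc.exists_isMinOn hfr
    (f := fun z => ‖wMap g z - wMap g z₁‖) (Continuous.continuousOn (by fun_prop))
  set δ := ‖wMap g z₀ - wMap g z₁‖ with hδ
  have hng : ‖deriv g z₁‖ < 1 := by rw [hgd]; simpa using hg
  have hd₁ : DifferentiableAt ℂ g z₁ := (hasDerivAt_rotate hdz).differentiableAt
  have hz₀n : z₀ ∉ Ω := by
    have := hz₀.2
    rwa [hΩo.interior_eq] at this
  have hδ0 : 0 < δ := by
    refine norm_pos_iff.2 (sub_ne_zero.2 ?_)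
    refine (wMap_ne_of_strict (strict_of_norm_deriv_lt H'.lip hd₁ hng ?_)).symm
    rintro rfl
    exact hz₀n hz₁U
  have key := H'.norm_deriv_kMap_le hη0.le hC (hhol _ _ _ H') hz₁U hng (half_pos hδ0)
    fun y hy => lt_of_lt_of_le (half_lt_self hδ0) (hmin hy)
  have hδd : δ ≤ 2 * d := H'.norm_wMap_sub_le hz₀.1 (subset_closure hz₁U)
  have hrδ : r ≤ A * δ ^ (1 - η) := by
    have h1 : r ≤ ‖xMap g z₀ - xMap g z₁‖ := by
      by_contra hcon
      push Not at hcon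
      refine hz₀n (hball (?_ : e * xMap g z₀ ∈ _))
      rw [mem_ball, dist_eq_norm, ← hxz, ← mul_sub, norm_mul, he, one_mul]
      exact hcon
    have h2 := hhol _ _ _ H' z₀ hz₀.1 z₁ (subset_closure hz₁U)
    have h3 : δ = δ ^ η * δ ^ (1 - η) := by
      rw [← Real.rpow_add hδ0]; simp
    have h4 : δ ^ η ≤ (2 * d) ^ η := Real.rpow_le_rpow hδ0.le hδd hη0.le
    calc r ≤ δ + C * δ ^ (1 - η) := h1.trans ((norm_xMap_sub_le _ _).trans (by gcongr))
      _ ≤ (2 * d) ^ η * δ ^ (1 - η) + C * δ ^ (1 - η) := by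
        gcongr
        conv_lhs => rw [h3]
        gcongr
      _ = _ := by rw [hA]; ring
  have hpow : (δ / 2) ^ (-η) ≤ 2 ^ η * A ^ ε * r ^ (-ε) := by
    have h1 : r / A ≤ δ ^ (1 - η) := by rw [div_le_iff₀ hA0]; linarith
    have h2 : (δ ^ (1 - η)) ^ (-ε) ≤ (r / A) ^ (-ε) :=
      Real.rpow_le_rpow_of_nonpos (by positivity) h1 (by linarith)
    rw [← Real.rpow_mul hδ0.le, show (1 - η) * -ε = -η by rw [hη]; field_simp; ring] at h2
    rw [Real.div_rpow hδ0.le zero_le_two, Real.rpow_neg zero_le_two, div_inv_eq_mul]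
    rw [Real.div_rpow hr.le hA0.le, Real.rpow_neg hA0.le, div_inv_eq_mul] at h2
    nlinarith [Real.rpow_pos_of_pos two_pos η]
  have e1 : ‖1 - deriv g z₁‖ = 1 + ‖deriv G z‖ := by
    rw [hgd, sub_neg_eq_add, ← Complex.ofReal_one, ← Complex.ofReal_add, Complex.norm_real,
      Real.norm_of_nonneg (by positivity)]
  have e2 : ‖1 + deriv g z₁‖ = 1 - ‖deriv G z‖ := by
    rw [hgd, ← sub_eq_add_neg, ← Complex.ofReal_one, ← Complex.ofReal_sub, Complex.norm_real,
      Real.norm_of_nonneg (by linarith)]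
  rw [e1, e2] at key
  refine key.trans ?_
  rw [mul_assoc C _ (r ^ (-ε))]
  gcongr

end PlanarOT

namespace PlanarOT

section subgradient
variable {E : Type*} [NormedAddCommGroup E] [InnerProductSpace ℝ E] {φ : E → ℝ}

/-- `p` is a subgradient of `φ` at `x`. -/
def IsSubgrad (φ : E → ℝ) (x p : E) : Prop := ∀ y, φ x + ⟪p, y - x⟫ ≤ φ y

lemma IsSubgrad.monotone {x p x' p' : E} (h : IsSubgrad φ x p) (h' : IsSubgrad φ x' p') :
    0 ≤ ⟪p - p', x - x'⟫ := by
  have h1 := h x'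
  have h2 := h' x
  rw [inner_sub_left]
  have h3 : ⟪p, x' - x⟫ = -⟪p, x - x'⟫ := by rw [← inner_neg_right, neg_sub]
  linarith

/-- A limit along `t → 0⁺` of an inequality between affine functions of `t`. -/
lemma le_of_forall_small {a b : ℝ} {c : ℝ} (h : ∀ t : ℝ, 0 < t → t ≤ 1 → a ≤ b + t * c) :
    a ≤ b := by
  have h1 : Filter.Tendsto (fun t : ℝ => b + t * c) (nhdsWithin 0 (Ioi 0)) (nhds b) := by
    have : Filter.Tendsto (fun t : ℝ => b + t * c) (nhds 0) (nhds (b + 0 * c)) :=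
      Continuous.tendsto (by fun_prop) 0
    simpa using this.mono_left nhdsWithin_le_nhds
  refine ge_of_tendsto h1 ?_
  filter_upwards [Ioc_mem_nhdsGT (zero_lt_one' ℝ)] with t ht using h t ht.1 ht.2

lemma convexOn_segment_le (hφ : ConvexOn ℝ univ φ) (x y : E) {t : ℝ} (h0 : 0 ≤ t) (h1 : t ≤ 1) :
    φ (x + t • (y - x)) ≤ φ x + t * (φ y - φ x) := by
  have := hφ.2 (mem_univ x) (mem_univ y) (sub_nonneg.2 h1) h0 (by ring)
  rw [show x + t • (y - x) = (1 - t) • x + t • y by rw [smul_sub, sub_smul, one_smul]; abel]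
  simp only [smul_eq_mul] at this
  linarith

lemma isSubgrad_of_hasFDerivAt (hφ : ConvexOn ℝ univ φ) {x p : E}
    (h : HasFDerivAt φ (innerSL ℝ p) x) : IsSubgrad φ x p := by
  intro y
  have h1 : HasDerivAt (fun t : ℝ => φ (x + t • (y - x))) ⟪p, y - x⟫ 0 := by
    have h2 : HasDerivAt (fun t : ℝ => x + t • (y - x)) (y - x) 0 := by
      simpa using ((hasDerivAt_id (0 : ℝ)).smul_const (y - x)).const_add x
    have h3 : HasFDerivAt φ (innerSL ℝ p) (x + (0 : ℝ) • (y - x)) := by simpa using h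
    exact h3.comp_hasDerivAt 0 h2
  have h4 : Filter.Tendsto (slope (fun t : ℝ => φ (x + t • (y - x))) 0) (nhdsWithin 0 (Ioi 0))
      (nhds ⟪p, y - x⟫) :=
    h1.tendsto_slope.mono_left (nhdsWithin_mono 0 fun t ht => ne_of_gt ht)
  suffices ⟪p, y - x⟫ ≤ φ y - φ x by linarith
  refine le_of_tendsto h4 ?_
  filter_upwards [Ioc_mem_nhdsGT (zero_lt_one' ℝ)] with t ht
  have h5 := convexOn_segment_le hφ x y ht.1.le ht.2
  rw [slope_def_field]
  simp only [zero_smul, add_zero, sub_zero]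
  rw [div_le_iff₀ ht.1]
  linarith

lemma isSubgrad_of_isMin (hφ : ConvexOn ℝ univ φ) {x ζ : E}
    (h : ∀ y, φ x + ‖x - ζ‖ ^ 2 / 2 ≤ φ y + ‖y - ζ‖ ^ 2 / 2) : IsSubgrad φ x (ζ - x) := by
  intro y
  refine le_of_forall_small (c := ‖y - x‖ ^ 2 / 2) fun t h0 h1 => ?_
  have h2 := h (x + t • (y - x))
  have h3 := convexOn_segment_le hφ x y h0.le h1
  have h4 : ‖x + t • (y - x) - ζ‖ ^ 2 =
      ‖x - ζ‖ ^ 2 - 2 * (t * ⟪ζ - x, y - x⟫) + t ^ 2 * ‖y - x‖ ^ 2 := by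
    rw [show x + t • (y - x) - ζ = t • (y - x) - (ζ - x) by abel, norm_sub_sq_real,
      norm_smul, inner_smul_left, real_inner_comm, norm_sub_rev ζ x, mul_pow]
    simp
    ring
  rw [h4] at h2
  have h5 : t * (φ x + ⟪ζ - x, y - x⟫) ≤ t * (φ y + t * (‖y - x‖ ^ 2 / 2)) := by nlinarith
  exact le_of_mul_le_mul_left h5 h0

lemma exists_prox [FiniteDimensional ℝ E] (hφ : ConvexOn ℝ univ φ) {x₀ p₀ : E}
    (h₀ : IsSubgrad φ x₀ p₀) (ζ : E) : ∃ x, IsSubgrad φ x (ζ - x) := by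
  have hc : Continuous φ := hφ.locallyLipschitz.continuous
  have hcoer : Filter.Tendsto (fun y => φ y + ‖y - ζ‖ ^ 2 / 2) (Filter.cocompact E)
      Filter.atTop := by
    have h1 : Filter.Tendsto (fun y : E => ‖y‖) (Filter.cocompact E) Filter.atTop :=
      tendsto_norm_cocompact_atTop
    have hb : ∀ y, φ x₀ - ⟪p₀, x₀⟫ - ‖ζ - p₀‖ ^ 2 + ‖y‖ ^ 2 / 4 ≤ φ y + ‖y - ζ‖ ^ 2 / 2 := by
      intro y
      have h2 := h₀ y
      have h3 := norm_sub_sq_real y ζ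
      have h4 := real_inner_le_norm (ζ - p₀) y
      rw [inner_sub_right] at h2
      rw [inner_sub_left, real_inner_comm y ζ] at h4
      nlinarith [sq_nonneg (‖ζ - p₀‖ - ‖y‖ / 2), sq_nonneg ‖ζ‖]
    refine Filter.tendsto_atTop_mono hb (Filter.tendsto_atTop_add_const_left _ _ ?_)
    exact ((Filter.tendsto_pow_atTop two_ne_zero).comp h1).atTop_div_const (by norm_num)
  obtain ⟨x, hx⟩ := Continuous.exists_forall_le (f := fun y => φ y + ‖y - ζ‖ ^ 2 / 2)
    (by fun_prop) hcoer
  exact ⟨x, isSubgrad_of_isMin hφ hx⟩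

/-- If `x` and `ζ - x` are dual to each other then `x` minimises the proximal functional. -/
lemma IsSubgrad.prox_le {x ζ : E} (h : IsSubgrad φ x (ζ - x)) (y : E) :
    φ x + ‖ζ - x‖ ^ 2 / 2 ≤ φ y + ‖ζ - y‖ ^ 2 / 2 := by
  have h1 := h y
  have h2 : ‖ζ - y‖ ^ 2 = ‖ζ - x‖ ^ 2 - 2 * ⟪ζ - x, y - x⟫ + ‖y - x‖ ^ 2 := by
    rw [← norm_sub_sq_real, sub_sub_sub_cancel_right]
  rw [h2]
  nlinarith [sq_nonneg ‖y - x‖]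

section prox
variable {X : E → E} (hX : ∀ ζ, IsSubgrad φ (X ζ) (ζ - X ζ))
include hX

lemma norm_sub_sq_prox (ζ ζ' : E) :
    ‖X ζ - X ζ'‖ ^ 2 + ‖(ζ - X ζ) - (ζ' - X ζ')‖ ^ 2 ≤ ‖ζ - ζ'‖ ^ 2 := by
  have h := (hX ζ).monotone (hX ζ')
  have h1 : ‖ζ - ζ'‖ ^ 2 = ‖((ζ - X ζ) - (ζ' - X ζ')) + (X ζ - X ζ')‖ ^ 2 := by
    congr 2; abel
  rw [h1, norm_add_sq_real]
  linarith

lemma norm_reflection_sub_le (ζ ζ' : E) :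
    ‖(X ζ - (ζ - X ζ)) - (X ζ' - (ζ' - X ζ'))‖ ≤ ‖ζ - ζ'‖ := by
  have h := (hX ζ).monotone (hX ζ')
  have h1 : ‖ζ - ζ'‖ ^ 2 = ‖((ζ - X ζ) - (ζ' - X ζ')) + (X ζ - X ζ')‖ ^ 2 := by
    congr 2; abel
  have h2 : ‖(X ζ - (ζ - X ζ)) - (X ζ' - (ζ' - X ζ'))‖ ^ 2 =
      ‖((ζ - X ζ) - (ζ' - X ζ')) - (X ζ - X ζ')‖ ^ 2 := by
    rw [← norm_neg]; congr 2; abel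
  refine le_of_sq_le_sq ?_ (norm_nonneg _)
  rw [h1, h2, norm_add_sq_real, norm_sub_sq_real]
  linarith

lemma prox_eq {x p : E} (h : IsSubgrad φ x p) : X (x + p) = x := by
  have h1 := h.monotone (hX (x + p))
  rw [show p - (x + p - X (x + p)) = -(x - X (x + p)) by abel, inner_neg_left,
    real_inner_self_eq_norm_sq] at h1
  have h2 : ‖x - X (x + p)‖ = 0 := by nlinarith [norm_nonneg (x - X (x + p))]
  exact (sub_eq_zero.1 (norm_eq_zero.1 h2)).symm

/-- The Moreau envelope is differentiable with gradient the dual proximal map. -/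
lemma hasFDerivAt_moreau (ζ : E) :
    HasFDerivAt (fun ζ => φ (X ζ) + ‖ζ - X ζ‖ ^ 2 / 2) (innerSL ℝ (ζ - X ζ)) ζ := by
  set M := fun ζ => φ (X ζ) + ‖ζ - X ζ‖ ^ 2 / 2 with hM
  have hup : ∀ a b, M b ≤ M a + ⟪a - X a, b - a⟫ + ‖b - a‖ ^ 2 / 2 := by
    intro a b
    have h1 := (hX b).prox_le (X a)
    have h2 : ‖b - X a‖ ^ 2 = ‖a - X a‖ ^ 2 + 2 * ⟪a - X a, b - a⟫ + ‖b - a‖ ^ 2 := by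
      rw [← norm_add_sq_real]; congr 2; abel
    rw [h2] at h1
    simp only [hM]
    linarith
  have hbound : ∀ b, ‖M b - M ζ - ⟪ζ - X ζ, b - ζ⟫‖ ≤ 2 * ‖b - ζ‖ ^ 2 := by
    intro b
    have h1 := hup ζ b
    have h2 := hup b ζ
    have h3 : ⟪b - X b, ζ - b⟫ = -⟪b - X b, b - ζ⟫ := by rw [← inner_neg_right, neg_sub]
    have h4 := real_inner_le_norm ((ζ - X ζ) - (b - X b)) (b - ζ)
    have h5 := norm_sub_sq_prox hX ζ b
    have h6 : ‖(ζ - X ζ) - (b - X b)‖ ≤ ‖b - ζ‖ := by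
      rw [norm_sub_rev b ζ]
      refine le_of_sq_le_sq ?_ (norm_nonneg _)
      nlinarith [sq_nonneg ‖X ζ - X b‖]
    rw [inner_sub_left] at h4
    rw [norm_sub_rev ζ b] at h2
    have h7 : ‖(ζ - X ζ) - (b - X b)‖ * ‖b - ζ‖ ≤ ‖b - ζ‖ ^ 2 := by
      rw [sq]; gcongr
    rw [Real.norm_eq_abs, abs_le]
    constructor <;> nlinarith [sq_nonneg ‖b - ζ‖]
  rw [hasFDerivAt_iff_isLittleO]
  have h8 : (fun b => M b - M ζ - ⟪ζ - X ζ, b - ζ⟫) =O[nhds ζ] fun b => ‖b - ζ‖ ^ 2 :=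
    Asymptotics.IsBigO.of_bound 2 (Filter.Eventually.of_forall fun b => by
      simpa using hbound b)
  refine h8.trans_isLittleO ?_
  have h9 : (fun b : E => ‖b - ζ‖ ^ 2) =o[nhds ζ] fun b => ‖b - ζ‖ := by
    have h10 : Filter.Tendsto (fun b : E => ‖b - ζ‖) (nhds ζ) (nhds 0) := by
      have : Continuous fun b : E => ‖b - ζ‖ := by fun_prop
      simpa using this.tendsto ζ
    exact (Asymptotics.isLittleO_pow_id one_lt_two).comp_tendsto h10
  exact h9.trans_isBigO (Asymptotics.isBigO_refl _ _).norm_left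

lemma symm_of_hasFDerivAt {ζ : E} {B : E →L[ℝ] E}
    (hB : HasFDerivAt (fun ζ => ζ - X ζ) B ζ) (v w : E) : ⟪B v, w⟫ = ⟪B w, v⟫ := by
  have h : HasFDerivAt (fun ζ => innerSL ℝ (ζ - X ζ)) ((innerSL ℝ : E →L[ℝ] E →L[ℝ] ℝ) ∘L B) ζ :=
    (innerSL ℝ : E →L[ℝ] E →L[ℝ] ℝ).hasFDerivAt.comp ζ hB
  exact second_derivative_symmetric_of_eventually_of_real
    (Filter.Eventually.of_forall (hasFDerivAt_moreau hX)) h v w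

lemma prox_segment {ζ ζ' : E} (h : X ζ = X ζ') {t : ℝ} (h0 : 0 ≤ t) (h1 : t ≤ 1) :
    X (ζ + t • (ζ' - ζ)) = X ζ := by
  have h2 : IsSubgrad φ (X ζ) (ζ + t • (ζ' - ζ) - X ζ) := by
    intro y
    have h3 := hX ζ y
    have h4 := hX ζ' y
    rw [← h] at h4
    rw [show ζ + t • (ζ' - ζ) - X ζ = (1 - t) • (ζ - X ζ) + t • (ζ' - X ζ) by module,
      inner_add_left, real_inner_smul_left, real_inner_smul_left]
    nlinarith
  have h5 := prox_eq hX h2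
  rwa [add_sub_cancel] at h5

lemma dual_prox_segment (hφ : ConvexOn ℝ univ φ) {ζ ζ' : E} (h : ζ - X ζ = ζ' - X ζ') {t : ℝ}
    (h0 : 0 ≤ t) (h1 : t ≤ 1) :
    X (ζ + t • (ζ' - ζ)) = X ζ + t • (ζ' - ζ) := by
  have hX' : X ζ' = X ζ + (ζ' - ζ) := by
    rw [← sub_eq_zero] at h ⊢; rw [← h]; abel
  have h2 : IsSubgrad φ (X ζ + t • (ζ' - ζ)) (ζ - X ζ) := by
    intro y
    have h3 := hX ζ y
    have h4 := hX ζ' y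
    have h5 := convexOn_segment_le hφ (X ζ) (X ζ') h0 h1
    rw [← h, hX'] at h4
    rw [hX', add_sub_cancel_left] at h5
    rw [show y - (X ζ + (ζ' - ζ)) = (y - X ζ) - (ζ' - ζ) by abel, inner_sub_right] at h4
    rw [show y - (X ζ + t • (ζ' - ζ)) = (y - X ζ) - t • (ζ' - ζ) by abel, inner_sub_right,
      real_inner_smul_right]
    nlinarith
  have h6 := prox_eq hX h2
  rwa [show X ζ + t • (ζ' - ζ) + (ζ - X ζ) = ζ + t • (ζ' - ζ) by abel] at h6

end prox
end subgradient

end PlanarOT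

namespace PlanarOT

open scoped ComplexConjugate

/-- A Lipschitz map which is almost everywhere complex differentiable on an open set is
holomorphic there. -/
lemma differentiableOn_of_ae_differentiableAt {G : ℂ → ℂ} (hG : LipschitzWith 1 G) {O : Set ℂ}
    (hO : IsOpen O) (h : ∀ᵐ z, z ∈ O → DifferentiableAt ℂ G z) : DifferentiableOn ℂ G O := by
  intro z₀ hz₀
  obtain ⟨r, hr, hball⟩ := Metric.isOpen_iff.1 hO z₀ hz₀
  set F : ℕ → ℂ → ℂ := fun n z =>
    ⨍ y in ball (0 : ℂ) (r / 2 / (n + 1)), G (z + y) with hF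
  have hrn : ∀ n : ℕ, 0 < r / 2 / (n + 1) := fun n => by positivity
  have hrn' : ∀ n : ℕ, r / 2 / (n + 1) ≤ r / 2 := fun n =>
    div_le_self (by positivity) (by linarith [(n.cast_nonneg : (0 : ℝ) ≤ n)])
  have hc := hG.continuous
  have hvol : ∀ n : ℕ, volume (ball (0 : ℂ) (r / 2 / (n + 1))) ≠ ⊤ := fun n =>
    measure_ball_lt_top.ne
  have hvol0 : ∀ n : ℕ, volume (ball (0 : ℂ) (r / 2 / (n + 1))) ≠ 0 := fun n =>
    (measure_ball_pos _ _ (hrn n)).ne'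
  have hintegrable : ∀ n z, IntegrableOn (fun y => G (z + y)) (ball (0 : ℂ) (r / 2 / (n + 1))) :=
    fun n z => ((by fun_prop : Continuous fun y => G (z + y)).continuousOn.integrableOn_compact
      (isCompact_closedBall (0 : ℂ) (r / 2 / (n + 1)))).mono_set ball_subset_closedBall
  have hdiff : ∀ n, DifferentiableOn ℂ (F n) (ball z₀ (r / 2)) := by
    intro n z hz
    have hae : ∀ᵐ y ∂(volume.restrict (ball (0 : ℂ) (r / 2 / (n + 1)))),
        DifferentiableAt ℂ G (z + y) := by
      rw [ae_restrict_iff' measurableSet_ball]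
      have h1 := (quasiMeasurePreserving_add_left volume z).ae h
      filter_upwards [h1] with y hy hyb
      refine hy (hball ?_)
      rw [mem_ball, dist_eq_norm] at hz
      rw [mem_ball_zero_iff] at hyb
      rw [mem_ball, dist_eq_norm, show z + y - z₀ = (z - z₀) + y by ring]
      linarith [norm_add_le (z - z₀) y, hrn' n]
    have h2 := hasDerivAt_integral_of_dominated_loc_of_lip (𝕜 := ℂ)
      (μ := volume.restrict (ball (0 : ℂ) (r / 2 / (n + 1))))
      (F := fun z y => G (z + y)) (F' := fun y => deriv G (z + y)) (x₀ := z) (s := univ)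
      (bound := fun _ => 1) Filter.univ_mem
      (Filter.Eventually.of_forall fun x => (hintegrable n x).aestronglyMeasurable) (hintegrable n z)
      ((measurable_deriv G).comp (measurable_const_add z)).aestronglyMeasurable
      (Filter.Eventually.of_forall fun y => by
        refine (LipschitzWith.of_dist_le_mul fun a b => ?_).lipschitzOnWith
        have := hG.dist_le_mul (a + y) (b + y)
        simpa using this)
      (integrable_const_iff.2 (Or.inr ⟨by
        rw [Measure.restrict_apply_univ]; exact measure_ball_lt_top⟩))
      (hae.mono fun y hy => by
        have h3 := hy.hasDerivAt.comp_add_const z y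
        exact h3)
    have h4 := h2.2.differentiableAt.const_smul
      ((volume.real (ball (0 : ℂ) (r / 2 / (n + 1))))⁻¹)
    refine (h4.congr_of_eventuallyEq (Filter.Eventually.of_forall fun x => ?_)).differentiableWithinAt
    simp only [hF, setAverage_eq, Pi.smul_apply]
  have hlim : TendstoLocallyUniformlyOn F G Filter.atTop (ball z₀ (r / 2)) := by
    refine TendstoUniformlyOn.tendstoLocallyUniformlyOn ?_
    rw [Metric.tendstoUniformlyOn_iff]
    intro ε hε
    have h5 : Filter.Tendsto (fun n : ℕ => r / 2 / ((n : ℝ) + 1)) Filter.atTop (nhds 0) :=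
      Filter.Tendsto.div_atTop tendsto_const_nhds
        (Filter.tendsto_atTop_add_const_right _ _ tendsto_natCast_atTop_atTop)
    filter_upwards [h5.eventually_lt_const hε] with n hn z _
    refine lt_of_le_of_lt ?_ hn
    have h6 : F n z ∈ closedBall (G z) (r / 2 / (n + 1)) := by
      refine (convex_closedBall _ _).set_average_mem isClosed_closedBall (hvol0 n) (hvol n) ?_
        (hintegrable n z)
      rw [ae_restrict_iff' measurableSet_ball]
      refine Filter.Eventually.of_forall fun y hy => ?_
      have h7 := hG.dist_le_mul (z + y) z
      rw [mem_ball_zero_iff] at hy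
      rw [mem_closedBall]
      refine h7.trans ?_
      simpa using hy.le
    rw [dist_comm]
    exact h6
  have h8 := hlim.differentiableOn (Filter.Eventually.of_forall hdiff) isOpen_ball
  exact (h8.differentiableAt (isOpen_ball.mem_nhds (mem_ball_self (by positivity)))).differentiableWithinAt

lemma volume_image_eq_zero_of_lipschitz {f : ℂ → ℂ} (hf : LipschitzWith 1 f) {N : Set ℂ}
    (hN : volume N = 0) : volume (f '' N) = 0 := by
  have e1 : (volume : Measure ℂ) ≪ μH[(Module.finrank ℝ ℂ : ℝ)] :=
    Measure.absolutelyContinuous_isAddHaarMeasure _ _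
  have e2 : μH[(Module.finrank ℝ ℂ : ℝ)] ≪ (volume : Measure ℂ) :=
    Measure.absolutelyContinuous_isAddHaarMeasure _ _
  refine e1 (le_antisymm ?_ bot_le)
  have h1 := hf.hausdorffMeasure_image_le (d := (Module.finrank ℝ ℂ : ℝ)) (by positivity) N
  refine h1.trans ?_
  rw [e2 hN]
  simp

end PlanarOT

namespace PlanarOT

open scoped ComplexConjugate

lemma det_clm_complex (A : ℂ →L[ℝ] ℂ) :
    A.det = (A 1).re * (A Complex.I).im - (A Complex.I).re * (A 1).im := by
  rw [ContinuousLinearMap.det, ← LinearMap.det_toMatrix Complex.basisOneI, Matrix.det_fin_two]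
  simp [LinearMap.toMatrix_apply]

/-- If `A` is symmetric, `0 ≤ A ≤ 1` and `A` and `1 - A` have the same determinant in absolute
value, then `A` has trace one. -/
lemma trace_eq_one_of_abs_det_eq {A : ℂ →L[ℝ] ℂ} (hs : (A 1).im = (A Complex.I).re)
    (hA : ∀ v, ‖A v - (v - A v)‖ ≤ ‖v‖)
    (hdet : |A.det| = |(ContinuousLinearMap.id ℝ ℂ - A).det|) :
    (A 1).re + (A Complex.I).im = 1 := by
  have hexp : ∀ x y : ℝ, A ⟨x, y⟩ = x * A 1 + y * A Complex.I := by
    intro x y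
    rw [show (⟨x, y⟩ : ℂ) = x • 1 + y • Complex.I by apply Complex.ext <;> simp, map_add,
      map_smul, map_smul, Complex.real_smul, Complex.real_smul]
  have hsq : ∀ x y : ℝ, 0 ≤ (A 1).re * x ^ 2 + 2 * (A 1).im * (x * y) + (A Complex.I).im * y ^ 2 ∧
      0 ≤ (1 - (A 1).re) * x ^ 2 - 2 * (A 1).im * (x * y) + (1 - (A Complex.I).im) * y ^ 2 := by
    intro x y
    have h := hA ⟨x, y⟩
    rw [hexp] at h
    have h2 := pow_le_pow_left₀ (norm_nonneg _) h 2
    rw [← Complex.normSq_eq_norm_sq, ← Complex.normSq_eq_norm_sq, Complex.normSq_apply,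
      Complex.normSq_apply] at h2
    simp only [Complex.sub_re, Complex.sub_im, Complex.add_re, Complex.add_im,
      Complex.re_ofReal_mul, Complex.im_ofReal_mul] at h2
    rw [← hs] at h2
    constructor
    · nlinarith [sq_nonneg (x * (A 1).re + y * (A 1).im), sq_nonneg (x * (A 1).im + y * (A Complex.I).im)]
    · nlinarith [sq_nonneg (x - (x * (A 1).re + y * (A 1).im)), sq_nonneg (y - (x * (A 1).im + y * (A Complex.I).im))]
  have d1 : 0 ≤ A.det := by
    have := discrim_le_zero (a := (A 1).re) (b := 2 * (A 1).im) (c := (A Complex.I).im)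
      fun x => by have := (hsq x 1).1; nlinarith
    rw [det_clm_complex, ← hs]
    rw [discrim] at this
    nlinarith
  have d2 : 0 ≤ (ContinuousLinearMap.id ℝ ℂ - A).det := by
    have := discrim_le_zero (a := 1 - (A 1).re) (b := -2 * (A 1).im) (c := 1 - (A Complex.I).im)
      fun x => by have := (hsq x 1).2; nlinarith
    rw [det_clm_complex]
    simp only [sub_apply, ContinuousLinearMap.id_apply, Complex.sub_re,
      Complex.sub_im, Complex.one_re, Complex.one_im, Complex.I_re, Complex.I_im]
    rw [← hs]
    rw [discrim] at this
    nlinarith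
  rw [abs_of_nonneg d1, abs_of_nonneg d2, det_clm_complex, det_clm_complex] at hdet
  simp only [sub_apply, ContinuousLinearMap.id_apply, Complex.sub_re,
      Complex.sub_im, Complex.one_re, Complex.one_im, Complex.I_re, Complex.I_im] at hdet
  linarith

end PlanarOT

namespace PlanarOT

open scoped ComplexConjugate

/-- The absolute value of the real Jacobian determinant of a planar map. -/
def jac (f : ℂ → ℂ) (z : ℂ) : ENNReal := ENNReal.ofReal |(fderiv ℝ f z).det|

lemma measurable_jac (f : ℂ → ℂ) : Measurable (jac f) :=
  (ContinuousLinearMap.continuous_det.measurable.comp (measurable_fderiv ℝ f)).abs.ennreal_ofReal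

lemma differentiableAt_of_jac_ne_zero {f : ℂ → ℂ} {z : ℂ} (h : jac f z ≠ 0) :
    DifferentiableAt ℝ f z := by
  by_contra hd
  refine h ?_
  rw [jac, fderiv_zero_of_not_differentiableAt hd, det_clm_complex]
  simp

lemma volume_image_le_lintegral_jac {f : ℂ → ℂ} (hf : LipschitzWith 1 f) {E : Set ℂ}
    (hE : MeasurableSet E) : volume (f '' E) ≤ ∫⁻ z in E, jac f z := by
  set D := {z | DifferentiableAt ℝ f z}
  have hD : MeasurableSet D := measurableSet_of_differentiableAt ℝ f
  have h0 : volume (f '' (E \ D)) = 0 := by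
    refine volume_image_eq_zero_of_lipschitz hf (measure_mono_null (sdiff_subset_compl E D) ?_)
    exact hf.ae_differentiableAt
  calc volume (f '' E) ≤ volume (f '' (E ∩ D) ∪ f '' (E \ D)) := by
        rw [← image_union, inter_union_sdiff]
    _ ≤ volume (f '' (E ∩ D)) := by
        simpa [h0] using measure_union_le (μ := volume) (f '' (E ∩ D)) (f '' (E \ D))
    _ ≤ ∫⁻ z in E ∩ D, jac f z :=
        addHaar_image_le_lintegral_abs_det_fderiv volume (hE.inter hD)
          fun z hz => hz.2.hasFDerivAt.hasFDerivWithinAt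
    _ ≤ ∫⁻ z in E, jac f z := lintegral_mono_set inter_subset_left

lemma lintegral_jac_eq {f : ℂ → ℂ} (hf : LipschitzWith 1 f)
    (hinj : ∀ z, jac f z ≠ 0 → ∀ z', f z' = f z → z' = z) {E : Set ℂ}
    (hE : MeasurableSet E) : ∫⁻ z in E, jac f z = volume (f '' E) := by
  refine le_antisymm ?_ (volume_image_le_lintegral_jac hf hE)
  have hm : MeasurableSet {z | jac f z ≠ 0} := (measurable_jac f) (measurableSet_singleton 0).compl
  calc ∫⁻ z in E, jac f z = ∫⁻ z in E ∩ {z | jac f z ≠ 0}, jac f z := by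
        rw [← lintegral_inter_add_sdiff (jac f) E hm]
        rw [show ∫⁻ z in E \ {z | jac f z ≠ 0}, jac f z = 0 from ?_, add_zero]
        rw [setLIntegral_congr_fun (g := 0) (hE.diff hm) (fun z hz => by simpa using hz.2)]
        simp
    _ = volume (f '' (E ∩ {z | jac f z ≠ 0})) :=
        lintegral_abs_det_fderiv_eq_addHaar_image volume (hE.inter hm)
          (fun z hz => (differentiableAt_of_jac_ne_zero hz.2).hasFDerivAt.hasFDerivWithinAt)
          (fun z _ z' hz' h => hinj z' hz'.2 z h)
    _ ≤ volume (f '' E) := measure_mono (image_mono inter_subset_left)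

/-- A map which is constant, up to a fixed linear map `L`, along the segment from `z` to `z'` has
derivative `L` in that direction. -/
lemma fderiv_apply_of_segment {f : ℂ → ℂ} {z z' w : ℂ} (hd : DifferentiableAt ℝ f z)
    (h : ∀ t : ℝ, 0 ≤ t → t ≤ 1 → f (z + t • (z' - z)) = f z + t • w) :
    fderiv ℝ f z (z' - z) = w := by
  have h1 : HasDerivAt (fun t : ℝ => f (z + t • (z' - z))) (fderiv ℝ f z (z' - z)) 0 := by
    have h2 : HasDerivAt (fun t : ℝ => z + t • (z' - z)) (z' - z) 0 := by
      simpa using ((hasDerivAt_id (0 : ℝ)).smul_const (z' - z)).const_add z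
    have h3 : HasFDerivAt f (fderiv ℝ f z) (z + (0 : ℝ) • (z' - z)) := by
      simpa using hd.hasFDerivAt
    exact h3.comp_hasDerivAt 0 h2
  have h4 : HasDerivAt (fun t : ℝ => f z + t • w) w 0 := by
    simpa using ((hasDerivAt_id (0 : ℝ)).smul_const w).const_add (f z)
  refine (uniqueDiffOn_Icc (zero_lt_one' ℝ) 0 (left_mem_Icc.2 zero_le_one)).eq_deriv _
    h1.hasDerivWithinAt ?_
  exact h4.hasDerivWithinAt.congr (fun t ht => h t ht.1 ht.2) (by simp)

lemma jac_eq_zero_of_segment {f : ℂ → ℂ} {z z' : ℂ} (hne : z' ≠ z)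
    (h : ∀ t : ℝ, 0 ≤ t → t ≤ 1 → f (z + t • (z' - z)) = f z) : jac f z = 0 := by
  by_contra hj
  have h1 := fderiv_apply_of_segment (w := 0) (differentiableAt_of_jac_ne_zero hj)
    (fun t h0 h1 => by rw [h t h0 h1, smul_zero, add_zero])
  refine hj ?_
  have h2 : LinearMap.det (fderiv ℝ f z : ℂ →ₗ[ℝ] ℂ) = 0 := by
    rw [LinearMap.det_eq_zero_iff_ker_ne_bot, Submodule.ne_bot_iff]
    exact ⟨z' - z, h1, sub_ne_zero.2 hne⟩
  rw [jac, ContinuousLinearMap.det, h2]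
  simp

section prox
variable {φ : ℂ → ℝ} {X : ℂ → ℂ} (hX : ∀ ζ, IsSubgrad φ (X ζ) (ζ - X ζ))
include hX

lemma lipschitz_prox : LipschitzWith 1 X := by
  refine LipschitzWith.of_dist_le_mul fun z z' => ?_
  rw [dist_eq_norm, dist_eq_norm, NNReal.coe_one, one_mul]
  refine le_of_sq_le_sq ?_ (norm_nonneg _)
  nlinarith [norm_sub_sq_prox hX z z', sq_nonneg ‖(z - X z) - (z' - X z')‖]

lemma lipschitz_dual_prox : LipschitzWith 1 fun ζ => ζ - X ζ := by
  refine LipschitzWith.of_dist_le_mul fun z z' => ?_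
  rw [dist_eq_norm, dist_eq_norm, NNReal.coe_one, one_mul]
  refine le_of_sq_le_sq ?_ (norm_nonneg _)
  nlinarith [norm_sub_sq_prox hX z z', sq_nonneg ‖X z - X z'‖]

lemma lintegral_jac_prox {E : Set ℂ} (hE : MeasurableSet E) :
    ∫⁻ z in E, jac X z = volume (X '' E) := by
  refine lintegral_jac_eq (lipschitz_prox hX) (fun z hz z' h => ?_) hE
  by_contra hne
  exact hz (jac_eq_zero_of_segment hne fun t h0 h1 => prox_segment hX h.symm h0 h1)

lemma lintegral_jac_dual_prox (hφ : ConvexOn ℝ univ φ) {E : Set ℂ} (hE : MeasurableSet E) :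
    ∫⁻ z in E, jac (fun ζ => ζ - X ζ) z = volume ((fun ζ => ζ - X ζ) '' E) := by
  refine lintegral_jac_eq (lipschitz_dual_prox hX) (fun z hz z' h => ?_) hE
  by_contra hne
  refine hz (jac_eq_zero_of_segment hne fun t h0 h1 => ?_)
  rw [dual_prox_segment hX hφ h.symm h0 h1]
  abel

end prox

end PlanarOT

namespace PlanarOT

open scoped ComplexConjugate

/-- The conjugate of the Cayley transform of the subdifferential with resolvent `X`. -/
def cayley (X : ℂ → ℂ) (ζ : ℂ) : ℂ := conj (X ζ - (ζ - X ζ))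

lemma xMap_cayley (X : ℂ → ℂ) : xMap (cayley X) = X := by
  ext ζ
  rw [xMap_eq, cayley, Complex.conj_conj]
  ring

lemma pMap_cayley (X : ℂ → ℂ) : pMap (cayley X) = fun ζ => ζ - X ζ := by
  ext ζ
  rw [pMap_eq, cayley, Complex.conj_conj]
  ring

section prox
variable {φ : ℂ → ℝ} {X : ℂ → ℂ} (hX : ∀ ζ, IsSubgrad φ (X ζ) (ζ - X ζ))
include hX

lemma lipschitz_cayley : LipschitzWith 1 (cayley X) := by
  refine LipschitzWith.of_dist_le_mul fun z z' => ?_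
  rw [dist_eq_norm, dist_eq_norm, NNReal.coe_one, one_mul, cayley, cayley, ← map_sub,
    RCLike.norm_conj]
  exact norm_reflection_sub_le hX z z'

/-- Where the resolvent and its dual have the same Jacobian, the Cayley transform is complex
differentiable: this is the Monge–Ampère equation in Cayley-transformed form. -/
lemma differentiableAt_cayley_of_jac_eq {z : ℂ} (hd : DifferentiableAt ℝ X z)
    (h : jac X z = jac (fun ζ => ζ - X ζ) z) : DifferentiableAt ℂ (cayley X) z := by
  set A := fderiv ℝ X z with hA
  have hP : HasFDerivAt (fun ζ => ζ - X ζ) (ContinuousLinearMap.id ℝ ℂ - A) z :=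
    (hasFDerivAt_id z).sub hd.hasFDerivAt
  have hG : HasFDerivAt (cayley X)
      ((Complex.conjCLE : ℂ →L[ℝ] ℂ) ∘L (A - (ContinuousLinearMap.id ℝ ℂ - A))) z :=
    (Complex.conjCLE : ℂ →L[ℝ] ℂ).hasFDerivAt.comp z (hd.hasFDerivAt.sub hP)
  have hnorm : ∀ v, ‖A v - (v - A v)‖ ≤ ‖v‖ := by
    intro v
    have h1 := norm_fderiv_le_of_lipschitz ℝ (x₀ := z) (lipschitz_cayley hX)
    rw [hG.fderiv] at h1
    have h2 := ContinuousLinearMap.le_of_opNorm_le _ h1 v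
    rw [ContinuousLinearMap.comp_apply, ContinuousLinearEquiv.coe_coe, Complex.conjCLE_apply,
      RCLike.norm_conj] at h2
    simpa using h2
  have hs : (A 1).im = (A Complex.I).re := by
    have := symm_of_hasFDerivAt hX hP 1 Complex.I
    simp only [Complex.inner, sub_apply, ContinuousLinearMap.id_apply] at this
    simpa using this
  have hdet : |A.det| = |(ContinuousLinearMap.id ℝ ℂ - A).det| := by
    rw [jac, jac, hP.fderiv, ← hA] at h
    exact (ENNReal.ofReal_eq_ofReal_iff (abs_nonneg _) (abs_nonneg _)).1 h
  have ht := trace_eq_one_of_abs_det_eq hs hnorm hdet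
  rw [differentiableAt_complex_iff_differentiableAt_real]
  refine ⟨hG.differentiableAt, ?_⟩
  rw [hG.fderiv]
  apply Complex.ext
  · simp
    linarith
  · simp
    linarith

end prox

/-- A subgradient at a point of differentiability is the gradient. -/
lemma IsSubgrad.hasFDerivAt {φ : ℂ → ℝ} {x p : ℂ} (h : IsSubgrad φ x p)
    (hd : DifferentiableAt ℝ φ x) : HasFDerivAt φ (innerSL ℝ p) x := by
  have h1 : IsLocalMin (fun y => φ y - innerSL ℝ p (y - x)) x := by
    refine Filter.Eventually.of_forall fun y => ?_
    have := h y
    simp only [innerSL_apply_apply, sub_self, inner_zero_right]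
    linarith
  have h2 : HasFDerivAt (fun y => φ y - innerSL ℝ p (y - x)) (fderiv ℝ φ x - innerSL ℝ p) x :=
    hd.hasFDerivAt.sub (HasFDerivAt.comp (g := innerSL ℝ p) (f := fun y => y - x) x
      (innerSL ℝ p).hasFDerivAt ((hasFDerivAt_id x).sub_const x))
  have h3 := h1.hasFDerivAt_eq_zero h2
  rw [← sub_eq_zero.1 h3]
  exact hd.hasFDerivAt

lemma IsSubgrad.gradient_eq {φ : ℂ → ℝ} {x p : ℂ} (h : IsSubgrad φ x p)
    (hd : DifferentiableAt ℝ φ x) : gradient φ x = p := by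
  rw [gradient, (h.hasFDerivAt hd).fderiv]
  exact (InnerProductSpace.toDual ℝ ℂ).symm_apply_apply p

/-- A convex potential whose gradient transports the uniform measure of `U` to that of `V`. -/
structure TransportPotential (φ : ℂ → ℝ) (U V : Set ℂ) : Prop where
  convex : ConvexOn ℝ univ φ
  subgrad_mem : ∀ x p, IsSubgrad φ x p → p ∈ closure V
  map_eq : Measure.map (gradient φ) (volume.restrict U) = volume.restrict V
  openU : IsOpen U
  openV : IsOpen V
  convexU : Convex ℝ U
  convexV : Convex ℝ V
  bddU : Bornology.IsBounded U
  bddV : Bornology.IsBounded V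
  volU : volume U = 1
  volV : volume V = 1

namespace TransportPotential
variable {φ : ℂ → ℝ} {U V : Set ℂ} (h : TransportPotential φ U V)
include h

lemma aemeasurable_gradient : AEMeasurable (gradient φ) (volume.restrict U) := by
  by_contra hn
  have h1 := h.map_eq
  rw [Measure.map_of_not_aemeasurable hn] at h1
  have h2 : (volume.restrict V) univ = 1 := by rw [Measure.restrict_apply_univ, h.volV]
  rw [← h1] at h2
  simp at h2

lemma volume_diff_differentiableAt : volume (U \ {x | DifferentiableAt ℝ φ x}) = 0 := by
  have h1 : volume.restrict U (gradient φ ⁻¹' {0}) = 0 := by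
    rw [← Measure.map_apply_of_aemeasurable h.aemeasurable_gradient (measurableSet_singleton 0),
      h.map_eq]
    exact Measure.restrict_le_self.absolutelyContinuous (measure_singleton 0)
  refine measure_mono_null ?_ (le_antisymm ((Measure.le_restrict_apply U _).trans_eq h1) bot_le)
  rintro x ⟨hxU, hx⟩
  refine ⟨?_, hxU⟩
  rw [mem_preimage, mem_singleton_iff, gradient, fderiv_zero_of_not_differentiableAt hx, map_zero]

lemma volume_le_volume_gradient_image {S : Set ℂ} (hS : S ⊆ U) :
    volume S ≤ volume (gradient φ '' S) := by
  rw [← measure_toMeasurable (gradient φ '' S)]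
  set T := toMeasurable volume (gradient φ '' S)
  calc volume S ≤ volume (gradient φ ⁻¹' T ∩ U) := measure_mono fun x hx =>
        ⟨subset_toMeasurable _ _ (mem_image_of_mem _ hx), hS hx⟩
    _ ≤ volume.restrict U (gradient φ ⁻¹' T) := Measure.le_restrict_apply _ _
    _ = volume.restrict V T := by
        rw [← Measure.map_apply_of_aemeasurable h.aemeasurable_gradient
          (measurableSet_toMeasurable _ _), h.map_eq]
    _ ≤ volume T := Measure.restrict_le_self T

lemma volume_closureV : volume (closure V) = 1 := by
  rw [← h.volV]
  refine le_antisymm ?_ (measure_mono subset_closure)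
  calc volume (closure V) ≤ volume (V ∪ frontier V) := measure_mono (by
        rw [closure_eq_self_union_frontier])
    _ ≤ volume V + volume (frontier V) := measure_union_le _ _
    _ = volume V := by rw [h.convexV.addHaar_frontier volume, add_zero]

lemma exists_resolvent : ∃ X : ℂ → ℂ, ∀ ζ, IsSubgrad φ (X ζ) (ζ - X ζ) := by
  have h1 : (U ∩ {x | DifferentiableAt ℝ φ x}).Nonempty := by
    by_contra hne
    rw [not_nonempty_iff_eq_empty] at hne
    have h2 := h.volume_diff_differentiableAt
    rw [← sdiff_self_inter, hne, sdiff_empty, h.volU] at h2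
    exact one_ne_zero h2
  obtain ⟨x₀, -, hx₀⟩ := h1
  have h3 : IsSubgrad φ x₀ (gradient φ x₀) :=
    isSubgrad_of_hasFDerivAt h.convex hx₀.hasGradientAt.hasFDerivAt
  choose X hX using exists_prox h.convex h3
  exact ⟨X, hX⟩

variable {X : ℂ → ℂ} (hX : ∀ ζ, IsSubgrad φ (X ζ) (ζ - X ζ))
include hX

lemma dual_mem_closure (ζ : ℂ) : ζ - X ζ ∈ closure V := h.subgrad_mem _ _ (hX ζ)

/-- The Jacobians of the resolvent and its dual agree almost everywhere over `U`, and the dual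
image of the preimage of `U` has full measure. -/
lemma jac_eq_ae :
    (∀ᵐ z, z ∈ X ⁻¹' U → jac X z = jac (fun ζ => ζ - X ζ) z) ∧
      1 ≤ volume ((fun ζ => ζ - X ζ) '' (X ⁻¹' U)) ∧ volume (U \ X '' (X ⁻¹' U)) = 0 := by
  have hc : Continuous X := (lipschitz_prox hX).continuous
  set P : ℂ → ℂ := fun ζ => ζ - X ζ with hP
  set W := U ∩ {x | DifferentiableAt ℝ φ x} with hW
  have hWm : MeasurableSet W := h.openU.measurableSet.inter (measurableSet_of_differentiableAt ℝ φ)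
  have hΩ : MeasurableSet (X ⁻¹' U) := (h.openU.preimage hc).measurableSet
  have hΩ' : MeasurableSet (X ⁻¹' W) := hc.measurable hWm
  have hsub : X ⁻¹' W ⊆ X ⁻¹' U := preimage_mono inter_subset_left
  have hgrad : ∀ z ∈ X ⁻¹' W, gradient φ (X z) = P z := fun z hz => (hX z).gradient_eq hz.2
  have hle : ∀ S ⊆ X ⁻¹' W, MeasurableSet S → ∫⁻ z in S, jac X z ≤ ∫⁻ z in S, jac P z := by
    intro S hS hSm
    rw [lintegral_jac_prox hX hSm, lintegral_jac_dual_prox hX h.convex hSm]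
    have h1 : P '' S = gradient φ '' (X '' S) := by
      rw [image_image]
      exact image_congr fun z hz => (hgrad z (hS hz)).symm
    rw [h1]
    exact h.volume_le_volume_gradient_image
      (image_subset_iff.2 (hS.trans hsub))
  have hWimg : X '' (X ⁻¹' W) = W := by
    refine image_preimage_eq_of_subset ?_
    rintro x ⟨-, hx⟩
    have h3 : IsSubgrad φ x (gradient φ x) :=
      isSubgrad_of_hasFDerivAt h.convex hx.hasGradientAt.hasFDerivAt
    exact ⟨_, prox_eq hX h3⟩
  have hnull : volume (U \ W) = 0 := by
    rw [hW, sdiff_self_inter]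
    exact h.volume_diff_differentiableAt
  have hvolW : volume W = 1 := by
    rw [← h.volU, ← measure_inter_add_sdiff U hWm, hnull, add_zero, hW, ← inter_assoc, inter_self]
  have hX1 : ∫⁻ z in X ⁻¹' W, jac X z = 1 := by rw [lintegral_jac_prox hX hΩ', hWimg, hvolW]
  have hXU : ∫⁻ z in X ⁻¹' U, jac X z ≤ 1 := by
    rw [lintegral_jac_prox hX hΩ, ← h.volU]
    exact measure_mono (image_preimage_subset _ _)
  have hPU : ∫⁻ z in X ⁻¹' U, jac P z ≤ 1 := by
    rw [lintegral_jac_dual_prox hX h.convex hΩ, ← h.volume_closureV]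
    refine measure_mono ?_
    rintro _ ⟨z, -, rfl⟩
    exact h.dual_mem_closure hX z
  have hPW : 1 ≤ ∫⁻ z in X ⁻¹' W, jac P z := hX1 ▸ hle _ subset_rfl hΩ'
  have hzero : ∀ f : ℂ → ENNReal, Measurable f → ∫⁻ z in X ⁻¹' U, f z ≤ 1 →
      1 ≤ ∫⁻ z in X ⁻¹' W, f z → ∀ᵐ z, z ∈ X ⁻¹' U \ X ⁻¹' W → f z = 0 := by
    intro f hf h1 h2
    have h3 := lintegral_inter_add_sdiff (μ := volume) f (X ⁻¹' U) hΩ'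
    rw [inter_eq_self_of_subset_right hsub] at h3
    have h4 : ∫⁻ z in X ⁻¹' U \ X ⁻¹' W, f z = 0 := by
      have h5 : 1 + ∫⁻ z in X ⁻¹' U \ X ⁻¹' W, f z ≤ 1 + 0 := by
        rw [add_zero]
        exact (add_le_add_left h2 _).trans (h3.le.trans h1)
      exact le_antisymm ((ENNReal.add_le_add_iff_left ENNReal.one_ne_top).1 h5) bot_le
    rw [lintegral_eq_zero_iff hf] at h4
    exact (ae_restrict_iff' (hΩ.diff hΩ')).1 h4
  have hae : jac X =ᵐ[volume.restrict (X ⁻¹' W)] jac P := by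
    refine ae_eq_of_ae_le_of_lintegral_le ?_ (by rw [hX1]; exact ENNReal.one_ne_top)
      (measurable_jac P).aemeasurable ?_
    · refine ae_le_of_forall_setLIntegral_le_of_sigmaFinite (measurable_jac X) fun S hS _ => ?_
      rw [Measure.restrict_restrict hS]
      exact hle _ inter_subset_right (hS.inter hΩ')
    · rw [hX1]
      exact (lintegral_mono_set hsub).trans hPU
  refine ⟨?_, ?_, ?_⟩
  · filter_upwards [(ae_restrict_iff' hΩ').1 hae, hzero _ (measurable_jac X) hXU hX1.ge,
      hzero _ (measurable_jac P) hPU hPW] with z h1 h2 h3 hz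
    by_cases hzW : z ∈ X ⁻¹' W
    · exact h1 hzW
    · rw [h2 ⟨hz, hzW⟩, h3 ⟨hz, hzW⟩]
  · rw [← lintegral_jac_dual_prox hX h.convex hΩ]
    exact hPW.trans (lintegral_mono_set hsub)
  · refine measure_mono_null (sdiff_subset_sdiff_right ?_) hnull
    rw [← hWimg]
    exact image_mono hsub

lemma differentiableOn_cayley : DifferentiableOn ℂ (cayley X) (X ⁻¹' U) := by
  refine differentiableOn_of_ae_differentiableAt (lipschitz_cayley hX)
    (h.openU.preimage (lipschitz_prox hX).continuous) ?_
  filter_upwards [(h.jac_eq_ae hX).1, (lipschitz_prox hX).ae_differentiableAt] with z h1 h2 hz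
  exact differentiableAt_cayley_of_jac_eq hX h2 (h1 hz)

end TransportPotential

end PlanarOT

namespace PlanarOT

open scoped ComplexConjugate

namespace TransportPotential
variable {φ : ℂ → ℝ} {U V : Set ℂ} (h : TransportPotential φ U V)
  {X : ℂ → ℂ} (hX : ∀ ζ, IsSubgrad φ (X ζ) (ζ - X ζ))
include h hX

lemma isOpen_preimage : IsOpen (X ⁻¹' U) := h.openU.preimage (lipschitz_prox hX).continuous

lemma isBounded_preimage : Bornology.IsBounded (X ⁻¹' U) := by
  refine (h.bddU.add h.bddV.closure).subset fun ζ hζ => ?_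
  exact ⟨X ζ, hζ, ζ - X ζ, h.dual_mem_closure hX ζ, by simp⟩

lemma norm_deriv_cayley_lt {z : ℂ} (hz : z ∈ X ⁻¹' U) : ‖deriv (cayley X) z‖ < 1 := by
  refine lt_of_le_of_ne (norm_deriv_le_one (lipschitz_cayley hX) z) fun h1 => ?_
  have hsub : connectedComponentIn (X ⁻¹' U) z ⊆ X ⁻¹' U := connectedComponentIn_subset _ _
  obtain ⟨μ, hμ, hline⟩ := exists_line_of_norm_deriv_eq (O := U) (lipschitz_cayley hX)
    (h.isOpen_preimage hX).connectedComponentIn isPreconnected_connectedComponentIn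
    ((h.differentiableOn_cayley hX).mono hsub)
    (fun y hy => by rw [xMap_cayley]; exact hsub hy)
    (fun y hy hyU => mem_connectedComponentIn_of_mem_closure hz
      (by rw [xMap_cayley] at hyU; exact hyU) hy)
    (mem_connectedComponentIn hz) h1
  obtain ⟨R, hR⟩ := (h.isBounded_preimage hX).exists_norm_le
  have hR0 : 0 ≤ R := (norm_nonneg z).trans (hR z hz)
  have h2 := hR _ (hsub (hline (2 * R + 1)).1)
  have h3 : ‖((2 * R + 1 : ℝ) : ℂ) * (μ * Complex.I)‖ = 2 * R + 1 := by
    rw [norm_mul, norm_mul, hμ, Complex.norm_I, Complex.norm_real,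
      Real.norm_of_nonneg (by positivity)]
    ring
  have h4 := norm_sub_le (z + ((2 * R + 1 : ℝ) : ℂ) * (μ * Complex.I)) z
  rw [add_sub_cancel_left, h3] at h4
  linarith [hR z hz]

lemma eventually_differentiableAt_cayley {z : ℂ} (hz : z ∈ X ⁻¹' U) :
    ∀ᶠ y in nhds z, DifferentiableAt ℂ (cayley X) y := by
  filter_upwards [(h.isOpen_preimage hX).mem_nhds hz] with y hy
  exact (h.differentiableOn_cayley hX).differentiableAt ((h.isOpen_preimage hX).mem_nhds hy)

lemma eq_of_dual_eq {z z' : ℂ} (hz : z ∈ X ⁻¹' U) (heq : z - X z = z' - X z') : z' = z := by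
  by_contra hne
  have h1 := strict_of_norm_deriv_lt (lipschitz_cayley hX)
    (h.eventually_differentiableAt_cayley hX hz).self_of_nhds (h.norm_deriv_cayley_lt hX hz) hne
  rw [cayley, cayley, heq, ← map_sub, RCLike.norm_conj] at h1
  refine h1.ne (congrArg _ ?_)
  linear_combination -heq

lemma dual_mem {z : ℂ} (hz : z ∈ X ⁻¹' U) : z - X z ∈ V := by
  have hVne : (interior V).Nonempty := by
    rw [h.openV.interior_eq]
    exact nonempty_of_measure_ne_zero (μ := volume) (by rw [h.volV]; exact one_ne_zero)
  rw [← h.openV.interior_eq,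
    ← h.convexV.interior_closure_eq_interior_of_nonempty_interior hVne, mem_interior_iff_mem_nhds]
  have h1 := map_nhds_pMap (h.eventually_differentiableAt_cayley hX hz)
    (h.norm_deriv_cayley_lt hX hz)
  rw [pMap_cayley] at h1
  rw [← h1, Filter.mem_map]
  exact Filter.Eventually.of_forall (h.dual_mem_closure hX)

lemma volume_diff_dual_image : volume (V \ (fun ζ => ζ - X ζ) '' (X ⁻¹' U)) = 0 := by
  set P : ℂ → ℂ := fun ζ => ζ - X ζ with hP
  have hopen : IsOpen (P '' (X ⁻¹' U)) := by
    rw [isOpen_iff_mem_nhds]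
    rintro _ ⟨z, hz, rfl⟩
    have h1 := map_nhds_pMap (h.eventually_differentiableAt_cayley hX hz)
      (h.norm_deriv_cayley_lt hX hz)
    rw [pMap_cayley] at h1
    rw [hP, ← h1]
    exact Filter.image_mem_map ((h.isOpen_preimage hX).mem_nhds hz)
  have hsub : P '' (X ⁻¹' U) ⊆ V := image_subset_iff.2 fun z hz => h.dual_mem hX hz
  rw [measure_sdiff hsub hopen.measurableSet.nullMeasurableSet
    ((measure_mono hsub).trans_lt (by rw [h.volV]; exact ENNReal.one_lt_top)).ne, h.volV]
  exact tsub_eq_zero_of_le (h.jac_eq_ae hX).2.1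

lemma subset_image_closure : U ⊆ X '' closure (X ⁻¹' U) := by
  have hK : IsCompact (X '' closure (X ⁻¹' U)) :=
    (h.isBounded_preimage hX).isCompact_closure.image (lipschitz_prox hX).continuous
  rw [← sdiff_eq_empty, ← (h.openU.sdiff hK.isClosed).measure_eq_zero_iff (μ := volume)]
  exact measure_mono_null (sdiff_subset_sdiff_right (image_mono subset_closure))
    (h.jac_eq_ae hX).2.2

lemma subset_dual_image_closure : V ⊆ (fun ζ => ζ - X ζ) '' closure (X ⁻¹' U) := by
  have hK : IsCompact ((fun ζ => ζ - X ζ) '' closure (X ⁻¹' U)) :=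
    (h.isBounded_preimage hX).isCompact_closure.image (lipschitz_dual_prox hX).continuous
  rw [← sdiff_eq_empty, ← (h.openV.sdiff hK.isClosed).measure_eq_zero_iff (μ := volume)]
  exact measure_mono_null (sdiff_subset_sdiff_right (image_mono subset_closure))
    (h.volume_diff_dual_image hX)

lemma mem_closure_of_dual_mem {ζ : ℂ} (hζ : ζ - X ζ ∈ V) : X ζ ∈ closure U := by
  by_contra hn
  obtain ⟨f, u, hf, hu⟩ := geometric_hahn_banach_closed_point h.convexU.closure isClosed_closure hn
  set c : ℂ := (InnerProductSpace.toDual ℝ ℂ).symm f with hc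
  have hfc : ∀ y, f y = ⟪c, y⟫ := fun y => (InnerProductSpace.toDual_symm_apply).symm
  have h1 : ∀ᶠ t : ℝ in nhdsWithin 0 (Ioi 0), ζ - X ζ + t • c ∈ V := by
    have h2 : Continuous fun t : ℝ => ζ - X ζ + t • c := by fun_prop
    have h3 := h2.tendsto 0
    simp only [zero_smul, add_zero] at h3
    exact (h3.mono_left nhdsWithin_le_nhds).eventually_mem (h.openV.mem_nhds hζ)
  obtain ⟨t, htV, ht⟩ := (h1.and self_mem_nhdsWithin).exists
  obtain ⟨z, hz, hPz⟩ := h.subset_dual_image_closure hX htV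
  have h4 := (hX z).monotone (hX ζ)
  have h5 : X z ∈ closure U := (lipschitz_prox hX).continuous.closure_preimage_subset _ hz
  have hPz' : z - X z = ζ - X ζ + t • c := hPz
  rw [hPz', add_sub_cancel_left, inner_smul_left, ← hfc, map_sub] at h4
  have h6 := hf _ h5
  have h7 := mul_neg_of_pos_of_neg (mem_Ioi.1 ht) (sub_neg.2 (h6.trans hu))
  exact absurd h4 (not_le.2 h7)

lemma differentiableOn_cayley_dual :
    DifferentiableOn ℂ (cayley X) ((fun ζ => ζ - X ζ) ⁻¹' V) := by
  set P : ℂ → ℂ := fun ζ => ζ - X ζ with hP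
  have hO : IsOpen (P ⁻¹' V) := h.openV.preimage (lipschitz_dual_prox hX).continuous
  have hm : MeasurableSet (P ⁻¹' V \ X ⁻¹' U) :=
    hO.measurableSet.diff (h.isOpen_preimage hX).measurableSet
  refine differentiableOn_of_ae_differentiableAt (lipschitz_cayley hX) hO ?_
  have e1 : ∫⁻ z in P ⁻¹' V \ X ⁻¹' U, jac X z = 0 := by
    rw [lintegral_jac_prox hX hm]
    refine measure_mono_null ?_ (h.convexU.addHaar_frontier volume)
    rintro _ ⟨z, ⟨hz, hz'⟩, rfl⟩
    rw [h.openU.frontier_eq]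
    exact ⟨h.mem_closure_of_dual_mem hX hz, hz'⟩
  have e2 : ∫⁻ z in P ⁻¹' V \ X ⁻¹' U, jac P z = 0 := by
    rw [lintegral_jac_dual_prox hX h.convex hm]
    refine measure_mono_null ?_ (h.volume_diff_dual_image hX)
    rintro _ ⟨z, ⟨hz, hz'⟩, rfl⟩
    refine ⟨hz, ?_⟩
    rintro ⟨y, hy, hyz⟩
    rw [h.eq_of_dual_eq hX hy hyz] at hz'
    exact hz' hy
  rw [lintegral_eq_zero_iff (measurable_jac _)] at e1 e2
  filter_upwards [(h.jac_eq_ae hX).1, (ae_restrict_iff' hm).1 e1, (ae_restrict_iff' hm).1 e2,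
    (lipschitz_prox hX).ae_differentiableAt] with z h1 h2 h3 h4 hz
  refine differentiableAt_cayley_of_jac_eq hX h4 ?_
  by_cases hzU : z ∈ X ⁻¹' U
  · exact h1 hzU
  · exact (h2 ⟨hz, hzU⟩).trans (h3 ⟨hz, hzU⟩).symm

lemma mem_of_dual_mem {ζ : ℂ} (hζ : ζ - X ζ ∈ V) : X ζ ∈ U := by
  obtain ⟨z, hz, hzζ⟩ := h.subset_dual_image_closure hX hζ
  have hzζ' : z - X z = ζ - X ζ := hzζ
  have hO : IsOpen ((fun ζ => ζ - X ζ) ⁻¹' V) :=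
    h.openV.preimage (lipschitz_dual_prox hX).continuous
  have hzO : z ∈ (fun ζ => ζ - X ζ) ⁻¹' V := by
    rw [mem_preimage, hzζ']
    exact hζ
  suffices hzU : z ∈ X ⁻¹' U by rwa [h.eq_of_dual_eq hX hzU hzζ']
  by_contra hn
  obtain ⟨f, hf⟩ := geometric_hahn_banach_open_point h.convexU h.openU hn
  have hle : ∀ y ∈ closure U, f y ≤ f (X z) := fun y hy =>
    closure_minimal (t := {y | f y ≤ f (X z)}) (fun y hy => (hf y hy).le)
      (isClosed_le f.continuous continuous_const) hy
  have h1 := eventually_eq_of_isLocalMax_xMap (G := cayley X) (z₀ := z)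
    (by
      filter_upwards [hO.mem_nhds hzO] with y hy
      exact (h.differentiableOn_cayley_dual hX).differentiableAt (hO.mem_nhds hy)) f
    (by
      filter_upwards [hO.mem_nhds hzO] with y hy
      rw [xMap_cayley]
      exact hle _ (h.mem_closure_of_dual_mem hX hy))
  rw [xMap_cayley] at h1
  obtain ⟨y, hy, hyU⟩ := mem_closure_iff_nhds.1 hz _ h1
  exact (hf _ hyU).ne hy

theorem transportSystem : TransportSystem (cayley X) U V where
  lip := lipschitz_cayley hX
  openU := h.openU
  openV := h.openV
  convexU := h.convexU
  convexV := h.convexV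
  preimage_eq := by
    rw [xMap_cayley, pMap_cayley]
    ext z
    exact ⟨fun hz => h.dual_mem hX hz, fun hz => h.mem_of_dual_mem hX hz⟩
  diff := by
    rw [xMap_cayley]
    exact h.differentiableOn_cayley hX
  surjX := by
    rw [xMap_cayley]
    exact (h.subset_image_closure hX).trans (image_subset_range _ _)
  surjP := by
    rw [pMap_cayley]
    exact (h.subset_dual_image_closure hX).trans (image_subset_range _ _)

end TransportPotential

end PlanarOT

namespace PlanarOT

open scoped ComplexConjugate

namespace TransportPotential
variable {φ : ℂ → ℝ} {U V : Set ℂ} (h : TransportPotential φ U V)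
  {X : ℂ → ℂ} (hX : ∀ ζ, IsSubgrad φ (X ζ) (ζ - X ζ))
include h hX

/-- The resolvent is strictly differentiable over `U`, with invertible derivative. -/
lemma exists_hasStrictFDerivAt {z : ℂ} (hz : z ∈ X ⁻¹' U) :
    ∃ A : ℂ ≃L[ℝ] ℂ, HasStrictFDerivAt X (A : ℂ →L[ℝ] ℂ) z ∧
      (∀ v, (1 - ‖deriv (cayley X) z‖) / 2 * ‖v‖ ≤ ‖A v‖) ∧
      ∀ v, ‖v - A v‖ ≤ (1 + ‖deriv (cayley X) z‖) / 2 * ‖v‖ := by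
  set g := deriv (cayley X) z with hg
  have hlt := h.norm_deriv_cayley_lt hX hz
  rw [← hg] at hlt
  have hs : HasStrictDerivAt (cayley X) g z :=
    AnalyticAt.hasStrictDerivAt ((h.differentiableOn_cayley hX).analyticAt
      ((h.isOpen_preimage hX).mem_nhds hz))
  have h1 := hs.hasStrictFDerivAt.restrictScalars ℝ
  have h2 := (Complex.conjCLE.toContinuousLinearMap.hasStrictFDerivAt (x := cayley X z)).comp z h1
  have h3 := ((hasStrictFDerivAt_id (𝕜 := ℝ) z).add h2).const_smul (2⁻¹ : ℝ)
  have h4 : (2⁻¹ : ℝ) • (id + fun y => (Complex.conjCLE : ℂ →L[ℝ] ℂ) (cayley X y)) = X := by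
    funext y
    nth_rw 2 [← xMap_cayley X]
    rw [xMap_eq]
    simp
    ring
  rw [h4] at h3
  set A := (2⁻¹ : ℝ) • (ContinuousLinearMap.id ℝ ℂ + (Complex.conjCLE : ℂ →L[ℝ] ℂ) ∘L
    ((ContinuousLinearMap.toSpanSingleton ℂ g).restrictScalars ℝ)) with hA
  have hAv : ∀ v, A v = (v + conj (v * g)) / 2 := by
    intro v
    simp [hA]
    ring
  have hgv : ∀ v, ‖conj (v * g)‖ = ‖g‖ * ‖v‖ := fun v => by
    rw [RCLike.norm_conj, norm_mul, mul_comm]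
  have hlow : ∀ v, (1 - ‖g‖) / 2 * ‖v‖ ≤ ‖A v‖ := by
    intro v
    rw [hAv, norm_div, Complex.norm_ofNat]
    have h6 : ‖v‖ - ‖conj (v * g)‖ ≤ ‖v + conj (v * g)‖ := by
      simpa using norm_sub_norm_le v (-conj (v * g))
    rw [hgv] at h6
    linarith
  have hinj : Function.Injective A := by
    rw [injective_iff_map_eq_zero]
    intro v hv
    have := hlow v
    rw [hv, norm_zero] at this
    refine norm_le_zero_iff.1 ?_
    have h7 : 0 < (1 - ‖g‖) / 2 := by linarith
    exact nonpos_of_mul_nonpos_right this h7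
  set A' : ℂ ≃L[ℝ] ℂ := (LinearEquiv.ofInjectiveEndo (A : ℂ →ₗ[ℝ] ℂ) hinj).toContinuousLinearEquiv
  have hA' : (A' : ℂ →L[ℝ] ℂ) = A := by
    ext <;> rfl
  have hA'v : ∀ v, A' v = A v := fun v => rfl
  refine ⟨A', ?_, fun v => ?_, fun v => ?_⟩
  · rw [hA']
    exact h3
  · exact hlow v
  · rw [hA'v, hAv, show v - (v + conj (v * g)) / 2 = (v - conj (v * g)) / 2 by ring, norm_div,
      Complex.norm_ofNat]
    have := norm_sub_le v (conj (v * g))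
    rw [hgv] at this
    linarith

lemma hasFDerivAt_resolvent {z : ℂ} (hz : z ∈ X ⁻¹' U) :
    HasFDerivAt φ (innerSL ℝ (z - X z)) (X z) := by
  obtain ⟨A, hA, -⟩ := h.exists_hasStrictFDerivAt hX hz
  set Y := hA.localInverse X A z
  have hY : Filter.Tendsto (fun x => Y x - X (Y x)) (nhds (X z)) (nhds (z - X z)) := by
    have h1 : Filter.Tendsto Y (nhds (X z)) (nhds z) := hA.localInverse_tendsto
    exact ((lipschitz_dual_prox hX).continuous.tendsto z).comp h1
  rw [hasFDerivAt_iff_isLittleO, Asymptotics.isLittleO_iff]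
  intro c hc
  filter_upwards [hA.eventually_right_inverse, hY.eventually (closedBall_mem_nhds _ hc)]
    with x hx hxc
  have h2 := hX z x
  have h3 := hX (Y x) (X z)
  have hx' : X (Y x) = x := hx
  rw [dist_eq_norm] at hxc
  rw [hx'] at hxc h3
  have h4 : ⟪Y x - x, X z - x⟫ = -⟪Y x - x, x - X z⟫ := by rw [← inner_neg_right, neg_sub]
  have h5 := real_inner_le_norm (Y x - x - (z - X z)) (x - X z)
  rw [inner_sub_left] at h5
  have h6 := mul_le_mul_of_nonneg_right hxc (norm_nonneg (x - X z))
  rw [innerSL_apply_apply, Real.norm_eq_abs, abs_of_nonneg (by linarith)]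
  linarith

theorem hessian_bound {z : ℂ} (hz : z ∈ X ⁻¹' U) :
    DifferentiableAt ℝ (fderiv ℝ φ) (X z) ∧
      ‖fderiv ℝ (fderiv ℝ φ) (X z)‖ * (1 - ‖deriv (cayley X) z‖) ≤
        1 + ‖deriv (cayley X) z‖ := by
  obtain ⟨A, hA, hlow, hup⟩ := h.exists_hasStrictFDerivAt hX hz
  have hlt := h.norm_deriv_cayley_lt hX hz
  set g := ‖deriv (cayley X) z‖ with hg
  set Y := hA.localInverse X A z with hYdef
  have hYz : Y (X z) = z := hA.localInverse_apply_image
  have hYd : HasFDerivAt Y (A.symm : ℂ →L[ℝ] ℂ) (X z) := hA.to_localInverse.hasFDerivAt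
  have hP : HasFDerivAt (fun ζ => ζ - X ζ) (ContinuousLinearMap.id ℝ ℂ - (A : ℂ →L[ℝ] ℂ))
      (Y (X z)) := by
    rw [hYz]
    exact (hasFDerivAt_id z).sub hA.hasFDerivAt
  have hD : HasFDerivAt (fun x => innerSL ℝ (Y x - X (Y x)))
      ((innerSL ℝ : ℂ →L[ℝ] ℂ →L[ℝ] ℝ) ∘L ((ContinuousLinearMap.id ℝ ℂ - (A : ℂ →L[ℝ] ℂ)) ∘L
        (A.symm : ℂ →L[ℝ] ℂ))) (X z) :=
    (innerSL ℝ : ℂ →L[ℝ] ℂ →L[ℝ] ℝ).hasFDerivAt.comp (X z) (hP.comp (X z) hYd)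
  have hev : fderiv ℝ φ =ᶠ[nhds (X z)] fun x => innerSL ℝ (Y x - X (Y x)) := by
    have h1 : Filter.Tendsto Y (nhds (X z)) (nhds z) := hA.localInverse_tendsto
    filter_upwards [hA.eventually_right_inverse,
      h1.eventually_mem ((h.isOpen_preimage hX).mem_nhds hz)] with x hx hxΩ
    have h2 := (h.hasFDerivAt_resolvent hX hxΩ).fderiv
    rwa [show X (Y x) = x from hx] at h2 ⊢
  have hF := hD.congr_of_eventuallyEq hev
  refine ⟨hF.differentiableAt, ?_⟩
  rw [hF.fderiv, ← le_div_iff₀ (by linarith)]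
  refine ContinuousLinearMap.opNorm_le_bound _
    (div_nonneg (by positivity) (by linarith)) fun v => ?_
  have h1 := hlow (A.symm v)
  have h2 := hup (A.symm v)
  rw [A.apply_symm_apply] at h1 h2
  have h3 : ‖((innerSL ℝ : ℂ →L[ℝ] ℂ →L[ℝ] ℝ) ∘L
      ((ContinuousLinearMap.id ℝ ℂ - (A : ℂ →L[ℝ] ℂ)) ∘L (A.symm : ℂ →L[ℝ] ℂ))) v‖ =
      ‖A.symm v - v‖ := by
    rw [ContinuousLinearMap.comp_apply, innerSL_apply_norm]
    simp
  rw [h3, div_mul_eq_mul_div, le_div_iff₀ (by linarith)]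
  nlinarith [mul_le_mul_of_nonneg_right h2 (by linarith : 0 ≤ 1 - g),
    mul_le_mul_of_nonneg_left h1 (by positivity : 0 ≤ 1 + g)]

end TransportPotential

/-- The Hessian of a potential between planar convex domains of area one blows up slower than any
negative power of the distance to the boundary. -/
theorem exists_hessian_constant {ε d : ℝ} (hε : 0 < ε) (hd : 1 ≤ d) : ∃ C > 0, ∀ φ U V,
    TransportPotential φ U V → diam U ≤ d → diam V ≤ d → ∀ x r, 0 < r → ball x r ⊆ U →
      DifferentiableAt ℝ φ x ∧ DifferentiableAt ℝ (fderiv ℝ φ) x ∧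
        ‖fderiv ℝ (fderiv ℝ φ) x‖ ≤ C * r ^ (-ε) := by
  obtain ⟨C, hC, hdil⟩ := exists_dilatation_constant hε hd
  refine ⟨C, hC, fun φ U V h hU hV x r hr hball => ?_⟩
  obtain ⟨X, hX⟩ := h.exists_resolvent
  have hS := h.transportSystem hX
  have hx : x ∈ U := hball (mem_ball_self hr)
  obtain ⟨z, rfl⟩ := hS.surjX hx
  have hunit : UnitSystem d (cayley X) U V :=
    { toTransportSystem := hS, volU := h.volU, volV := h.volV, bddU := h.bddU, bddV := h.bddV,
      diamU := hU, diamV := hV }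
  have hzU : z ∈ X ⁻¹' U := by rwa [xMap_cayley] at hx
  have hlt := h.norm_deriv_cayley_lt hX hzU
  have h1 := hdil _ _ _ hunit z hx hlt r hr hball
  have h2 := h.hessian_bound hX hzU
  rw [xMap_cayley]
  refine ⟨(h.hasFDerivAt_resolvent hX hzU).differentiableAt, h2.1, ?_⟩
  exact le_of_mul_le_mul_right (h2.2.trans h1) (by linarith)

end PlanarOT

namespace PlanarOT

lemma ball_infDist_frontier_subset {U : Set R2} (hU : IsOpen U) {x : R2} (hx : x ∈ U) :
    ball x (infDist x (frontier U)) ⊆ U := by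
  rcases (infDist_nonneg (x := x) (s := frontier U)).eq_or_lt with h0 | h0
  · rw [← h0, ball_zero]
    exact empty_subset _
  refine (convex_ball x _).isPreconnected.subset_left_of_subset_union hU
    isClosed_closure.isOpen_compl
    (disjoint_compl_right.mono_left subset_closure) (fun y hy => ?_) ⟨x, mem_ball_self h0, hx⟩
  by_contra hn
  rw [mem_union, mem_compl_iff, not_or, not_not] at hn
  have h1 : y ∈ frontier U := by
    rw [hU.frontier_eq]
    exact ⟨hn.2, hn.1⟩
  have h2 := infDist_le_dist_of_mem (x := x) h1
  rw [mem_ball, dist_comm] at hy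
  linarith

lemma infDist_frontier_pos {U : Set R2} (hU : IsOpen U) (hb : Bornology.IsBounded U) {x : R2}
    (hx : x ∈ U) : 0 < infDist x (frontier U) := by
  have hne : (frontier U).Nonempty := by
    rw [nonempty_frontier_iff]
    refine ⟨⟨x, hx⟩, ?_⟩
    rintro rfl
    exact NormedSpace.unbounded_univ ℝ R2 hb
  rw [← isClosed_frontier.notMem_iff_infDist_pos hne, hU.frontier_eq]
  exact fun h => h.2 hx

section transfer
variable (f : ℂ ≃ₗᵢ[ℝ] R2) (ψ : R2 → ℝ)

lemma fderiv_comp_isometry (x : ℂ) :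
    fderiv ℝ (ψ ∘ f) x = (fderiv ℝ ψ (f x)).comp (f.toContinuousLinearEquiv : ℂ →L[ℝ] R2) :=
  f.toContinuousLinearEquiv.comp_right_fderiv

lemma gradient_comp_isometry (x : ℂ) : gradient (ψ ∘ f) x = f.symm (gradient ψ (f x)) := by
  refine ext_inner_right ℝ fun v => ?_
  have h1 : ⟪f.symm (gradient ψ (f x)), v⟫ = ⟪gradient ψ (f x), f v⟫ := by
    rw [← f.inner_map_map, f.apply_symm_apply]
  rw [h1, gradient, gradient, InnerProductSpace.toDual_symm_apply,
    InnerProductSpace.toDual_symm_apply, fderiv_comp_isometry]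
  rfl

variable {ψ}

/-- Second differentiability and the bound on the Hessian are invariant under isometries. -/
lemma hessian_of_comp_isometry {x : R2} {K : ℝ} (h1 : DifferentiableAt ℝ (ψ ∘ f) (f.symm x))
    (h2 : DifferentiableAt ℝ (fderiv ℝ (ψ ∘ f)) (f.symm x))
    (h3 : ‖fderiv ℝ (fderiv ℝ (ψ ∘ f)) (f.symm x)‖ ≤ K) :
    DifferentiableAt ℝ ψ x ∧ DifferentiableAt ℝ (fderiv ℝ ψ) x ∧ ‖fderiv ℝ (fderiv ℝ ψ) x‖ ≤ K := by
  set S : R2 →L[ℝ] ℂ := (f.symm.toContinuousLinearEquiv : R2 →L[ℝ] ℂ) with hS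
  have hSv : ∀ v, S v = f.symm v := fun v => rfl
  set T : (ℂ →L[ℝ] ℝ) →L[ℝ] (R2 →L[ℝ] ℝ) := (ContinuousLinearMap.compL ℝ R2 ℂ ℝ).flip S with hT
  have hTv : ∀ l, T l = l.comp S := fun l => rfl
  have hT1 : ∀ l, ‖T l‖ ≤ ‖l‖ := by
    intro l
    refine ContinuousLinearMap.opNorm_le_bound _ (norm_nonneg _) fun v => ?_
    rw [hTv, ContinuousLinearMap.comp_apply]
    simpa [hSv] using l.le_opNorm (S v)
  have e1 : ψ = (ψ ∘ f) ∘ S := by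
    funext y
    simp [hSv]
  have e2 : fderiv ℝ ψ = fun y => T (fderiv ℝ (ψ ∘ f) (S y)) := by
    funext y
    rw [fderiv_comp_isometry, hTv, hSv, f.apply_symm_apply]
    ext v
    simp [hSv]
  have hd1 : DifferentiableAt ℝ ψ x := by
    rw [e1]
    exact DifferentiableAt.comp x h1 S.differentiableAt
  have hd2 : HasFDerivAt (fderiv ℝ ψ)
      (T ∘L (fderiv ℝ (fderiv ℝ (ψ ∘ f)) (f.symm x) ∘L S)) x := by
    rw [e2]
    exact T.hasFDerivAt.comp x (HasFDerivAt.comp x (g := fderiv ℝ (ψ ∘ f)) h2.hasFDerivAt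
      S.hasFDerivAt)
  refine ⟨hd1, hd2.differentiableAt, ?_⟩
  rw [hd2.fderiv]
  have hK : 0 ≤ K := le_trans (norm_nonneg (fderiv ℝ (fderiv ℝ (ψ ∘ f)) (f.symm x))) h3
  refine ContinuousLinearMap.opNorm_le_bound _ hK fun v => ?_
  rw [ContinuousLinearMap.comp_apply, ContinuousLinearMap.comp_apply]
  refine (hT1 _).trans ((ContinuousLinearMap.le_of_opNorm_le _ h3 _).trans_eq ?_)
  rw [hSv, f.symm.norm_map]

lemma transportPotential_comp_isometry {U₁ U₂ : Set R2} (h₁ : IsOpen U₁) (h₂ : IsOpen U₂)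
    (hc₁ : Convex ℝ U₁) (hc₂ : Convex ℝ U₂) (hb₁ : Bornology.IsBounded U₁)
    (hb₂ : Bornology.IsBounded U₂) (hv₁ : volume U₁ = 1) (hv₂ : volume U₂ = 1)
    (hψ : IsOTPotential U₁ U₂ ψ) : TransportPotential (ψ ∘ f) (f ⁻¹' U₁) (f ⁻¹' U₂) := by
  obtain ⟨hconv, hsub, hmap⟩ := hψ
  have hmp : MeasurePreserving f := f.measurePreserving
  have hmp' : MeasurePreserving f.symm := f.symm.measurePreserving
  have hgm : AEMeasurable (fun x => gradient ψ x) (volume.restrict U₁) := by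
    by_contra hn
    rw [Measure.map_of_not_aemeasurable hn] at hmap
    have h3 : (volume.restrict U₂) univ = 1 := by rw [Measure.restrict_apply_univ, hv₂]
    rw [← hmap] at h3
    simp at h3
  refine ⟨?_, ?_, ?_, h₁.preimage f.continuous, h₂.preimage f.continuous,
    hc₁.linear_preimage f.toLinearEquiv.toLinearMap,
    hc₂.linear_preimage f.toLinearEquiv.toLinearMap,
    f.antilipschitz.isBounded_preimage hb₁, f.antilipschitz.isBounded_preimage hb₂, ?_, ?_⟩
  · exact hconv.comp_linearMap f.toLinearEquiv.toLinearMap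
  · intro x p hp
    have h4 : f p ∈ closure U₂ := by
      refine hsub (f x) (f p) fun y => ?_
      have h5 := hp (f.symm y)
      rw [← f.inner_map_map, map_sub, f.apply_symm_apply] at h5
      simpa using h5
    have h6 := f.toHomeomorph.preimage_closure U₂
    exact h6.subset h4
  · have e1 : gradient (ψ ∘ f) = fun x => f.symm (gradient ψ (f x)) :=
      funext (gradient_comp_isometry f ψ)
    have r1 := hmp.restrict_preimage h₁.measurableSet
    have r2 := hmp'.restrict_preimage (h₂.preimage f.continuous).measurableSet
    have hpre : f.symm ⁻¹' (f ⁻¹' U₂) = U₂ := by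
      ext y
      simp
    rw [hpre] at r2
    rw [e1, ← r2.map_eq, ← hmap, ← r1.map_eq]
    rw [← r1.map_eq] at hgm
    rw [AEMeasurable.map_map_of_aemeasurable hgm hmp.measurable.aemeasurable,
      AEMeasurable.map_map_of_aemeasurable hmp'.measurable.aemeasurable
        (hgm.comp_measurable hmp.measurable)]
    rfl
  · rw [hmp.measure_preimage h₁.measurableSet.nullMeasurableSet, hv₁]
  · rw [hmp.measure_preimage h₂.measurableSet.nullMeasurableSet, hv₂]

end transfer

end PlanarOT

/-- pointwise `W^{2,p}`-type estimate for potentials of optimal transport maps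
between bounded convex planar domains of area 1:
`‖D²ψ(x)‖ ≤ C(ε) dist(x, ∂U₁)^{-ε}` with `C(ε)` depending only on `ε` and the diameters. -/
theorem stmt_0 :
    ∀ ε : ℝ, 0 < ε → ∀ d₁ d₂ : ℝ, ∃ C : ℝ, 0 < C ∧
      ∀ (U₁ U₂ : Set R2) (ψ : R2 → ℝ),
        IsOpen U₁ → IsOpen U₂ → Convex ℝ U₁ → Convex ℝ U₂ →
        Bornology.IsBounded U₁ → Bornology.IsBounded U₂ →
        MeasureTheory.volume U₁ = 1 → MeasureTheory.volume U₂ = 1 →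
        Metric.diam U₁ = d₁ → Metric.diam U₂ = d₂ →
        IsOTPotential U₁ U₂ ψ →
        ∀ x ∈ U₁,
          DifferentiableAt ℝ ψ x ∧ DifferentiableAt ℝ (fderiv ℝ ψ) x ∧
          ‖fderiv ℝ (fderiv ℝ ψ) x‖ ≤ C * Metric.infDist x (frontier U₁) ^ (-ε) := by
  intro ε hε d₁ d₂
  obtain ⟨C, hC, h⟩ := PlanarOT.exists_hessian_constant hε (le_max_left 1 (max d₁ d₂))
  refine ⟨C, hC, fun U₁ U₂ ψ h₁ h₂ hc₁ hc₂ hb₁ hb₂ hv₁ hv₂ hd₁ hd₂ hψ x hx => ?_⟩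
  set f : ℂ ≃ₗᵢ[ℝ] R2 := Complex.orthonormalBasisOneI.repr
  have hdiam : ∀ U : Set R2, diam (f ⁻¹' U) = diam U := fun U => by
    rw [← f.isometry.diam_image, image_preimage_eq _ f.surjective]
  have hball : ball (f.symm x) (infDist x (frontier U₁)) ⊆ f ⁻¹' U₁ := by
    intro y hy
    refine PlanarOT.ball_infDist_frontier_subset h₁ hx ?_
    rw [mem_ball] at hy ⊢
    rwa [← f.dist_map, f.apply_symm_apply] at hy
  obtain ⟨k₁, k₂, k₃⟩ := h (ψ ∘ f) (f ⁻¹' U₁) (f ⁻¹' U₂)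
    (PlanarOT.transportPotential_comp_isometry f h₁ h₂ hc₁ hc₂ hb₁ hb₂ hv₁ hv₂ hψ)
    (by rw [hdiam, hd₁]; exact (le_max_left _ _).trans (le_max_right _ _))
    (by rw [hdiam, hd₂]; exact (le_max_right _ _).trans (le_max_right _ _))
    (f.symm x) _ (PlanarOT.infDist_frontier_pos h₁ hb₁ hx) hball
  exact PlanarOT.hessian_of_comp_isometry f k₁ k₂ k₃
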